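/- arXiv:2108.07643 — 4 statements merged into one kernel-verified Lean document; each statement's English description precedes it below -/
import Mathlib

section
/- Let Ω ⊂ ℝ² be open, bounded and simply connected with real analytic boundary ∂Ω; let t and n denote the unit tangent and outward unit normal vector fields on ∂Ω. For h ∈ C¹(∂Ω) define (Hh)(v) := (1/π) lim_{ε→0} ∫_{∂Ω∖B_ε(v)} h(w) · [t(v)·(v−w)] / |v−w|² dw for v ∈ ∂Ω (arclength integral, B_ε(v) the Euclidean ball of radius ε about v). Let f,h ∈ C¹(∂Ω). If f − Hh is real analytic on ∂Ω, then there exists an open connected set U ⊂ ℝ² with cl(Ω) ⊂ U and a vector field B ∈ C¹(U∖cl(Ω);ℝ²) ∩ C(U∖Ω;ℝ²) with div B = 0 and curl B = 0 on U∖cl(Ω), B·t = f and B·n = h on ∂Ω. -/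
open MeasureTheory Filter Topology Set

/-- Partial derivative in the first coordinate. -/
noncomputable def pdx (F : ℝ × ℝ → ℝ) (p : ℝ × ℝ) : ℝ :=
  deriv (fun x => F (x, p.2)) p.1

/-- Partial derivative in the second coordinate. -/
noncomputable def pdy (F : ℝ × ℝ → ℝ) (p : ℝ × ℝ) : ℝ :=
  deriv (fun y => F (p.1, y)) p.2

/-- Planar divergence of a vector field. -/
noncomputable def divg (B : ℝ × ℝ → ℝ × ℝ) (p : ℝ × ℝ) : ℝ :=
  pdx (fun q => (B q).1) p + pdy (fun q => (B q).2) p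

/-- Planar (scalar) curl of a vector field. -/
noncomputable def curl2 (B : ℝ × ℝ → ℝ × ℝ) (p : ℝ × ℝ) : ℝ :=
  pdx (fun q => (B q).2) p - pdy (fun q => (B q).1) p

/-- Euclidean dot product on `ℝ × ℝ`. -/
def dot (u v : ℝ × ℝ) : ℝ := u.1 * v.1 + u.2 * v.2

/-- Euclidean norm on `ℝ × ℝ`. -/
noncomputable def enorm2 (v : ℝ × ℝ) : ℝ := Real.sqrt (v.1 ^ 2 + v.2 ^ 2)

lemma exists_local_complexification {φ : ℝ → ℂ} {s₀ : ℝ} (h : AnalyticAt ℝ φ s₀) :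
    ∃ (G : ℂ → ℂ) (ρ : ℝ), 0 < ρ ∧ DifferentiableOn ℂ G (Metric.ball (s₀ : ℂ) ρ) ∧
      ∀ s ∈ Metric.ball s₀ ρ, G (s : ℂ) = φ s := by
  obtain ⟨p, r, hp⟩ := h
  set q : FormalMultilinearSeries ℂ ℂ ℂ := FormalMultilinearSeries.ofScalars ℂ (fun n => p.coeff n)
    with hq
  have hrad : q.radius = p.radius := by
    unfold FormalMultilinearSeries.radius
    have : ∀ n, ‖q n‖ = ‖p n‖ := by
      intro n
      rw [hq, FormalMultilinearSeries.ofScalars_norm,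
        FormalMultilinearSeries.norm_apply_eq_norm_coef]
    simp only [this]
  obtain ⟨ρ, hρ0, hρ⟩ := ENNReal.lt_iff_exists_nnreal_btwn.1 hp.r_pos
  have hρ0' : 0 < ρ := by exact_mod_cast hρ0
  have hqr : (ρ : ENNReal) < q.radius := by rw [hrad]; exact hρ.trans_le hp.r_le
  have hqb := q.hasFPowerSeriesOnBall (pos_of_gt hqr)
  refine ⟨fun ζ => q.sum (ζ - s₀), ρ, by exact_mod_cast hρ0', ?_, ?_⟩
  · intro ζ hζ
    have : DifferentiableAt ℂ q.sum (ζ - s₀) := by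
      refine (hqb.analyticAt_of_mem ?_).differentiableAt
      rw [Metric.mem_ball, dist_eq_norm] at hζ
      rw [Metric.mem_eball, edist_zero_right]
      refine lt_trans ?_ hqr
      rw [enorm_eq_nnnorm, ENNReal.coe_lt_coe, ← NNReal.coe_lt_coe]
      exact hζ
    exact (this.comp ζ (differentiableAt_id.sub_const _)).differentiableWithinAt
  · intro s hs
    have h1 : HasSum (fun n => p n fun _ => s - s₀) (φ s) := by
      have := hp.hasSum_sub (y := s) ?_
      · exact this
      · rw [Metric.mem_ball, dist_eq_norm] at hs
        rw [Metric.mem_eball, edist_eq_enorm_sub]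
        refine lt_trans ?_ hρ
        rw [enorm_eq_nnnorm, ENNReal.coe_lt_coe, ← NNReal.coe_lt_coe]
        exact hs
    rw [← h1.tsum_eq]
    simp only [FormalMultilinearSeries.sum]
    congr 1
    ext n
    simp only [hq, FormalMultilinearSeries.apply_eq_pow_smul_coeff]
    rw [smul_eq_mul, mul_comm]
    simp [Complex.real_smul, mul_comm]

/-- The complexification of a function on the real line, through its Taylor coefficients. -/
noncomputable def complexify (φ : ℝ → ℂ) (ζ : ℂ) : ℂ :=
  ∑' n : ℕ, (n.factorial : ℂ)⁻¹ * iteratedDeriv n φ ζ.re * (ζ.im * Complex.I) ^ n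

lemma complexify_ofReal (φ : ℝ → ℂ) (s : ℝ) : complexify φ s = φ s := by
  unfold complexify
  rw [tsum_eq_single 0]
  · simp
  · intro n hn
    simp [hn]

lemma complexify_periodic {φ : ℝ → ℂ} {T : ℝ} (h : Function.Periodic φ T) :
    Function.Periodic (complexify φ) (T : ℂ) := by
  intro ζ
  unfold complexify
  congr 1
  ext n
  have : iteratedDeriv n φ (ζ + T).re = iteratedDeriv n φ ζ.re := by
    have h2 : (fun x => φ (x + T)) = φ := funext h
    have := congrFun (iteratedDeriv_comp_add_const n φ T) ζ.re
    rw [h2] at this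
    simp [this]
  rw [this]
  simp

lemma analyticAt_complexify {φ : ℝ → ℂ} {s₀ : ℝ} (h : AnalyticAt ℝ φ s₀) :
    AnalyticAt ℂ (complexify φ) s₀ := by
  obtain ⟨G, ρ, hρ, hG, hGφ⟩ := exists_local_complexification h
  have hGa : ∀ ζ ∈ Metric.ball (s₀ : ℂ) ρ, AnalyticAt ℂ G ζ := fun ζ hζ =>
    hG.analyticAt (Metric.isOpen_ball.mem_nhds hζ)
  have hmem : ∀ s ∈ Metric.ball s₀ ρ, (s : ℂ) ∈ Metric.ball (s₀ : ℂ) ρ := by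
    intro s hs
    rw [Metric.mem_ball, Complex.dist_of_im_eq (by simp)]
    simpa using hs
  have hder : ∀ n, ∀ s ∈ Metric.ball s₀ ρ, iteratedDeriv n φ s = iteratedDeriv n G s := by
    intro n
    induction n with
    | zero => intro s hs; simp [hGφ s hs]
    | succ k ih =>
      intro s hs
      rw [iteratedDeriv_succ, iteratedDeriv_succ]
      have h1 : iteratedDeriv k φ =ᶠ[𝓝 s] fun x : ℝ => iteratedDeriv k G x := by
        filter_upwards [Metric.isOpen_ball.mem_nhds hs] with x hx using ih x hx
      rw [h1.deriv_eq]
      have h2 : AnalyticAt ℂ (iteratedDeriv k G) s := by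
        rw [iteratedDeriv_eq_iterate]
        exact (hGa _ (hmem s hs)).iterated_deriv k
      exact h2.differentiableAt.hasDerivAt.comp_ofReal.deriv
  have : G =ᶠ[𝓝 (s₀ : ℂ)] complexify φ := by
    filter_upwards [Metric.ball_mem_nhds (s₀ : ℂ) (half_pos hρ)] with ζ hζ
    rw [Metric.mem_ball, dist_eq_norm] at hζ
    have hre : |ζ.re - s₀| < ρ / 2 := by
      refine lt_of_le_of_lt ?_ hζ
      simpa using Complex.abs_re_le_norm (ζ - s₀)
    have him : |ζ.im| < ρ / 2 := by
      refine lt_of_le_of_lt ?_ hζ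
      simpa using Complex.abs_im_le_norm (ζ - s₀)
    have hζ' : ζ = (ζ.re : ℂ) + ζ.im * Complex.I := (Complex.re_add_im ζ).symm
    have hsub : Metric.ball (ζ.re : ℂ) (ρ / 2) ⊆ Metric.ball (s₀ : ℂ) ρ := by
      apply Metric.ball_subset_ball'
      rw [Complex.dist_of_im_eq (by simp)]
      simp only [Complex.ofReal_re, Real.dist_eq]
      linarith
    have h3 := Complex.taylorSeries_eq_on_ball' (c := (ζ.re : ℂ)) (r := ρ / 2) (z := ζ)
      (by
        rw [Metric.mem_ball, dist_eq_norm]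
        have : ζ - ζ.re = ζ.im * Complex.I := by linear_combination hζ'
        rw [this]; simpa using him) (hG.mono hsub)
    rw [← h3]
    unfold complexify
    congr 1
    ext n
    rw [hder n ζ.re (by rw [Metric.mem_ball, Real.dist_eq]; linarith)]
    have : ζ - ζ.re = ζ.im * Complex.I := by linear_combination hζ'
    rw [this]
  exact (hGa _ (Metric.mem_ball_self hρ)).congr this

lemma exists_reduce_mod_two_pi (ζ : ℂ) :
    ∃ n : ℤ, (ζ + n * (2 * Real.pi : ℝ)).re ∈ Icc 0 (2 * Real.pi) ∧
      (ζ + n * (2 * Real.pi : ℝ)).im = ζ.im := by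
  have h2 := Real.two_pi_pos
  refine ⟨-⌊ζ.re / (2 * Real.pi)⌋, ?_, by simp⟩
  have h3 := Int.floor_le (ζ.re / (2 * Real.pi))
  have h4 := Int.lt_floor_add_one (ζ.re / (2 * Real.pi))
  rw [le_div_iff₀ h2] at h3
  rw [div_lt_iff₀ h2] at h4
  have : (ζ + (-⌊ζ.re / (2 * Real.pi)⌋ : ℤ) * (2 * Real.pi : ℝ)).re
      = ζ.re - ⌊ζ.re / (2 * Real.pi)⌋ * (2 * Real.pi) := by
    simp [sub_eq_add_neg]
  rw [this]
  constructor <;> linarith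

lemma exists_strip_subset {W : Set ℂ} (hW : IsOpen W) (hR : ∀ s : ℝ, (s : ℂ) ∈ W)
    (hper : ∀ ζ : ℂ, ∀ n : ℤ, ζ + n * (2 * Real.pi : ℝ) ∈ W → ζ ∈ W) :
    ∃ r > 0, ∀ ζ : ℂ, |ζ.im| < r → ζ ∈ W := by
  have hK : IsCompact ((fun s : ℝ => (s : ℂ)) '' Icc 0 (2 * Real.pi)) :=
    isCompact_Icc.image Complex.continuous_ofReal
  obtain ⟨δ, hδ, hsub⟩ := hK.exists_thickening_subset_open hW (by rintro _ ⟨s, -, rfl⟩; exact hR s)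
  refine ⟨δ, hδ, fun ζ hζ => ?_⟩
  obtain ⟨n, hn, hi⟩ := exists_reduce_mod_two_pi ζ
  refine hper ζ n (hsub ?_)
  rw [Metric.mem_thickening_iff]
  refine ⟨_, ⟨_, hn, rfl⟩, ?_⟩
  rw [Complex.dist_of_re_eq (by simp), Complex.ofReal_im, hi, Real.dist_eq, sub_zero]
  exact hζ

lemma exists_strip_prod_subset {W : Set (ℂ × ℂ)} (hW : IsOpen W)
    (hR : ∀ s t : ℝ, ((s : ℂ), (t : ℂ)) ∈ W)
    (hper : ∀ ζ w : ℂ, ∀ n m : ℤ,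
      (ζ + n * (2 * Real.pi : ℝ), w + m * (2 * Real.pi : ℝ)) ∈ W → (ζ, w) ∈ W) :
    ∃ r > 0, ∀ ζ w : ℂ, |ζ.im| < r → |w.im| < r → (ζ, w) ∈ W := by
  have hK : IsCompact ((fun s : ℝ => (s : ℂ)) '' Icc 0 (2 * Real.pi)) :=
    isCompact_Icc.image Complex.continuous_ofReal
  obtain ⟨δ, hδ, hsub⟩ := (hK.prod hK).exists_thickening_subset_open hW
    (by rintro ⟨_, _⟩ ⟨⟨s, -, rfl⟩, ⟨t, -, rfl⟩⟩; exact hR s t)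
  refine ⟨δ, hδ, fun ζ w hζ hw => ?_⟩
  obtain ⟨n, hn, hi⟩ := exists_reduce_mod_two_pi ζ
  obtain ⟨m, hm, hj⟩ := exists_reduce_mod_two_pi w
  refine hper ζ w n m (hsub ?_)
  rw [Metric.mem_thickening_iff]
  refine ⟨(_, _), ⟨⟨_, hn, rfl⟩, ⟨_, hm, rfl⟩⟩, ?_⟩
  rw [Prod.dist_eq]
  refine max_lt ?_ ?_
  · rw [Complex.dist_of_re_eq (by simp), hi, Real.dist_eq]
    simpa using hζ
  · rw [Complex.dist_of_re_eq (by simp), hj, Real.dist_eq]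
    simpa using hw

/-- A `2π`-periodic map of the plane, holomorphic and locally invertible in the strip `|Im ζ| < r`,
and injective there modulo its period. -/
structure StripMap (Γ : ℂ → ℂ) (r : ℝ) : Prop where
  pos : 0 < r
  per : Function.Periodic Γ ((2 * Real.pi : ℝ) : ℂ)
  an : ∀ ζ : ℂ, |ζ.im| < r → AnalyticAt ℂ Γ ζ
  deriv_ne : ∀ ζ : ℂ, |ζ.im| < r → deriv Γ ζ ≠ 0
  inj : ∀ ζ w : ℂ, |ζ.im| < r → |w.im| < r → Γ ζ = Γ w →
    ∃ n : ℤ, ζ = w + n * (2 * Real.pi : ℝ)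

lemma Function.Periodic.add_int_mul_two_pi {Γ : ℂ → ℂ}
    (h : Function.Periodic Γ ((2 * Real.pi : ℝ) : ℂ)) (ζ : ℂ) (n : ℤ) :
    Γ (ζ + n * (2 * Real.pi : ℝ)) = Γ ζ := h.int_mul n ζ

lemma periodic_deriv {Γ : ℂ → ℂ} {T : ℂ} (h : Function.Periodic Γ T) :
    Function.Periodic (deriv Γ) T := by
  intro ζ
  have h2 : (fun x => Γ (x + T)) = Γ := funext h
  have := deriv_comp_add_const Γ T ζ
  rw [h2] at this
  exact this.symm

lemma analyticAt_add_int_mul_two_pi {Γ : ℂ → ℂ}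
    (h : Function.Periodic Γ ((2 * Real.pi : ℝ) : ℂ)) {ζ : ℂ} (n : ℤ)
    (ha : AnalyticAt ℂ Γ (ζ + n * (2 * Real.pi : ℝ))) : AnalyticAt ℂ Γ ζ := by
  have h1 : Γ = fun x => Γ (x + n * (2 * Real.pi : ℝ)) :=
    funext fun x => (h.add_int_mul_two_pi x n).symm
  rw [h1]
  exact ha.comp_of_eq (by fun_prop) rfl

lemma exists_strip_analyticAt {Γ : ℂ → ℂ} (h : Function.Periodic Γ ((2 * Real.pi : ℝ) : ℂ))
    (ha : ∀ s : ℝ, AnalyticAt ℂ Γ s) : ∃ r > 0, ∀ ζ : ℂ, |ζ.im| < r → AnalyticAt ℂ Γ ζ :=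
  exists_strip_subset (isOpen_analyticAt ℂ Γ) ha
    fun _ n hn => analyticAt_add_int_mul_two_pi h n hn

lemma injOn_mod_of_injOn_Ico {c : ℝ → ℂ} (hper : Function.Periodic c (2 * Real.pi))
    (hinj : InjOn c (Ico 0 (2 * Real.pi))) {s t : ℝ} (h : c s = c t) :
    ∃ n : ℤ, s = t + n * (2 * Real.pi) := by
  have h1 := toIcoMod_mem_Ico Real.two_pi_pos 0 s
  have h2 := toIcoMod_mem_Ico Real.two_pi_pos 0 t
  rw [zero_add] at h1 h2
  have e1 := toIcoMod_add_toIcoDiv_zsmul Real.two_pi_pos 0 s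
  have e2 := toIcoMod_add_toIcoDiv_zsmul Real.two_pi_pos 0 t
  have f1 : c (toIcoMod Real.two_pi_pos 0 s) = c s := by
    conv_rhs => rw [← e1, zsmul_eq_mul]
    exact (hper.int_mul _ _).symm
  have f2 : c (toIcoMod Real.two_pi_pos 0 t) = c t := by
    conv_rhs => rw [← e2, zsmul_eq_mul]
    exact (hper.int_mul _ _).symm
  have h3 := hinj h1 h2 (by rw [f1, f2, h])
  refine ⟨toIcoDiv Real.two_pi_pos 0 s - toIcoDiv Real.two_pi_pos 0 t, ?_⟩
  rw [zsmul_eq_mul] at e1 e2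
  push_cast
  linarith

lemma exists_stripMap {c : ℝ → ℂ} (han : AnalyticOnNhd ℝ c univ)
    (hper : Function.Periodic c (2 * Real.pi)) (hreg : ∀ s, deriv c s ≠ 0)
    (hinj : InjOn c (Ico 0 (2 * Real.pi))) :
    ∃ r, StripMap (complexify c) r := by
  set Γ := complexify c with hΓ
  have hP : Function.Periodic Γ ((2 * Real.pi : ℝ) : ℂ) := complexify_periodic hper
  have ha : ∀ s : ℝ, AnalyticAt ℂ Γ s := fun s => analyticAt_complexify (han s trivial)
  have hd : ∀ s : ℝ, deriv Γ s ≠ 0 := by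
    intro s
    have := (ha s).differentiableAt.hasDerivAt.comp_ofReal.deriv
    simp only [hΓ, complexify_ofReal] at this
    rw [hΓ, ← this]
    exact hreg s
  obtain ⟨r₁, hr₁, h₁⟩ := exists_strip_analyticAt hP ha
  obtain ⟨r₂, hr₂, h₂⟩ := exists_strip_subset
    (W := {ζ | AnalyticAt ℂ Γ ζ ∧ deriv Γ ζ ≠ 0}) (by
      rw [isOpen_iff_mem_nhds]
      rintro ζ ⟨h1, h2⟩
      exact h1.eventually_analyticAt.and (h1.deriv.continuousAt.eventually_ne h2))
    (fun s => ⟨ha s, hd s⟩)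
    (fun ζ n hn => ⟨analyticAt_add_int_mul_two_pi hP n hn.1, by
      have := hn.2
      rwa [(periodic_deriv hP).add_int_mul_two_pi] at this⟩)
  obtain ⟨r₃, hr₃, h₃⟩ := exists_strip_prod_subset
    (W := {p | ∀ᶠ q : ℂ × ℂ in 𝓝 p, Γ q.1 = Γ q.2 → ∃ n : ℤ, q.1 = q.2 + n * (2 * Real.pi : ℝ)})
    (isOpen_setOfPred_eventually_nhds) (by
      intro s t
      by_cases hst : Γ s = Γ t
      · rw [hΓ, complexify_ofReal, complexify_ofReal] at hst
        obtain ⟨n, hn⟩ := injOn_mod_of_injOn_Ico hper hinj hst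
        have hloc : ∀ᶠ q : ℂ × ℂ in 𝓝 ((s : ℂ), (s : ℂ)), Γ q.1 = Γ q.2 → q.1 = q.2 := by
          have hstr : HasStrictDerivAt Γ (deriv Γ s) (s : ℂ) :=
            (ha s).hasStrictDerivAt
          have := (hstr.hasStrictFDerivAt_equiv (hd s)).eventually_left_inverse
          have hl := (((continuous_fst (X := ℂ) (Y := ℂ)).tendsto ((s : ℂ), (s : ℂ))).eventually
            this).and (((continuous_snd (X := ℂ) (Y := ℂ)).tendsto ((s : ℂ), (s : ℂ))).eventually
            this)
          filter_upwards [hl] with q hq heq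
          rw [← hq.1, ← hq.2, heq]
        have hcont : Tendsto (fun q : ℂ × ℂ => (q.1, q.2 + n * (2 * Real.pi : ℝ)))
            (𝓝 ((s : ℂ), (t : ℂ))) (𝓝 ((s : ℂ), (s : ℂ))) := by
          have : Continuous (fun q : ℂ × ℂ => (q.1, q.2 + n * (2 * Real.pi : ℝ))) := by fun_prop
          convert this.tendsto ((s : ℂ), (t : ℂ)) using 2
          rw [hn]; push_cast; rfl
        filter_upwards [hcont.eventually hloc] with q hq heq
        refine ⟨n, hq ?_⟩
        rw [hP.add_int_mul_two_pi]
        exact heq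
      · have : ContinuousAt (fun q : ℂ × ℂ => Γ q.1 - Γ q.2) ((s : ℂ), (t : ℂ)) :=
          ((ha s).continuousAt.comp_of_eq continuousAt_fst rfl).sub
            ((ha t).continuousAt.comp_of_eq continuousAt_snd rfl)
        filter_upwards [this.eventually_ne (sub_ne_zero.2 hst)] with q hq heq
        exact absurd (sub_eq_zero.2 heq) hq)
    (by
      intro ζ w n m hnm
      have hcont : Continuous (fun q : ℂ × ℂ =>
        (q.1 + n * (2 * Real.pi : ℝ), q.2 + m * (2 * Real.pi : ℝ))) := by fun_prop
      have := (hcont.tendsto (ζ, w)).eventually hnm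
      simp only [mem_ofPred_eq]
      filter_upwards [this] with q hq heq
      obtain ⟨k, hk⟩ := hq (by simpa only [hP.add_int_mul_two_pi] using heq)
      refine ⟨k + m - n, ?_⟩
      push_cast at hk ⊢
      linear_combination hk)
  refine ⟨min r₂ r₃, lt_min hr₂ hr₃, hP, fun ζ hζ => (h₂ ζ (hζ.trans_le (min_le_left _ _))).1,
    fun ζ hζ => (h₂ ζ (hζ.trans_le (min_le_left _ _))).2, fun ζ w hζ hw heq => ?_⟩
  exact (h₃ ζ w (hζ.trans_le (min_le_right _ _)) (hw.trans_le (min_le_right _ _))).self_of_nhds heq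

lemma analyticAt_intervalIntegral_of_cauchy {k : ℂ → ℝ → ℂ} {c : ℂ} {R a b : ℝ} (hR : 0 < R)
    (hab : a ≤ b) (hc : ContinuousOn (Function.uncurry k) (Metric.sphere c R ×ˢ Icc a b))
    (hk : ∀ ζ ∈ Metric.ball c R, ∀ᵐ σ : ℝ, σ ∈ Icc a b →
      k ζ σ = (2 * Real.pi * Complex.I : ℂ)⁻¹ • ∮ w in C(c, R), (w - ζ)⁻¹ • k w σ) :
    AnalyticAt ℂ (fun ζ => ∫ σ in a..b, k ζ σ) c := by
  set K : ℝ → ℝ → ℂ := fun θ σ => k (circleMap c R θ) (projIcc a b hab σ) with hK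
  have hKc : Continuous (Function.uncurry K) := by
    have : Continuous fun p : ℝ × ℝ => (circleMap c R p.1, (projIcc a b hab p.2 : ℝ)) := by fun_prop
    exact hc.comp_continuous this
      fun p => ⟨circleMap_mem_sphere c hR.le p.1, (projIcc a b hab p.2).2⟩
  have hKk : ∀ θ, ∀ σ ∈ Icc a b, k (circleMap c R θ) σ = K θ σ := by
    intro θ σ hσ
    simp [hK, projIcc_of_mem hab hσ]
  have hφ : ∀ θ, (∫ σ in a..b, k (circleMap c R θ) σ) = ∫ σ in a..b, K θ σ := fun θ =>
    intervalIntegral.integral_congr fun σ hσ => hKk θ σ (by rwa [uIcc_of_le hab] at hσ)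
  have hInt : CircleIntegrable (fun w => ∫ σ in a..b, k w σ) c R := by
    unfold CircleIntegrable
    simp only [hφ]
    exact (intervalIntegral.continuous_parametric_intervalIntegral_of_continuous'
      hKc a b).intervalIntegrable _ _
  have hpow := hasFPowerSeriesOn_cauchy_integral (R := ⟨R, hR.le⟩) hInt hR
  refine hpow.analyticAt.congr ?_
  filter_upwards [Metric.ball_mem_nhds c hR] with ζ hζ
  have hne : ∀ θ, circleMap c R θ - ζ ≠ 0 := fun θ h0 => by
    have h1 := circleMap_mem_sphere c hR.le θ
    rw [sub_eq_zero.1 h0] at h1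
    exact (Metric.mem_ball.1 hζ).ne (Metric.mem_sphere.1 h1)
  have h1 : (∫ σ in a..b, k ζ σ) = ∫ σ in a..b, (2 * Real.pi * Complex.I : ℂ)⁻¹ •
      ∫ θ in (0 : ℝ)..2 * Real.pi, deriv (circleMap c R) θ • (circleMap c R θ - ζ)⁻¹ • K θ σ := by
    refine intervalIntegral.integral_congr_ae ?_
    filter_upwards [hk ζ hζ] with σ hσ hmem
    have hmem' : σ ∈ Icc a b := by
      rw [uIoc_of_le hab] at hmem
      exact Ioc_subset_Icc_self hmem
    rw [hσ hmem']
    unfold circleIntegral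
    simp only [hKk _ σ hmem']
  rw [h1, intervalIntegral.integral_smul, intervalIntegral_intervalIntegral_swap]
  · congr 1
    unfold circleIntegral
    refine intervalIntegral.integral_congr fun θ _ => ?_
    simp only [intervalIntegral.integral_smul]
    rw [← hφ]
    rfl
  · have hcont : Continuous (Function.uncurry fun (σ θ : ℝ) =>
        deriv (circleMap c R) θ • (circleMap c R θ - ζ)⁻¹ • K θ σ) := by
      have h2 : Continuous fun p : ℝ × ℝ => K p.2 p.1 := hKc.comp continuous_swap
      have h3 : Continuous fun p : ℝ × ℝ => (circleMap c R p.2 - ζ)⁻¹ :=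
        Continuous.inv₀ (by fun_prop) fun p => hne p.2
      have h4 : Continuous fun p : ℝ × ℝ => deriv (circleMap c R) p.2 := by
        simp only [deriv_circleMap]; fun_prop
      exact h4.smul (h3.smul h2)
    have := hcont.continuousOn.integrableOn_compact (μ := volume)
      ((isCompact_uIcc (a := a) (b := b)).prod (isCompact_uIcc (a := 0) (b := 2 * Real.pi)))
    exact this.mono_set (prod_mono uIoc_subset_uIcc uIoc_subset_uIcc)

lemma analyticAt_integral_regular {k : ℂ → ℝ → ℂ} {c : ℂ} {V : Set ℂ} (hV : IsOpen V) (hcV : c ∈ V)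
    {a b : ℝ} (hab : a ≤ b)
    (hc : ContinuousOn (Function.uncurry k) (V ×ˢ Icc a b))
    (hd : ∀ σ ∈ Icc a b, DifferentiableOn ℂ (fun ζ => k ζ σ) V) :
    AnalyticAt ℂ (fun ζ => ∫ σ in a..b, k ζ σ) c := by
  obtain ⟨R, hR, hsub⟩ := Metric.nhds_basis_closedBall.mem_iff.1 (hV.mem_nhds hcV)
  refine analyticAt_intervalIntegral_of_cauchy hR hab
    (hc.mono (prod_mono (Metric.sphere_subset_closedBall.trans hsub) le_rfl)) ?_
  refine fun ζ hζ => Eventually.of_forall fun σ hσ => ?_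
  have h1 : DiffContOnCl ℂ (fun ζ => k ζ σ) (Metric.ball c R) := by
    refine ((hd σ hσ).mono ?_).diffContOnCl
    rwa [closure_ball c hR.ne']
  exact (h1.two_pi_i_inv_smul_circleIntegral_sub_inv_smul hζ).symm

lemma tendsto_sub_mul_div {P q : ℂ → ℂ} {c d : ℂ} (hP : HasDerivAt P d c) (h0 : P c = 0)
    (hd : d ≠ 0) (hq : ContinuousAt q c) :
    Tendsto (fun ζ => (ζ - c) * (q ζ / P ζ)) (𝓝[≠] c) (𝓝 (q c / d)) := by
  have h1 := hasDerivAt_iff_tendsto_slope.1 hP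
  have h2 := (hq.tendsto.mono_left (nhdsWithin_le_nhds (s := {c}ᶜ))).div h1 hd
  refine h2.congr' ?_
  filter_upwards [self_mem_nhdsWithin] with ζ hζ
  have : ζ - c ≠ 0 := sub_ne_zero.2 hζ
  simp only [slope, vsub_eq_sub, h0, sub_zero, smul_eq_mul, Pi.div_apply]
  by_cases h : P ζ = 0
  · simp [h]
  · field_simp

lemma exists_differentiableOn_eq_sub_div {P₁ P₂ q₁ q₂ : ℂ → ℂ} {c d₁ d₂ : ℂ} {V : Set ℂ}
    (hV : IsOpen V) (hc : c ∈ V)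
    (hP₁ : HasDerivAt P₁ d₁ c) (hP₂ : HasDerivAt P₂ d₂ c) (h₁ : P₁ c = 0) (h₂ : P₂ c = 0)
    (hd₁ : d₁ ≠ 0) (hd₂ : d₂ ≠ 0) (hq₁ : ContinuousAt q₁ c) (hq₂ : ContinuousAt q₂ c)
    (hq : q₁ c / d₁ = q₂ c / d₂)
    (hdiff : DifferentiableOn ℂ (fun ζ => q₁ ζ / P₁ ζ - q₂ ζ / P₂ ζ) (V \ {c})) :
    ∃ F : ℂ → ℂ, DifferentiableOn ℂ F V ∧ ∀ ζ ∈ V, ζ ≠ c → F ζ = q₁ ζ / P₁ ζ - q₂ ζ / P₂ ζ := by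
  set f : ℂ → ℂ := fun ζ => q₁ ζ / P₁ ζ - q₂ ζ / P₂ ζ with hf
  have ht : Tendsto (fun ζ => (ζ - c) * f ζ) (𝓝[≠] c) (𝓝 0) := by
    have := (tendsto_sub_mul_div hP₁ h₁ hd₁ hq₁).sub (tendsto_sub_mul_div hP₂ h₂ hd₂ hq₂)
    rw [hq, sub_self] at this
    refine this.congr fun ζ => ?_
    simp only [hf]; ring
  have hfc : f c = 0 := by simp [hf, h₁, h₂]
  have ho : (fun z => f z - f c) =o[𝓝[≠] c] fun z => (z - c)⁻¹ := by
    rw [hfc, Asymptotics.isLittleO_iff_tendsto']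
    · refine ht.congr fun ζ => ?_
      rw [sub_zero, div_inv_eq_mul, mul_comm]
    · filter_upwards [self_mem_nhdsWithin] with ζ hζ h
      exact absurd (sub_eq_zero.1 (inv_eq_zero.1 h)) hζ
  refine ⟨_, Complex.differentiableOn_update_limUnder_of_isLittleO (hV.mem_nhds hc) hdiff ho,
    fun ζ _ hne => ?_⟩
  rw [Function.update_of_ne hne]

/-- Half the cotangent of half the argument. -/
noncomputable def halfCot (z : ℂ) : ℂ := Complex.cos (z / 2) / 2 / Complex.sin (z / 2)

lemma sin_half_ne_zero {z : ℂ} (h : ∀ n : ℤ, z ≠ n * (2 * Real.pi : ℝ)) :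
    Complex.sin (z / 2) ≠ 0 := by
  intro h0
  obtain ⟨k, hk⟩ := Complex.sin_eq_zero_iff.1 h0
  apply h k
  push_cast
  linear_combination 2 * hk

lemma halfCot_periodic : Function.Periodic halfCot ((2 * Real.pi : ℝ) : ℂ) := by
  intro z
  unfold halfCot
  have : (z + ((2 * Real.pi : ℝ) : ℂ)) / 2 = z / 2 + Real.pi := by push_cast; ring
  rw [this, Complex.cos_add_pi, Complex.sin_add_pi]
  ring

lemma halfCot_neg (z : ℂ) : halfCot (-z) = -halfCot z := by
  unfold halfCot
  rw [neg_div, Complex.cos_neg, Complex.sin_neg, div_neg]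

lemma hasDerivAt_sin_half_sub (w ζ : ℂ) :
    HasDerivAt (fun ζ => Complex.sin ((ζ - w) / 2)) (Complex.cos ((ζ - w) / 2) / 2) ζ := by
  have h := (((hasDerivAt_id' ζ).sub_const w).div_const 2).csin
  convert h using 1
  ring

lemma hasDerivAt_sin_half_sub' (w ζ : ℂ) :
    HasDerivAt (fun w => Complex.sin ((ζ - w) / 2)) (-(Complex.cos ((ζ - w) / 2) / 2)) w := by
  have h := (((hasDerivAt_id' w).const_sub ζ).div_const 2).csin
  convert h using 1
  ring

lemma differentiableAt_halfCot {z : ℂ} (h : Complex.sin (z / 2) ≠ 0) :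
    DifferentiableAt ℂ halfCot z := by
  unfold halfCot
  fun_prop (disch := assumption)

/-- The difference of the Cauchy kernels of a closed curve and of the circle. -/
noncomputable def cauchyDiff (Γ : ℂ → ℂ) (ζ w : ℂ) : ℂ :=
  deriv Γ ζ / (Γ ζ - Γ w) - halfCot (ζ - w)

lemma ne_int_mul_of_norm_lt {z : ℂ} (h0 : z ≠ 0) (h : ‖z‖ < 2 * Real.pi) (n : ℤ) :
    z ≠ n * (2 * Real.pi : ℝ) := by
  rintro rfl
  rw [norm_mul, Complex.norm_intCast, Complex.norm_real,
    Real.norm_of_nonneg Real.two_pi_pos.le] at h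
  have h1 : |(n : ℝ)| < 1 := by
    by_contra! h2
    nlinarith [Real.two_pi_pos]
  have h2 : n = 0 := by
    have : |n| < 1 := by exact_mod_cast h1
    exact Int.abs_lt_one_iff.1 this
  simp [h2] at h0

namespace StripMap
variable {Γ : ℂ → ℂ} {r : ℝ}

lemma sub_ne_zero_of_ne (H : StripMap Γ r) {ζ w : ℂ} (hζ : |ζ.im| < r) (hw : |w.im| < r)
    (h : ∀ n : ℤ, ζ - w ≠ n * (2 * Real.pi : ℝ)) : Γ ζ - Γ w ≠ 0 := by
  intro h0
  obtain ⟨n, hn⟩ := H.inj ζ w hζ hw (sub_eq_zero.1 h0)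
  exact h n (by rw [hn]; ring)

lemma differentiableAt_cauchyDiff_left (H : StripMap Γ r) {ζ w : ℂ} (hζ : |ζ.im| < r)
    (hw : |w.im| < r) (h : ∀ n : ℤ, ζ - w ≠ n * (2 * Real.pi : ℝ)) :
    DifferentiableAt ℂ (fun ζ => cauchyDiff Γ ζ w) ζ := by
  unfold cauchyDiff
  have h1 := (H.an ζ hζ).differentiableAt
  have h2 := (H.an ζ hζ).deriv.differentiableAt
  have h3 : DifferentiableAt ℂ (fun ζ => halfCot (ζ - w)) ζ :=
    (differentiableAt_halfCot (sin_half_ne_zero h)).comp ζ (differentiableAt_id.sub_const w)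
  exact (h2.div (h1.sub_const _) (H.sub_ne_zero_of_ne hζ hw h)).sub h3

lemma differentiableAt_cauchyDiff_right (H : StripMap Γ r) {ζ w : ℂ} (hζ : |ζ.im| < r)
    (hw : |w.im| < r) (h : ∀ n : ℤ, ζ - w ≠ n * (2 * Real.pi : ℝ)) :
    DifferentiableAt ℂ (fun w => cauchyDiff Γ ζ w) w := by
  unfold cauchyDiff
  have h1 := (H.an w hw).differentiableAt
  have h3 : DifferentiableAt ℂ (fun w => halfCot (ζ - w)) w :=
    (differentiableAt_halfCot (sin_half_ne_zero h)).comp w (differentiableAt_id.const_sub ζ)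
  exact ((differentiableAt_const _).div (h1.const_sub _) (H.sub_ne_zero_of_ne hζ hw h)).sub h3

lemma continuousAt_cauchyDiff (H : StripMap Γ r) {ζ w : ℂ} (hζ : |ζ.im| < r)
    (hw : |w.im| < r) (h : ∀ n : ℤ, ζ - w ≠ n * (2 * Real.pi : ℝ)) :
    ContinuousAt (fun p : ℂ × ℂ => cauchyDiff Γ p.1 p.2) (ζ, w) := by
  unfold cauchyDiff
  have h1 : ContinuousAt (fun p : ℂ × ℂ => Γ p.1) (ζ, w) :=
    (H.an ζ hζ).continuousAt.comp_of_eq continuousAt_fst rfl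
  have h1' : ContinuousAt (fun p : ℂ × ℂ => Γ p.2) (ζ, w) :=
    (H.an w hw).continuousAt.comp_of_eq continuousAt_snd rfl
  have h2 : ContinuousAt (fun p : ℂ × ℂ => deriv Γ p.1) (ζ, w) :=
    (H.an ζ hζ).deriv.continuousAt.comp_of_eq continuousAt_fst rfl
  have h3 : ContinuousAt (fun p : ℂ × ℂ => halfCot (p.1 - p.2)) (ζ, w) :=
    (differentiableAt_halfCot (sin_half_ne_zero h)).continuousAt.comp_of_eq
      (continuousAt_fst.sub continuousAt_snd) rfl
  exact (h2.div (h1.sub h1') (H.sub_ne_zero_of_ne hζ hw h)).sub h3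

lemma cauchyDiff_add_right (H : StripMap Γ r) (ζ : ℂ) :
    Function.Periodic (cauchyDiff Γ ζ) ((2 * Real.pi : ℝ) : ℂ) := by
  intro w
  unfold cauchyDiff
  rw [H.per w]
  have : ζ - (w + ((2 * Real.pi : ℝ) : ℂ)) = ζ - w - ((2 * Real.pi : ℝ) : ℂ) := by ring
  rw [this, halfCot_periodic.sub_eq]

lemma abs_im_lt_of_mem_ball {s₀ ρ : ℝ} {ζ : ℂ} (hζ : ζ ∈ Metric.ball (s₀ : ℂ) ρ) : |ζ.im| < ρ := by
  rw [Metric.mem_ball, dist_eq_norm] at hζ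
  refine lt_of_le_of_lt ?_ hζ
  simpa using Complex.abs_im_le_norm (ζ - s₀)

lemma ne_of_mem_ball {s₀ ρ : ℝ} (hρ : ρ ≤ 1) {ζ w : ℂ} (hζ : ζ ∈ Metric.ball (s₀ : ℂ) ρ)
    (hw : w ∈ Metric.ball (s₀ : ℂ) ρ) (hne : ζ ≠ w) (n : ℤ) : ζ - w ≠ n * (2 * Real.pi : ℝ) := by
  refine ne_int_mul_of_norm_lt (sub_ne_zero.2 hne) ?_ n
  have h1 := dist_triangle_right ζ w (s₀ : ℂ)
  rw [dist_eq_norm] at h1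
  rw [Metric.mem_ball] at hζ hw
  linarith [Real.pi_gt_three]

lemma exists_extension_left (H : StripMap Γ r) {s₀ ρ : ℝ} (hρ1 : ρ ≤ 1) (hρr : ρ ≤ r)
    {w : ℂ} (hw : w ∈ Metric.ball (s₀ : ℂ) ρ) :
    ∃ F : ℂ → ℂ, DifferentiableOn ℂ F (Metric.ball (s₀ : ℂ) ρ) ∧
      ∀ ζ ∈ Metric.ball (s₀ : ℂ) ρ, ζ ≠ w → F ζ = cauchyDiff Γ ζ w := by
  have hi : ∀ {z : ℂ}, z ∈ Metric.ball (s₀ : ℂ) ρ → |z.im| < r :=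
    fun hz => (abs_im_lt_of_mem_ball hz).trans_le hρr
  have hs := hasDerivAt_sin_half_sub w w
  simp only [sub_self, zero_div, Complex.cos_zero] at hs
  refine exists_differentiableOn_eq_sub_div Metric.isOpen_ball hw
    ((H.an w (hi hw)).differentiableAt.hasDerivAt.sub_const (Γ w)) hs (sub_self _) (by simp)
    (H.deriv_ne w (hi hw)) (by norm_num) (H.an w (hi hw)).deriv.continuousAt
    (q₂ := fun ζ => Complex.cos ((ζ - w) / 2) / 2) (by fun_prop) ?_ ?_
  · rw [div_self (H.deriv_ne w (hi hw))]; simp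
  · rintro ζ ⟨hζ, hne⟩
    exact (H.differentiableAt_cauchyDiff_left (hi hζ) (hi hw)
      (ne_of_mem_ball hρ1 hζ hw hne)).differentiableWithinAt

lemma exists_extension_right (H : StripMap Γ r) {s₀ ρ : ℝ} (hρ1 : ρ ≤ 1) (hρr : ρ ≤ r)
    {ζ : ℂ} (hζ : ζ ∈ Metric.ball (s₀ : ℂ) ρ) :
    ∃ F : ℂ → ℂ, DifferentiableOn ℂ F (Metric.ball (s₀ : ℂ) ρ) ∧
      ∀ w ∈ Metric.ball (s₀ : ℂ) ρ, w ≠ ζ → F w = cauchyDiff Γ ζ w := by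
  have hi : ∀ {z : ℂ}, z ∈ Metric.ball (s₀ : ℂ) ρ → |z.im| < r :=
    fun hz => (abs_im_lt_of_mem_ball hz).trans_le hρr
  have hs := hasDerivAt_sin_half_sub' ζ ζ
  simp only [sub_self, zero_div, Complex.cos_zero] at hs
  refine exists_differentiableOn_eq_sub_div Metric.isOpen_ball hζ
    ((H.an ζ (hi hζ)).differentiableAt.hasDerivAt.const_sub (Γ ζ)) hs (sub_self _) (by simp)
    (neg_ne_zero.2 (H.deriv_ne ζ (hi hζ))) (by norm_num)
    (q₁ := fun _ => deriv Γ ζ) continuousAt_const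
    (q₂ := fun w => Complex.cos ((ζ - w) / 2) / 2) (by fun_prop) ?_ ?_
  · have := H.deriv_ne ζ (hi hζ)
    rw [div_neg, div_self this]; simp
  · rintro w ⟨hw, hne⟩
    exact (H.differentiableAt_cauchyDiff_right (hi hζ) (hi hw)
      (ne_of_mem_ball hρ1 hζ hw (Ne.symm hne))).differentiableWithinAt

lemma ofReal_mem_ball {s₀ σ ρ : ℝ} (h : |σ - s₀| < ρ) : (σ : ℂ) ∈ Metric.ball (s₀ : ℂ) ρ := by
  rw [Metric.mem_ball, Complex.dist_of_im_eq (by simp)]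
  simpa [Real.dist_eq] using h

lemma ne_of_far {s₀ σ ρ : ℝ} (hρ : ρ ≤ 1) {ζ : ℂ} (hζ : ζ ∈ Metric.ball (s₀ : ℂ) (ρ / 4))
    (h₁ : ρ / 2 ≤ |σ - s₀|) (h₂ : |σ - s₀| ≤ Real.pi) (n : ℤ) :
    ζ - σ ≠ n * (2 * Real.pi : ℝ) := by
  rw [Metric.mem_ball, dist_eq_norm] at hζ
  have e : ‖((s₀ - σ : ℝ) : ℂ)‖ = |σ - s₀| := by
    rw [Complex.norm_real, Real.norm_eq_abs, abs_sub_comm]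
  have e2 : ζ - σ = (ζ - s₀) + ((s₀ - σ : ℝ) : ℂ) := by push_cast; ring
  have hp : 0 < ρ := by linarith [norm_nonneg (ζ - s₀)]
  refine ne_int_mul_of_norm_lt ?_ ?_ n
  · intro h0
    have : ‖((s₀ - σ : ℝ) : ℂ)‖ = ‖ζ - s₀‖ := by
      rw [← norm_neg]; congr 1; linear_combination e2 - h0
    linarith
  · rw [e2]
    have := norm_add_le (ζ - s₀) ((s₀ - σ : ℝ) : ℂ)
    linarith [Real.pi_gt_three]

lemma continuousAt_mul_cauchyDiff (H : StripMap Γ r) {g : ℝ → ℂ} (hg : Continuous g) {ζ : ℂ} {σ : ℝ}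
    (hζ : |ζ.im| < r) (h : ∀ n : ℤ, ζ - σ ≠ n * (2 * Real.pi : ℝ)) :
    ContinuousAt (Function.uncurry fun (ζ : ℂ) (σ : ℝ) => g σ * cauchyDiff Γ ζ σ) (ζ, σ) := by
  have h1 := H.continuousAt_cauchyDiff (w := (σ : ℂ)) hζ (by simpa using H.pos) h
  have h2 : ContinuousAt (fun p : ℂ × ℝ => (p.1, (p.2 : ℂ))) (ζ, σ) := by fun_prop
  have h3 : ContinuousAt (fun p : ℂ × ℝ => cauchyDiff Γ p.1 (p.2 : ℂ)) (ζ, σ) :=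
    ContinuousAt.comp (g := fun p : ℂ × ℂ => cauchyDiff Γ p.1 p.2)
      (f := fun p : ℂ × ℝ => (p.1, (p.2 : ℂ))) h1 h2
  have h4 : ContinuousAt (fun p : ℂ × ℝ => g p.2) (ζ, σ) :=
    (hg.comp continuous_snd).continuousAt
  simp only [Function.uncurry_def]
  exact h4.mul h3

lemma continuousOn_far (H : StripMap Γ r) {g : ℝ → ℂ} (hg : Continuous g) {s₀ ρ : ℝ}
    (hρ1 : ρ ≤ 1) (hρr : ρ ≤ r) {S : Set ℝ}
    (hS : ∀ σ ∈ S, ρ / 2 ≤ |σ - s₀| ∧ |σ - s₀| ≤ Real.pi) :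
    ContinuousOn (Function.uncurry fun (ζ : ℂ) (σ : ℝ) => g σ * cauchyDiff Γ ζ σ)
      (Metric.ball (s₀ : ℂ) (ρ / 4) ×ˢ S) := by
  rintro ⟨ζ, σ⟩ ⟨hζ, hσ⟩
  refine ContinuousAt.continuousWithinAt ?_
  have hi : |ζ.im| < r := by
    have := abs_im_lt_of_mem_ball hζ
    have := abs_nonneg ζ.im
    linarith
  exact H.continuousAt_mul_cauchyDiff hg hi (ne_of_far hρ1 hζ (hS σ hσ).1 (hS σ hσ).2)

lemma analyticAt_far (H : StripMap Γ r) {g : ℝ → ℂ} (hg : Continuous g) {s₀ ρ a b : ℝ}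
    (hρ : 0 < ρ) (hρ1 : ρ ≤ 1) (hρr : ρ ≤ r) (hab : a ≤ b)
    (hS : ∀ σ ∈ Icc a b, ρ / 2 ≤ |σ - s₀| ∧ |σ - s₀| ≤ Real.pi) :
    AnalyticAt ℂ (fun ζ => ∫ σ in a..b, g σ * cauchyDiff Γ ζ σ) s₀ := by
  refine analyticAt_integral_regular Metric.isOpen_ball
    (Metric.mem_ball_self (by positivity : 0 < ρ / 4)) hab (H.continuousOn_far hg hρ1 hρr hS) ?_
  intro σ hσ ζ hζ
  have hi : |ζ.im| < r := by
    have := abs_im_lt_of_mem_ball hζ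
    linarith
  exact ((H.differentiableAt_cauchyDiff_left hi (by simpa using H.pos)
    (ne_of_far hρ1 hζ (hS σ hσ).1 (hS σ hσ).2)).const_mul (g σ)).differentiableWithinAt

lemma intervalIntegrable_far (H : StripMap Γ r) {g : ℝ → ℂ} (hg : Continuous g) {s₀ ρ a b : ℝ}
    (hρ1 : ρ ≤ 1) (hρr : ρ ≤ r) (hab : a ≤ b)
    (hS : ∀ σ ∈ Icc a b, ρ / 2 ≤ |σ - s₀| ∧ |σ - s₀| ≤ Real.pi)
    {ζ : ℂ} (hζ : ζ ∈ Metric.ball (s₀ : ℂ) (ρ / 4)) :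
    IntervalIntegrable (fun σ : ℝ => g σ * cauchyDiff Γ ζ σ) volume a b := by
  refine ContinuousOn.intervalIntegrable ?_
  rw [uIcc_of_le hab]
  exact (H.continuousOn_far hg hρ1 hρr hS).comp (f := fun σ : ℝ => (ζ, σ))
    (by fun_prop) fun σ hσ => ⟨hζ, hσ⟩

lemma intervalIntegrable_near (H : StripMap Γ r) {g : ℝ → ℂ} (hg : Continuous g) {s₀ ρ : ℝ}
    (hρ : 0 < ρ) (hρ1 : ρ ≤ 1) (hρr : ρ ≤ r) {ζ : ℂ} (hζ : ζ ∈ Metric.ball (s₀ : ℂ) ρ) :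
    IntervalIntegrable (fun σ : ℝ => g σ * cauchyDiff Γ ζ σ) volume (s₀ - ρ / 2) (s₀ + ρ / 2) := by
  obtain ⟨F, hF, hFk⟩ := H.exists_extension_right hρ1 hρr hζ
  have hmem : ∀ σ ∈ uIcc (s₀ - ρ / 2) (s₀ + ρ / 2), (σ : ℂ) ∈ Metric.ball (s₀ : ℂ) ρ := by
    intro σ hσ
    rw [uIcc_of_le (by linarith)] at hσ
    refine ofReal_mem_ball ?_
    rw [abs_lt]
    constructor <;> linarith [hσ.1, hσ.2]
  have hcont : ContinuousOn (fun σ : ℝ => g σ * F σ) (uIcc (s₀ - ρ / 2) (s₀ + ρ / 2)) :=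
    hg.continuousOn.mul (hF.continuousOn.comp Complex.continuous_ofReal.continuousOn hmem)
  refine hcont.intervalIntegrable.congr_ae ?_
  rw [Filter.EventuallyEq, ae_restrict_iff' measurableSet_uIoc]
  filter_upwards [compl_mem_ae_iff.2 (measure_singleton ζ.re)] with σ hne hσ
  rw [hFk σ (hmem σ (uIoc_subset_uIcc hσ))]
  rintro rfl
  exact hne (by simp)

lemma analyticAt_near (H : StripMap Γ r) {g : ℝ → ℂ} (hg : Continuous g) {s₀ ρ : ℝ}
    (hρ : 0 < ρ) (hρ1 : ρ ≤ 1) (hρr : ρ ≤ r) :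
    AnalyticAt ℂ (fun ζ => ∫ σ in (s₀ - ρ / 2)..(s₀ + ρ / 2), g σ * cauchyDiff Γ ζ σ) s₀ := by
  have hmem : ∀ σ ∈ Icc (s₀ - ρ / 2) (s₀ + ρ / 2), |σ - s₀| ≤ ρ / 2 := by
    intro σ hσ
    rw [abs_le]
    constructor <;> linarith [hσ.1, hσ.2]
  have hR : 0 < 3 * ρ / 4 := by positivity
  have hsub : Metric.closedBall (s₀ : ℂ) (3 * ρ / 4) ⊆ Metric.ball (s₀ : ℂ) ρ :=
    Metric.closedBall_subset_ball (by linarith)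
  have hne : ∀ ζ ∈ Metric.sphere (s₀ : ℂ) (3 * ρ / 4), ∀ σ ∈ Icc (s₀ - ρ / 2) (s₀ + ρ / 2),
      ζ ≠ σ := by
    rintro ζ hζ σ hσ rfl
    rw [Metric.mem_sphere, Complex.dist_of_im_eq (by simp)] at hζ
    simp only [Complex.ofReal_re, Real.dist_eq] at hζ
    linarith [hmem σ hσ]
  refine analyticAt_intervalIntegral_of_cauchy hR (by linarith) ?_ ?_
  · rintro ⟨ζ, σ⟩ ⟨hζ, hσ⟩
    refine ContinuousAt.continuousWithinAt ?_
    have hζ' : ζ ∈ Metric.ball (s₀ : ℂ) ρ := hsub (Metric.sphere_subset_closedBall hζ)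
    exact H.continuousAt_mul_cauchyDiff hg ((abs_im_lt_of_mem_ball hζ').trans_le hρr)
      (ne_of_mem_ball hρ1 hζ' (ofReal_mem_ball (by linarith [hmem σ hσ])) (hne ζ hζ σ hσ))
  · intro ζ hζ
    filter_upwards [compl_mem_ae_iff.2 (measure_singleton ζ.re)] with σ hne' hσ
    obtain ⟨F, hF, hFk⟩ := H.exists_extension_left hρ1 hρr
      (ofReal_mem_ball (s₀ := s₀) (σ := σ) (ρ := ρ) (by linarith [hmem σ hσ]))
    have hd : DiffContOnCl ℂ (fun ζ => g σ * F ζ) (Metric.ball (s₀ : ℂ) (3 * ρ / 4)) := by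
      refine DifferentiableOn.diffContOnCl ?_
      rw [closure_ball _ hR.ne']
      exact (hF.mono hsub).const_mul _
    have hc := hd.two_pi_i_inv_smul_circleIntegral_sub_inv_smul hζ
    rw [← hFk ζ (hsub (Metric.ball_subset_closedBall hζ))
      (by rintro rfl; exact hne' (by simp)), ← hc]
    congr 1
    refine circleIntegral.integral_congr hR.le fun w hw => ?_
    rw [hFk w (hsub (Metric.sphere_subset_closedBall hw)) (hne w hw σ hσ)]

lemma far_left {s₀ ρ : ℝ} (hρ : 0 < ρ) :
    ∀ σ ∈ Icc (s₀ - Real.pi) (s₀ - ρ / 2), ρ / 2 ≤ |σ - s₀| ∧ |σ - s₀| ≤ Real.pi := by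
  rintro σ ⟨h1, h2⟩
  rw [abs_of_nonpos (by linarith)]
  constructor <;> linarith

lemma far_right {s₀ ρ : ℝ} (hρ : 0 < ρ) :
    ∀ σ ∈ Icc (s₀ + ρ / 2) (s₀ + Real.pi), ρ / 2 ≤ |σ - s₀| ∧ |σ - s₀| ≤ Real.pi := by
  rintro σ ⟨h1, h2⟩
  rw [abs_of_nonneg (by linarith)]
  constructor <;> linarith

lemma intervalIntegrable_cauchyDiff (H : StripMap Γ r) {g : ℝ → ℂ} (hg : Continuous g) (s : ℝ) :
    IntervalIntegrable (fun σ : ℝ => g σ * cauchyDiff Γ s σ) volume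
      (s - Real.pi) (s + Real.pi) := by
  have hρ : 0 < min r 1 := lt_min H.pos one_pos
  have hm : (s : ℂ) ∈ Metric.ball (s : ℂ) (min r 1 / 4) := Metric.mem_ball_self (by positivity)
  have hm' : (s : ℂ) ∈ Metric.ball (s : ℂ) (min r 1) := Metric.mem_ball_self hρ
  have h1 : min r 1 ≤ 1 := min_le_right _ _
  have h2 : min r 1 ≤ r := min_le_left _ _
  have := Real.pi_gt_three
  exact ((H.intervalIntegrable_far hg h1 h2 (by linarith) (far_left hρ) hm).trans
    (H.intervalIntegrable_near hg hρ h1 h2 hm')).trans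
    (H.intervalIntegrable_far hg h1 h2 (by linarith) (far_right hρ) hm)

lemma analyticAt_integral_cauchyDiff (H : StripMap Γ r) {g : ℝ → ℂ} (hg : Continuous g)
    (hper : Function.Periodic g (2 * Real.pi)) (s₀ : ℝ) :
    AnalyticAt ℂ (fun ζ => ∫ σ in (0 : ℝ)..2 * Real.pi, g σ * cauchyDiff Γ ζ σ) s₀ := by
  have hρ : 0 < min r 1 := lt_min H.pos one_pos
  set ρ := min r 1 with hρdef
  have h1 : ρ ≤ 1 := min_le_right _ _
  have h2 : ρ ≤ r := min_le_left _ _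
  have hpi := Real.pi_gt_three
  have ha := ((H.analyticAt_far hg hρ h1 h2 (by linarith) (far_left hρ)).add
    (H.analyticAt_near hg hρ h1 h2)).add
    (H.analyticAt_far hg hρ h1 h2 (by linarith) (far_right (s₀ := s₀) hρ))
  refine ha.congr ?_
  filter_upwards [Metric.ball_mem_nhds (s₀ : ℂ) (by positivity : 0 < ρ / 4)] with ζ hζ
  have hζ' : ζ ∈ Metric.ball (s₀ : ℂ) ρ := Metric.ball_subset_ball (by linarith) hζ
  have i1 := H.intervalIntegrable_far hg h1 h2 (by linarith) (far_left hρ) hζ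
  have i2 := H.intervalIntegrable_near hg hρ h1 h2 hζ'
  have i3 := H.intervalIntegrable_far hg h1 h2 (by linarith) (far_right (s₀ := s₀) hρ) hζ
  simp only [Pi.add_apply]
  rw [intervalIntegral.integral_add_adjacent_intervals i1 i2,
    intervalIntegral.integral_add_adjacent_intervals (i1.trans i2) i3]
  have hp : Function.Periodic (fun σ : ℝ => g σ * cauchyDiff Γ ζ σ) (2 * Real.pi) := by
    intro σ
    simp only [hper σ]
    have := H.cauchyDiff_add_right ζ σ
    push_cast at this ⊢
    rw [this]
  have := hp.intervalIntegral_add_eq 0 (s₀ - Real.pi)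
  rw [zero_add] at this
  rw [this]
  congr 1
  ring

end StripMap

lemma abs_re_le_norm_sin_half {z : ℂ} (hz : |z.re| ≤ Real.pi) :
    |z.re| ≤ Real.pi * ‖Complex.sin (z / 2)‖ := by
  have hpi := Real.pi_pos
  have h1 : |Real.sin (z.re / 2)| ≤ ‖Complex.sin (z / 2)‖ := by
    have hz2 : z / 2 = ((z.re / 2 : ℝ) : ℂ) + ((z.im / 2 : ℝ) : ℂ) * Complex.I := by
      apply Complex.ext <;> simp
    have h2 : (Complex.sin (z / 2)).re = Real.sin (z.re / 2) * Real.cosh (z.im / 2) := by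
      rw [hz2, Complex.sin_add_mul_I, ← Complex.ofReal_sin, ← Complex.ofReal_cosh,
        ← Complex.ofReal_cos, ← Complex.ofReal_sinh, ← Complex.ofReal_mul, ← Complex.ofReal_mul]
      simp only [Complex.add_re, Complex.ofReal_re, Complex.re_ofReal_mul, Complex.I_re, mul_zero,
        add_zero]
    refine le_trans ?_ (Complex.abs_re_le_norm _)
    rw [h2, abs_mul, abs_of_pos (Real.cosh_pos _)]
    exact le_mul_of_one_le_right (abs_nonneg _) (Real.one_le_cosh _)
  have h3 : 2 / Real.pi * |z.re / 2| ≤ |Real.sin (z.re / 2)| := by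
    refine Real.mul_abs_le_abs_sin ?_
    rw [abs_div, abs_two]
    linarith
  rw [abs_div, abs_two] at h3
  have h4 : |z.re| / Real.pi ≤ ‖Complex.sin (z / 2)‖ := by
    refine le_trans (le_of_eq ?_) (h3.trans h1)
    ring
  rw [div_le_iff₀ hpi] at h4
  linarith

lemma norm_cos_half_le {z : ℂ} (hz : |z.im| ≤ 2) : ‖Complex.cos (z / 2)‖ ≤ Real.exp 1 := by
  have h := abs_le.1 hz
  rw [Complex.cos, norm_div, Complex.norm_two]
  have h1 := norm_add_le (Complex.exp (z / 2 * Complex.I)) (Complex.exp (-(z / 2) * Complex.I))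
  rw [Complex.norm_exp, Complex.norm_exp] at h1
  have h2 : Real.exp (z / 2 * Complex.I).re ≤ Real.exp 1 := by
    apply Real.exp_le_exp.2
    simp
    linarith
  have h3 : Real.exp (-(z / 2) * Complex.I).re ≤ Real.exp 1 := by
    apply Real.exp_le_exp.2
    simp
    linarith
  linarith

lemma abs_re_mul_norm_halfCot_le {z : ℂ} (hz : |z.re| ≤ Real.pi) (hz' : |z.im| ≤ 2) :
    |z.re| * ‖halfCot z‖ ≤ Real.pi * Real.exp 1 := by
  have hpi := Real.pi_pos
  by_cases h0 : Complex.sin (z / 2) = 0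
  · simp only [halfCot, h0, div_zero, norm_zero, mul_zero]
    positivity
  have hs : 0 < ‖Complex.sin (z / 2)‖ := norm_pos_iff.2 h0
  rw [halfCot, norm_div, norm_div, Complex.norm_two, mul_div_assoc', div_le_iff₀ hs]
  have h1 := norm_cos_half_le hz'
  have h2 := abs_re_le_norm_sin_half hz
  calc |z.re| * (‖Complex.cos (z / 2)‖ / 2)
      ≤ (Real.pi * ‖Complex.sin (z / 2)‖) * (Real.exp 1) := by
        gcongr
        linarith [norm_nonneg (Complex.cos (z / 2))]
    _ = _ := by ring

lemma measurable_halfCot : Measurable halfCot := by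
  unfold halfCot
  fun_prop

lemma sin_half_ne_zero_of_re {z : ℂ} (hz : |z.re| ≤ Real.pi) (h0 : z.re ≠ 0) :
    Complex.sin (z / 2) ≠ 0 := by
  intro h
  have := abs_re_le_norm_sin_half hz
  rw [h, norm_zero, mul_zero] at this
  exact h0 (abs_eq_zero.1 (le_antisymm this (abs_nonneg _)))

lemma sin_half_ne_zero_of_im {z : ℂ} (h0 : z.im ≠ 0) : Complex.sin (z / 2) ≠ 0 := by
  refine sin_half_ne_zero fun n hn => h0 ?_
  rw [hn]
  simp

/-- The regularised integral of `g` against the half cotangent kernel. -/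
noncomputable def cotIntegral (g : ℝ → ℂ) (ζ : ℂ) : ℂ :=
  ∫ τ in -Real.pi..Real.pi, (g (ζ.re + τ) - g ζ.re) * halfCot (ζ.im * Complex.I - τ)

lemma norm_cotIntegrand_le {g : ℝ → ℂ} {L : NNReal} (hg : LipschitzWith L g) {ζ : ℂ}
    (hζ : |ζ.im| ≤ 2) {τ : ℝ} (hτ : |τ| ≤ Real.pi) :
    ‖(g (ζ.re + τ) - g ζ.re) * halfCot (ζ.im * Complex.I - τ)‖ ≤ L * (Real.pi * Real.exp 1) := by
  have h1 := hg.dist_le_mul (ζ.re + τ) ζ.re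
  rw [dist_eq_norm, Real.dist_eq, add_sub_cancel_left] at h1
  have h2 := abs_re_mul_norm_halfCot_le (z := ζ.im * Complex.I - τ) (by simpa using hτ)
    (by simpa using hζ)
  simp only [Complex.sub_re, Complex.re_ofReal_mul, Complex.I_re, mul_zero, Complex.ofReal_re,
    zero_sub, abs_neg] at h2
  rw [norm_mul]
  calc _ ≤ (L * |τ|) * ‖halfCot (ζ.im * Complex.I - τ)‖ := by gcongr
    _ = L * (|τ| * ‖halfCot (ζ.im * Complex.I - τ)‖) := by ring
    _ ≤ _ := by gcongr

lemma aestronglyMeasurable_cotIntegrand {g : ℝ → ℂ} (hg : Continuous g) (ζ : ℂ) (μ : Measure ℝ) :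
    AEStronglyMeasurable
      (fun τ : ℝ => (g (ζ.re + τ) - g ζ.re) * halfCot (ζ.im * Complex.I - τ)) μ := by
  have h1 : Measurable fun τ : ℝ => halfCot (ζ.im * Complex.I - τ) :=
    measurable_halfCot.comp (by fun_prop)
  have h2 : Continuous fun τ : ℝ => g (ζ.re + τ) - g ζ.re := by fun_prop
  exact (h2.measurable.mul h1).aestronglyMeasurable

lemma abs_le_pi_of_mem {τ : ℝ} (hτ : τ ∈ uIoc (-Real.pi) Real.pi) : |τ| ≤ Real.pi := by
  rw [uIoc_of_le (by linarith [Real.pi_pos])] at hτ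
  exact abs_le.2 ⟨hτ.1.le, hτ.2⟩

lemma intervalIntegrable_cotIntegrand {g : ℝ → ℂ} {L : NNReal} (hg : LipschitzWith L g) {ζ : ℂ}
    (hζ : |ζ.im| ≤ 2) :
    IntervalIntegrable (fun τ : ℝ => (g (ζ.re + τ) - g ζ.re) * halfCot (ζ.im * Complex.I - τ))
      volume (-Real.pi) Real.pi := by
  refine (intervalIntegrable_const (c := (L * (Real.pi * Real.exp 1) : ℝ))).mono_fun
    (aestronglyMeasurable_cotIntegrand hg.continuous ζ _) ?_
  rw [Filter.EventuallyLE, ae_restrict_iff' measurableSet_uIoc]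
  refine Eventually.of_forall fun τ hτ => ?_
  exact (norm_cotIntegrand_le hg hζ (abs_le_pi_of_mem hτ)).trans (le_abs_self _)

lemma continuousAt_cotIntegral {g : ℝ → ℂ} {L : NNReal} (hg : LipschitzWith L g) {ζ : ℂ}
    (hζ : |ζ.im| < 2) : ContinuousAt (cotIntegral g) ζ := by
  refine intervalIntegral.continuousAt_of_dominated_interval
    (bound := fun _ => L * (Real.pi * Real.exp 1))
    (Eventually.of_forall fun z => aestronglyMeasurable_cotIntegrand hg.continuous z _) ?_
    intervalIntegrable_const ?_
  · have : ∀ᶠ z : ℂ in 𝓝 ζ, |z.im| < 2 :=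
      (continuous_abs.comp Complex.continuous_im).continuousAt.eventually_lt_const hζ
    filter_upwards [this] with z hz
    exact Eventually.of_forall fun τ hτ => norm_cotIntegrand_le hg hz.le (abs_le_pi_of_mem hτ)
  · filter_upwards [compl_mem_ae_iff.2 (measure_singleton (0 : ℝ))] with τ hne hτ
    have h1 := differentiableAt_halfCot (sin_half_ne_zero_of_re (z := ζ.im * Complex.I - τ)
      (by simpa using abs_le_pi_of_mem hτ) (by simpa using hne))
    have h2 : ContinuousAt (fun z : ℂ => z.im * Complex.I - (τ : ℂ)) ζ := by fun_prop
    have h3 : ContinuousAt (fun z : ℂ => halfCot (z.im * Complex.I - (τ : ℂ))) ζ :=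
      ContinuousAt.comp (g := halfCot) (f := fun z : ℂ => z.im * Complex.I - (τ : ℂ))
        h1.continuousAt h2
    have h4 := hg.continuous
    have h5 : Continuous fun z : ℂ => g (z.re + τ) - g z.re :=
      (h4.comp (by fun_prop)).sub (h4.comp (by fun_prop))
    exact h5.continuousAt.mul h3

lemma cotIntegral_periodic {g : ℝ → ℂ} (hg : Function.Periodic g (2 * Real.pi)) :
    Function.Periodic (cotIntegral g) ((2 * Real.pi : ℝ) : ℂ) := by
  intro ζ
  unfold cotIntegral
  simp only [Complex.add_re, Complex.ofReal_re, Complex.add_im, Complex.ofReal_im, add_zero]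
  rw [hg]
  congr 1
  ext τ
  rw [add_right_comm, hg]

lemma halfCot_eq_of_im_pos {z : ℂ} (hz : 0 < z.im) :
    halfCot z = -(Complex.I / 2)
      + -(Complex.exp (z * Complex.I) * Complex.I) / (1 - Complex.exp (z * Complex.I)) := by
  have hs := sin_half_ne_zero_of_im hz.ne'
  set u := Complex.exp (z / 2 * Complex.I) with hu
  have hu0 : u ≠ 0 := Complex.exp_ne_zero _
  have h1 : Complex.exp (z * Complex.I) = u * u := by
    rw [hu, ← Complex.exp_add]; ring_nf
  have h2 : Complex.exp (-(z / 2) * Complex.I) = u⁻¹ := by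
    rw [hu, ← Complex.exp_neg]; ring_nf
  have hc : Complex.cos (z / 2) = (u + u⁻¹) / 2 := by rw [Complex.cos, h2]
  have hsn : Complex.sin (z / 2) = (u⁻¹ - u) * Complex.I / 2 := by rw [Complex.sin, h2]
  rw [halfCot, h1, hc]
  rw [hsn] at hs ⊢
  have h3 : 1 - u * u ≠ 0 := by
    intro h
    apply hs
    have : u⁻¹ - u = (1 - u * u) * u⁻¹ := by field_simp
    rw [this, h]; simp
  have h4 : u⁻¹ - u ≠ 0 := by
    intro h; apply hs; rw [h]; simp
  have h5 : 1 - u ^ 2 ≠ 0 := by rwa [sq]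
  have hI := Complex.I_ne_zero
  have e : u⁻¹ - u = (1 - u ^ 2) / u := by field_simp
  rw [e]
  field_simp
  rw [Complex.I_sq]
  ring

lemma integral_halfCot_of_pos {η : ℝ} (hη : 0 < η) :
    ∫ τ in -Real.pi..Real.pi, halfCot (η * Complex.I - τ) = -(Real.pi * Complex.I) := by
  set P : ℝ → ℂ := fun τ => Complex.I / 2 * (η * Complex.I - τ)
    - Complex.log (1 - Complex.exp ((η * Complex.I - τ) * Complex.I)) with hP
  have hd : ∀ τ : ℝ, HasDerivAt P (halfCot (η * Complex.I - τ)) τ := by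
    intro τ
    have him : 0 < (η * Complex.I - τ : ℂ).im := by simpa using hη
    rw [halfCot_eq_of_im_pos him]
    have h0 : HasDerivAt (fun τ : ℝ => (η * Complex.I - τ : ℂ)) (-1) τ := by
      simpa using (Complex.ofRealCLM.hasDerivAt (x := τ)).const_sub (η * Complex.I : ℂ)
    have h1 := ((h0.mul_const Complex.I).cexp).const_sub 1
    have hsl : 1 - Complex.exp ((η * Complex.I - τ) * Complex.I) ∈ Complex.slitPlane := by
      left
      have hn : ‖Complex.exp ((η * Complex.I - τ) * Complex.I)‖ < 1 := by
        rw [Complex.norm_exp, Real.exp_lt_one_iff]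
        simpa using hη
      have := (Complex.re_le_norm _).trans_lt hn
      rw [Complex.sub_re, Complex.one_re]
      linarith
    have h2 := h1.clog_real hsl
    have h3 := (h0.const_mul (Complex.I / 2)).sub h2
    refine h3.congr_deriv ?_
    ring
  have hcont : Continuous fun τ : ℝ => halfCot (η * Complex.I - τ) := by
    rw [continuous_iff_continuousAt]
    intro τ
    have h1 := differentiableAt_halfCot (sin_half_ne_zero_of_im (z := η * Complex.I - τ)
      (by simpa using hη.ne'))
    exact ContinuousAt.comp (g := halfCot) (f := fun τ : ℝ => (η * Complex.I - (τ : ℂ)))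
        h1.continuousAt (by fun_prop)
  rw [intervalIntegral.integral_eq_sub_of_hasDerivAt (fun τ _ => hd τ)
    (hcont.intervalIntegrable _ _)]
  have hexp : Complex.exp ((η * Complex.I - (Real.pi : ℝ)) * Complex.I)
      = Complex.exp ((η * Complex.I - ((-Real.pi : ℝ) : ℂ)) * Complex.I) := by
    rw [Complex.exp_eq_exp_iff_exists_int]
    refine ⟨-1, ?_⟩
    push_cast
    ring
  simp only [hP, hexp]
  push_cast
  ring

lemma integral_halfCot_of_neg {η : ℝ} (hη : η < 0) :
    ∫ τ in -Real.pi..Real.pi, halfCot (η * Complex.I - τ) = Real.pi * Complex.I := by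
  have h := integral_halfCot_of_pos (neg_pos.2 hη)
  have h2 : ∫ τ in -Real.pi..Real.pi, halfCot (η * Complex.I - τ)
      = ∫ τ in -Real.pi..Real.pi, halfCot (η * Complex.I - ((-τ : ℝ) : ℂ)) := by
    rw [intervalIntegral.integral_comp_neg (fun τ : ℝ => halfCot (η * Complex.I - τ)), neg_neg]
  rw [h2, ← neg_neg ((Real.pi : ℂ) * Complex.I), ← h, ← intervalIntegral.integral_neg]
  congr 1
  ext τ
  rw [← halfCot_neg]
  congr 1
  push_cast
  ring

lemma integral_halfCot_eq {κ η : ℝ} (hκ : κ = 1 ∨ κ = -1) (hη : 0 < κ * η) :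
    ∫ τ in -Real.pi..Real.pi, halfCot (η * Complex.I - τ) = -(κ * Real.pi * Complex.I) := by
  rcases hκ with rfl | rfl
  · rw [integral_halfCot_of_pos (by linarith)]; push_cast; ring
  · rw [integral_halfCot_of_neg (by linarith)]; push_cast; ring

/-- The integral of `g` against the half cotangent kernel on the side `0 < κ * im ζ` of the real
line, extended to the line by its boundary values. -/
noncomputable def cotSide (g : ℝ → ℂ) (κ : ℝ) (ζ : ℂ) : ℂ :=
  cotIntegral g ζ - κ * Real.pi * Complex.I * g ζ.re

lemma continuousAt_cotSide {g : ℝ → ℂ} {L : NNReal} (hg : LipschitzWith L g) (κ : ℝ) {ζ : ℂ}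
    (hζ : |ζ.im| < 2) : ContinuousAt (cotSide g κ) ζ :=
  (continuousAt_cotIntegral hg hζ).sub
    (continuousAt_const.mul (hg.continuous.comp Complex.continuous_re).continuousAt)

lemma cotSide_periodic {g : ℝ → ℂ} (hg : Function.Periodic g (2 * Real.pi)) (κ : ℝ) :
    Function.Periodic (cotSide g κ) ((2 * Real.pi : ℝ) : ℂ) := by
  intro ζ
  unfold cotSide
  rw [cotIntegral_periodic hg ζ, Complex.add_re, Complex.ofReal_re, hg]

lemma cotSide_eq {g : ℝ → ℂ} {L : NNReal} (hg : LipschitzWith L g)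
    (hper : Function.Periodic g (2 * Real.pi)) {κ : ℝ} (hκ : κ = 1 ∨ κ = -1) {ζ : ℂ}
    (hζ : |ζ.im| < 2) (hs : 0 < κ * ζ.im) :
    cotSide g κ ζ = ∫ σ in (0 : ℝ)..2 * Real.pi, g σ * halfCot (ζ - σ) := by
  have hp : Function.Periodic (fun σ : ℝ => g σ * halfCot (ζ - σ)) (2 * Real.pi) := by
    intro σ
    simp only [hper σ]
    have : ζ - ((σ + 2 * Real.pi : ℝ) : ℂ) = ζ - σ - ((2 * Real.pi : ℝ) : ℂ) := by
      push_cast; ring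
    rw [this, halfCot_periodic.sub_eq]
  have h1 := hp.intervalIntegral_add_eq 0 (-Real.pi + ζ.re)
  rw [zero_add, show -Real.pi + ζ.re + 2 * Real.pi = Real.pi + ζ.re by ring,
    ← intervalIntegral.integral_comp_add_right (fun σ : ℝ => g σ * halfCot (ζ - σ))] at h1
  have hne : ζ.im ≠ 0 := by
    intro h; simp [h] at hs
  have hcont : Continuous fun τ : ℝ => halfCot (ζ.im * Complex.I - τ) := by
    rw [continuous_iff_continuousAt]
    intro τ
    have h1 := differentiableAt_halfCot (sin_half_ne_zero_of_im (z := ζ.im * Complex.I - τ)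
      (by simpa using hne))
    exact ContinuousAt.comp (g := halfCot) (f := fun τ : ℝ => (ζ.im * Complex.I - (τ : ℂ)))
        h1.continuousAt (by fun_prop)
  rw [h1, cotSide, cotIntegral]
  have h2 := integral_halfCot_eq hκ hs
  have h3 : -(κ * Real.pi * Complex.I * g ζ.re)
      = ∫ τ in -Real.pi..Real.pi, g ζ.re * halfCot (ζ.im * Complex.I - τ) := by
    rw [intervalIntegral.integral_const_mul, h2]; ring
  have h4 : Continuous fun τ : ℝ => g ζ.re * halfCot (ζ.im * Complex.I - τ) :=
    continuous_const.mul hcont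
  rw [sub_eq_add_neg, h3, ← intervalIntegral.integral_add
    (intervalIntegrable_cotIntegrand hg hζ.le) (h4.intervalIntegrable _ _)]
  congr 1
  ext τ
  have : ζ - ((τ + ζ.re : ℝ) : ℂ) = ζ.im * Complex.I - τ := by
    push_cast
    linear_combination -(Complex.re_add_im ζ)
  rw [this, add_comm τ]
  ring

lemma analyticAt_cotSide {g : ℝ → ℂ} {L : NNReal} (hg : LipschitzWith L g)
    (hper : Function.Periodic g (2 * Real.pi)) {κ : ℝ} (hκ : κ = 1 ∨ κ = -1) {ζ : ℂ}
    (hζ : |ζ.im| < 2) (hs : 0 < κ * ζ.im) : AnalyticAt ℂ (cotSide g κ) ζ := by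
  have hV : IsOpen {z : ℂ | 0 < κ * z.im} := isOpen_lt (by fun_prop) (by fun_prop)
  have hne : ∀ z ∈ {z : ℂ | 0 < κ * z.im}, ∀ σ : ℝ, Complex.sin ((z - σ) / 2) ≠ 0 := by
    intro z hz σ
    apply sin_half_ne_zero_of_im
    intro h
    simp only [Complex.sub_im, Complex.ofReal_im, sub_zero] at h
    simp [h] at hz
  have h1 : AnalyticAt ℂ (fun ζ : ℂ => ∫ σ in (0 : ℝ)..2 * Real.pi, g σ * halfCot (ζ - σ)) ζ := by
    refine analyticAt_integral_regular hV hs Real.two_pi_pos.le ?_ ?_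
    · rintro ⟨z, σ⟩ ⟨hz, -⟩
      have h3 : ContinuousAt (fun p : ℂ × ℝ => halfCot (p.1 - (p.2 : ℂ))) (z, σ) :=
        ContinuousAt.comp (g := halfCot) (f := fun p : ℂ × ℝ => p.1 - (p.2 : ℂ))
          (differentiableAt_halfCot (hne z hz σ)).continuousAt (by fun_prop)
      have h4 : ContinuousAt (fun p : ℂ × ℝ => g p.2) (z, σ) :=
        (hg.continuous.comp continuous_snd).continuousAt
      simp only [Function.uncurry_def]
      exact (h4.mul h3).continuousWithinAt
    · intro σ _ z hz
      have h3 : DifferentiableAt ℂ (fun z : ℂ => halfCot (z - σ)) z :=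
        (differentiableAt_halfCot (hne z hz σ)).comp z (differentiableAt_id.sub_const _)
      exact (h3.const_mul _).differentiableWithinAt
  refine h1.congr ?_
  have e1 : ∀ᶠ z : ℂ in 𝓝 ζ, |z.im| < 2 :=
    (continuous_abs.comp Complex.continuous_im).continuousAt.eventually_lt_const hζ
  filter_upwards [e1, hV.mem_nhds hs] with z h1 h2
  exact (cotSide_eq hg hper hκ h1 h2).symm

lemma HasDerivAt.log_norm {φ : ℝ → ℂ} {d : ℂ} {σ : ℝ} (h : HasDerivAt φ d σ) (h0 : φ σ ≠ 0) :
    HasDerivAt (fun σ => Real.log ‖φ σ‖) (d / φ σ).re σ := by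
  have hn : ‖φ σ‖ ≠ 0 := norm_ne_zero_iff.2 h0
  have h1 := (h.norm_sq.log (by simpa using h0)).div_const 2
  have e : (fun σ => Real.log ‖φ σ‖) = fun σ => Real.log ((fun σ => ‖φ σ‖) ^ 2 <| σ) / 2 := by
    ext σ
    simp
  rw [e]
  refine h1.congr_deriv ?_
  rw [Complex.inner, Complex.div_re, ← Complex.normSq_eq_norm_sq]
  have : Complex.normSq (φ σ) ≠ 0 := by simpa using h0
  simp
  field_simp

/-- A level set of the distance to a fixed point contributes nothing to the truncated integral of
the logarithmic derivative along a closed analytic curve. -/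
lemma integral_truncated_logDeriv_eq_zero {φ : ℝ → ℂ} (han : AnalyticOnNhd ℝ φ univ) {a b : ℝ}
    (hab : a ≤ b) (hφ : φ a = φ b) (hz : ∃ s ∈ Icc a b, φ s = 0) {ε : ℝ} (hε : 0 < ε) :
    ∫ σ in a..b, (if ε ≤ ‖φ σ‖ then (deriv φ σ / φ σ).re else 0) = 0 := by
  obtain ⟨s, hs, hs0⟩ := hz
  have hc : Continuous φ := continuousOn_univ.1 han.continuousOn
  have hdc : Continuous (deriv φ) := continuousOn_univ.1 han.deriv.continuousOn
  have hq : AnalyticOnNhd ℝ (fun σ => Complex.normSq (φ σ) - ε ^ 2) (Icc a b) := by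
    intro σ _
    have h1 := han σ trivial
    have hre : AnalyticAt ℝ (fun σ => (φ σ).re) σ :=
      (Complex.reCLM.analyticAt _).comp h1
    have him : AnalyticAt ℝ (fun σ => (φ σ).im) σ :=
      (Complex.imCLM.analyticAt _).comp h1
    simp only [Complex.normSq_apply]
    exact ((hre.mul hre).add (him.mul him)).sub analyticAt_const
  have hfin := IsCompact.finite_sdiff_of_mem_codiscreteWithin isCompact_Icc
    (hq.preimage_zero_mem_codiscreteWithin (x := s) (by simp [hs0, hε.ne']) hs
      ⟨⟨s, hs⟩, isPreconnected_Icc⟩)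
  have hV : ∫ σ in a..b, (if ε ≤ ‖φ σ‖ then (deriv φ σ / φ σ).re else 0)
      = Real.log (max ‖φ b‖ ε) - Real.log (max ‖φ a‖ ε) := by
    refine integral_eq_of_hasDerivAt_off_countable_of_le (fun σ => Real.log (max ‖φ σ‖ ε)) _ hab
      hfin.countable ?_ ?_ ?_
    · refine Continuous.continuousOn ?_
      exact (hc.norm.max continuous_const).log fun σ => (lt_max_of_lt_right hε).ne'
    · rintro σ ⟨hσ, hne⟩
      have hne' : ‖φ σ‖ ≠ ε := by
        intro h
        apply hne
        refine ⟨Ioo_subset_Icc_self hσ, ?_⟩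
        simp [Complex.normSq_eq_norm_sq, h]
      rcases hne'.lt_or_gt with h | h
      · rw [if_neg (not_le.2 h)]
        refine (hasDerivAt_const σ (Real.log ε)).congr_of_eventuallyEq ?_
        filter_upwards [hc.norm.continuousAt.eventually_lt_const h] with t ht
        rw [max_eq_right ht.le]
      · rw [if_pos h.le]
        refine HasDerivAt.congr_of_eventuallyEq
          ((han σ trivial).differentiableAt.hasDerivAt.log_norm
            (norm_pos_iff.1 (hε.trans h))) ?_
        filter_upwards [hc.norm.continuousAt.eventually_const_lt h] with t ht
        rw [max_eq_left ht.le]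
    · have hcl : MeasurableSet {σ | ε ≤ ‖φ σ‖} :=
        (isClosed_le continuous_const hc.norm).measurableSet
      have hm : Measurable fun σ => (if ε ≤ ‖φ σ‖ then (deriv φ σ / φ σ).re else 0) :=
        Measurable.ite hcl
          (Complex.measurable_re.comp (hdc.measurable.div hc.measurable)) measurable_const
      have hb : Continuous fun σ => ‖deriv φ σ‖ / ε := by fun_prop
      refine (hb.intervalIntegrable a b).mono_fun hm.aestronglyMeasurable
        (Eventually.of_forall fun σ => ?_)
      simp only
      rw [Real.norm_of_nonneg (by positivity : (0 : ℝ) ≤ ‖deriv φ σ‖ / ε)]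
      split_ifs with h
      · refine (Complex.abs_re_le_norm _).trans ?_
        rw [norm_div]
        gcongr
      · rw [norm_zero]; positivity
  rw [hV, hφ, sub_self]

namespace StripMap
variable {Γ : ℂ → ℂ} {r : ℝ}

lemma analyticOnNhd_ofReal (H : StripMap Γ r) : AnalyticOnNhd ℝ (fun σ : ℝ => Γ σ) univ := by
  intro σ _
  have h1 := (H.an σ (by simpa using H.pos)).restrictScalars (𝕜 := ℝ)
  exact h1.comp_of_eq (Complex.ofRealCLM.analyticAt σ) rfl

lemma hasDerivAt_ofReal (H : StripMap Γ r) (σ : ℝ) :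
    HasDerivAt (fun σ : ℝ => Γ σ) (deriv Γ σ) σ :=
  (H.an σ (by simpa using H.pos)).differentiableAt.hasDerivAt.comp_ofReal

lemma ofReal_ne (H : StripMap Γ r) {s σ : ℝ} (h : |σ - s| ≤ Real.pi) (hne : σ ≠ s) :
    Γ σ - Γ s ≠ 0 := by
  refine H.sub_ne_zero_of_ne (by simpa using H.pos) (by simpa using H.pos)
    (ne_int_mul_of_norm_lt ?_ ?_)
  · rw [sub_ne_zero]; exact_mod_cast hne
  · rw [← Complex.ofReal_sub, Complex.norm_real, Real.norm_eq_abs]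
    linarith [Real.pi_pos]

lemma intervalIntegrable_cauchyDiff_left (H : StripMap Γ r) (s : ℝ) :
    IntervalIntegrable (fun σ : ℝ => cauchyDiff Γ σ s) volume (s - Real.pi) (s + Real.pi) := by
  have hρ : 0 < min r 1 := lt_min H.pos one_pos
  have hpi := Real.pi_pos
  have hms : (s : ℂ) ∈ Metric.ball (s : ℂ) (min r 1) := Metric.mem_ball_self hρ
  obtain ⟨F, hF, hFk⟩ := H.exists_extension_left (min_le_right _ _) (min_le_left _ _) hms
  have hcont : ContinuousOn (Function.update (fun σ : ℝ => cauchyDiff Γ σ s) s (F s))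
      (uIcc (s - Real.pi) (s + Real.pi)) := by
    rw [continuousOn_update_iff]
    constructor
    · rintro σ ⟨hσ, hne⟩
      rw [uIcc_of_le (by linarith)] at hσ
      have h1 := H.continuousAt_cauchyDiff (ζ := σ) (w := s) (by simpa using H.pos)
        (by simpa using H.pos) (ne_int_mul_of_norm_lt
          (by rw [sub_ne_zero]; exact_mod_cast hne)
          (by
            rw [← Complex.ofReal_sub, Complex.norm_real, Real.norm_eq_abs]
            have : |σ - s| ≤ Real.pi := abs_le.2 ⟨by linarith [hσ.1], by linarith [hσ.2]⟩
            linarith))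
      refine ContinuousAt.continuousWithinAt ?_
      exact ContinuousAt.comp (g := fun p : ℂ × ℂ => cauchyDiff Γ p.1 p.2)
        (f := fun σ : ℝ => ((σ : ℂ), (s : ℂ))) h1 (by fun_prop)
    · intro _
      have h1 : Tendsto (fun σ : ℝ => F σ) (𝓝 s) (𝓝 (F s)) := by
        have h2 : ContinuousAt F s :=
          (hF.continuousOn.continuousAt (Metric.isOpen_ball.mem_nhds hms))
        exact h2.tendsto.comp Complex.continuous_ofReal.continuousAt.tendsto
      refine (h1.mono_left nhdsWithin_le_nhds).congr' ?_
      have h3 : ∀ᶠ σ : ℝ in 𝓝[uIcc (s - Real.pi) (s + Real.pi) \ {s}] s,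
          (σ : ℂ) ∈ Metric.ball (s : ℂ) (min r 1) :=
        nhdsWithin_le_nhds (Complex.continuous_ofReal.continuousAt.eventually_mem
          (Metric.isOpen_ball.mem_nhds hms))
      filter_upwards [h3, self_mem_nhdsWithin] with σ h4 h5
      exact hFk σ h4 (by simpa using h5.2)
  refine hcont.intervalIntegrable.congr_ae ?_
  rw [Filter.EventuallyEq, ae_restrict_iff' measurableSet_uIoc]
  filter_upwards [compl_mem_ae_iff.2 (measure_singleton s)] with σ hne hσ
  rw [Function.update_of_ne hne]

lemma add_two_pi_ofReal (H : StripMap Γ r) (s : ℝ) :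
    Γ ((s - Real.pi : ℝ) : ℂ) = Γ ((s + Real.pi : ℝ) : ℂ) := by
  rw [← H.per]
  congr 1
  push_cast
  ring

lemma integral_re_cauchyDiff_left (H : StripMap Γ r) (s : ℝ) :
    ∫ σ in (s - Real.pi)..(s + Real.pi), (cauchyDiff Γ σ s).re = 0 := by
  have hpi := Real.pi_pos
  have hsin : ∀ σ : ℝ, Complex.sin (((σ : ℂ) - s) / 2) = (Real.sin ((σ - s) / 2) : ℝ) := by
    intro σ; push_cast; rfl
  have hsin0 : ∀ σ : ℝ, |σ - s| ≤ Real.pi → σ ≠ s → Complex.sin (((σ : ℂ) - s) / 2) ≠ 0 := by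
    intro σ h hne
    apply sin_half_ne_zero_of_re
    · simpa using h
    · simpa [sub_eq_zero] using hne
  set W₀ : ℝ → ℝ := fun σ => Real.log ‖Γ σ - Γ s‖ - Real.log ‖Complex.sin (((σ : ℂ) - s) / 2)‖
    with hW₀
  have hderiv : ∀ σ : ℝ, |σ - s| ≤ Real.pi → σ ≠ s →
      HasDerivAt W₀ (cauchyDiff Γ σ s).re σ := by
    intro σ h hne
    have h1 := ((H.hasDerivAt_ofReal σ).sub_const (Γ s)).log_norm (H.ofReal_ne h hne)
    have h2 := (hasDerivAt_sin_half_sub (s : ℂ) (σ : ℂ)).comp_ofReal.log_norm (hsin0 σ h hne)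
    refine (h1.sub h2).congr_deriv ?_
    rw [cauchyDiff, halfCot, Complex.sub_re]
  have hlim : Tendsto W₀ (𝓝[≠] s) (𝓝 (Real.log (‖deriv Γ s‖ / ‖(1 / 2 : ℂ)‖))) := by
    have h1 := (hasDerivAt_iff_tendsto_slope.1 (H.hasDerivAt_ofReal s)).norm
    have h2 := (hasDerivAt_iff_tendsto_slope.1
      (hasDerivAt_sin_half_sub (s : ℂ) (s : ℂ)).comp_ofReal).norm
    simp only [sub_self, zero_div, Complex.cos_zero] at h2
    have hd := norm_ne_zero_iff.2 (H.deriv_ne s (by simpa using H.pos))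
    have h3 := (h1.div h2 (by norm_num)).log (div_ne_zero hd (by norm_num))
    refine h3.congr' ?_
    have h4 : ∀ᶠ σ : ℝ in 𝓝[≠] s, |σ - s| < Real.pi := by
      refine nhdsWithin_le_nhds ?_
      have : Continuous fun σ : ℝ => |σ - s| := by fun_prop
      exact this.continuousAt.eventually_lt_const (by simpa using hpi)
    filter_upwards [h4, self_mem_nhdsWithin] with σ h5 h6
    have n1 := norm_ne_zero_iff.2 (H.ofReal_ne h5.le h6)
    have n2 := norm_ne_zero_iff.2 (hsin0 σ h5.le h6)
    have n3 : |σ - s| ≠ 0 := abs_ne_zero.2 (sub_ne_zero.2 h6)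
    simp only [slope, vsub_eq_sub, norm_smul, Complex.sin_zero, sub_zero, sub_self, zero_div, hW₀,
      Pi.div_apply, norm_inv, Real.norm_eq_abs]
    rw [← Real.log_div n1 n2, mul_div_mul_left _ _ (inv_ne_zero n3)]
  have hInt : IntervalIntegrable (fun σ : ℝ => (cauchyDiff Γ σ s).re) volume
      (s - Real.pi) (s + Real.pi) := by
    have h1 := H.intervalIntegrable_cauchyDiff_left s
    exact ⟨h1.1.re, h1.2.re⟩
  have habs : ∀ σ ∈ Icc (s - Real.pi) (s + Real.pi), |σ - s| ≤ Real.pi := fun σ hσ =>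
    abs_le.2 ⟨by linarith [hσ.1], by linarith [hσ.2]⟩
  rw [integral_eq_of_hasDerivAt_off_countable_of_le
    (Function.update W₀ s (Real.log (‖deriv Γ s‖ / ‖(1 / 2 : ℂ)‖))) _ (by linarith)
    (countable_singleton s) ?_ ?_ hInt]
  · rw [Function.update_of_ne (by linarith), Function.update_of_ne (by linarith)]
    simp only [hW₀, H.add_two_pi_ofReal s, hsin]
    rw [show (s + Real.pi - s) / 2 = Real.pi / 2 by ring,
      show (s - Real.pi - s) / 2 = -(Real.pi / 2) by ring, Real.sin_neg, Real.sin_pi_div_two]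
    simp
  · rw [continuousOn_update_iff]
    refine ⟨fun σ hσ => ?_, fun _ => hlim.mono_left (nhdsWithin_mono _ fun σ hσ => hσ.2)⟩
    exact (hderiv σ (habs σ hσ.1) hσ.2).continuousAt.continuousWithinAt
  · rintro σ ⟨hσ, hne⟩
    refine (hderiv σ (habs σ (Ioo_subset_Icc_self hσ)) hne).congr_of_eventuallyEq ?_
    filter_upwards [isOpen_compl_singleton.mem_nhds hne] with t ht
    rw [Function.update_of_ne ht]

end StripMap

lemma tendsto_integral_truncated {K d : ℝ → ℝ} {a b s : ℝ} (hK : IntervalIntegrable K volume a b)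
    (hd : Measurable d) (hpos : ∀ σ ∈ uIoc a b, σ ≠ s → 0 < d σ) :
    Tendsto (fun ε : ℝ => ∫ σ in a..b, (if ε ≤ d σ then K σ else 0)) (𝓝[>] 0)
      (𝓝 (∫ σ in a..b, K σ)) := by
  refine intervalIntegral.tendsto_integral_filter_of_dominated_convergence (fun σ => ‖K σ‖)
    (Eventually.of_forall fun ε => ?_) (Eventually.of_forall fun ε => ?_) hK.norm ?_
  · exact (hK.aestronglyMeasurable_restrict_uIoc).indicator (measurableSet_le measurable_const hd)
  · refine Eventually.of_forall fun σ _ => ?_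
    split_ifs
    · exact le_rfl
    · rw [norm_zero]; exact norm_nonneg _
  · filter_upwards [compl_mem_ae_iff.2 (measure_singleton s)] with σ hne hσ
    refine tendsto_const_nhds.congr' ?_
    filter_upwards [nhdsWithin_le_nhds (Iic_mem_nhds (hpos σ hσ hne))] with ε hε
    exact (if_pos (mem_Iic.1 hε)).symm

namespace StripMap
variable {Γ : ℂ → ℂ} {r : ℝ}

/-- The truncated Cauchy integrals along a closed analytic curve converge, and the limit is the
sum of a regularised integral and of an integral with a smooth kernel. -/
lemma tendsto_principalValue (H : StripMap Γ r) {g : ℝ → ℝ} {L : NNReal} (hg : LipschitzWith L g)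
    (hper : Function.Periodic g (2 * Real.pi)) (s : ℝ) :
    Tendsto (fun ε : ℝ => ∫ σ in (0 : ℝ)..2 * Real.pi,
        (if ε ≤ ‖Γ s - Γ σ‖ then g σ * (deriv Γ s / (Γ s - Γ σ)).re else 0)) (𝓝[>] 0)
      (𝓝 ((cotIntegral (fun σ => (g σ : ℂ)) s).re
        + (∫ σ in (0 : ℝ)..2 * Real.pi, (g σ : ℂ) * cauchyDiff Γ s σ).re)) := by
  have hpi := Real.pi_pos
  have hgc : Continuous fun σ => (g σ : ℂ) := Complex.continuous_ofReal.comp hg.continuous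
  have hgC : LipschitzWith L fun σ => (g σ : ℂ) := by
    have := (Complex.isometry_ofReal.lipschitz).comp hg
    simpa [Function.comp_def] using this
  have hΓper : ∀ σ : ℝ, Γ ((σ + 2 * Real.pi : ℝ) : ℂ) = Γ σ := by
    intro σ
    rw [← H.per σ]; congr 1; push_cast; ring
  set K₁ : ℝ → ℂ := fun σ => (g σ : ℂ) * cauchyDiff Γ s σ with hK₁
  set K₂ : ℝ → ℂ := fun σ => ((g σ : ℂ) - g s) * halfCot (s - σ) with hK₂
  set K₃ : ℝ → ℂ := fun σ => cauchyDiff Γ σ s with hK₃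
  have i₁ : IntervalIntegrable K₁ volume (s - Real.pi) (s + Real.pi) :=
    H.intervalIntegrable_cauchyDiff hgc s
  have hcot : ∀ τ : ℝ, K₂ (τ + s) = ((g ((s : ℂ).re + τ) : ℂ) - g (s : ℂ).re)
      * halfCot ((s : ℂ).im * Complex.I - τ) := by
    intro τ
    simp only [hK₂, Complex.ofReal_re, Complex.ofReal_im, Complex.ofReal_zero, zero_mul, zero_sub]
    rw [add_comm τ s]
    congr 2
    push_cast
    ring
  have i₂ : IntervalIntegrable K₂ volume (s - Real.pi) (s + Real.pi) := by
    have := intervalIntegrable_cotIntegrand hgC (ζ := (s : ℂ)) (by simp)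
    have h2 := this.congr (g := fun τ => K₂ (τ + s)) (fun τ _ => (hcot τ).symm)
    have h3 := h2.comp_sub_right s
    simp only [sub_add_cancel] at h3
    rwa [show -Real.pi + s = s - Real.pi by ring, add_comm Real.pi s] at h3
  have i₃ : IntervalIntegrable K₃ volume (s - Real.pi) (s + Real.pi) :=
    H.intervalIntegrable_cauchyDiff_left s
  have e₁ : ∫ σ in (s - Real.pi)..(s + Real.pi), K₁ σ = ∫ σ in (0 : ℝ)..2 * Real.pi, K₁ σ := by
    have hp : Function.Periodic K₁ (2 * Real.pi) := by
      intro σ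
      have := H.cauchyDiff_add_right s σ
      simp only [hK₁, hper σ]
      push_cast at this ⊢
      rw [this]
    have := hp.intervalIntegral_add_eq 0 (s - Real.pi)
    rw [zero_add] at this
    rw [this]
    congr 1
    ring
  have e₂ : ∫ σ in (s - Real.pi)..(s + Real.pi), K₂ σ = cotIntegral (fun σ => (g σ : ℂ)) s := by
    have h3 := intervalIntegral.integral_comp_add_right (a := -Real.pi) (b := Real.pi) K₂ s
    rw [show -Real.pi + s = s - Real.pi by ring, add_comm Real.pi s] at h3
    rw [← h3, cotIntegral]
    simp only [hcot]
  have toRe : ∀ {K : ℝ → ℂ}, IntervalIntegrable K volume (s - Real.pi) (s + Real.pi) →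
      IntervalIntegrable (fun σ => (K σ).re) volume (s - Real.pi) (s + Real.pi) ∧
      ∫ σ in (s - Real.pi)..(s + Real.pi), (K σ).re
        = (∫ σ in (s - Real.pi)..(s + Real.pi), K σ).re := by
    intro K hK
    exact ⟨⟨hK.1.re, hK.2.re⟩, Complex.reCLM.intervalIntegral_comp_comm hK⟩
  obtain ⟨j₁, f₁⟩ := toRe i₁
  obtain ⟨j₂, f₂⟩ := toRe i₂
  obtain ⟨j₃, -⟩ := toRe i₃
  have f₃ := H.integral_re_cauchyDiff_left s
  have hInt := (j₁.add j₂).add (j₃.const_mul (g s))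
  have hval : ∫ σ in (s - Real.pi)..(s + Real.pi), ((K₁ σ).re + (K₂ σ).re + g s * (K₃ σ).re)
      = (cotIntegral (fun σ => (g σ : ℂ)) s).re
        + (∫ σ in (0 : ℝ)..2 * Real.pi, (g σ : ℂ) * cauchyDiff Γ s σ).re := by
    rw [intervalIntegral.integral_add (j₁.add j₂) (j₃.const_mul (g s)),
      intervalIntegral.integral_add j₁ j₂, intervalIntegral.integral_const_mul, f₁, f₂, e₁, e₂, f₃]
    ring
  have hΓc : Continuous fun σ : ℝ => Γ σ := continuousOn_univ.1 H.analyticOnNhd_ofReal.continuousOn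
  have hd : Measurable fun σ : ℝ => ‖Γ s - Γ σ‖ := (continuous_const.sub hΓc).norm.measurable
  have habs : ∀ σ ∈ uIoc (s - Real.pi) (s + Real.pi), |σ - s| ≤ Real.pi := by
    intro σ hσ
    rw [uIoc_of_le (by linarith)] at hσ
    exact abs_le.2 ⟨by linarith [hσ.1], by linarith [hσ.2]⟩
  have hlim := tendsto_integral_truncated (s := s) hInt hd fun σ hσ hne => by
    rw [norm_sub_rev]
    exact norm_pos_iff.2 (H.ofReal_ne (habs σ hσ) hne)
  rw [hval] at hlim
  refine hlim.congr' ?_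
  filter_upwards [self_mem_nhdsWithin] with ε hε
  have hε : 0 < ε := hε
  have hp : Function.Periodic (fun σ : ℝ =>
      if ε ≤ ‖Γ s - Γ σ‖ then g σ * (deriv Γ s / (Γ s - Γ σ)).re else 0) (2 * Real.pi) := by
    intro σ
    simp only [hper σ, hΓper σ]
  have h1 := hp.intervalIntegral_add_eq 0 (s - Real.pi)
  rw [zero_add, show s - Real.pi + 2 * Real.pi = s + Real.pi by ring] at h1
  rw [h1]
  have hzero := integral_truncated_logDeriv_eq_zero (φ := fun σ : ℝ => Γ σ - Γ s)
    (a := s - Real.pi) (b := s + Real.pi)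
    (H.analyticOnNhd_ofReal.sub analyticOnNhd_const) (by linarith)
    (by simp only [H.add_two_pi_ofReal s])
    ⟨s, ⟨by linarith, by linarith⟩, sub_self _⟩ hε
  have hderiv : ∀ σ : ℝ, deriv (fun σ : ℝ => Γ σ - Γ s) σ = deriv Γ σ := fun σ =>
    ((H.hasDerivAt_ofReal σ).sub_const _).deriv
  simp only [hderiv] at hzero
  set T : ℝ → ℝ := fun σ => if ε ≤ ‖Γ σ - Γ s‖ then (deriv Γ σ / (Γ σ - Γ s)).re else 0 with hT
  have hTi : IntervalIntegrable T volume (s - Real.pi) (s + Real.pi) := by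
    have hdc : Continuous fun σ : ℝ => deriv Γ σ := by
      have : Continuous (deriv fun σ : ℝ => Γ σ) :=
        continuousOn_univ.1 H.analyticOnNhd_ofReal.deriv.continuousOn
      exact this.congr fun σ => (H.hasDerivAt_ofReal σ).deriv
    have hm : Measurable T :=
      Measurable.ite (measurableSet_le measurable_const (hΓc.sub continuous_const).norm.measurable)
        (Complex.measurable_re.comp (hdc.measurable.div (hΓc.sub continuous_const).measurable))
        measurable_const
    have hb : Continuous fun σ : ℝ => ‖deriv Γ σ‖ / ε := by fun_prop
    refine (hb.intervalIntegrable _ _).mono_fun hm.aestronglyMeasurable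
      (Eventually.of_forall fun σ => ?_)
    simp only [hT]
    rw [Real.norm_of_nonneg (by positivity : (0 : ℝ) ≤ ‖deriv Γ σ‖ / ε)]
    split_ifs with h
    · refine (Complex.abs_re_le_norm _).trans ?_
      rw [norm_div]
      gcongr
    · rw [norm_zero]; positivity
  have hKi : IntervalIntegrable (fun σ => if ε ≤ ‖Γ s - Γ σ‖ then
      ((K₁ σ).re + (K₂ σ).re + g s * (K₃ σ).re) else 0) volume (s - Real.pi) (s + Real.pi) := by
    refine hInt.mono_fun
      ((hInt.aestronglyMeasurable_restrict_uIoc).indicator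
        (measurableSet_le measurable_const hd)) (Eventually.of_forall fun σ => ?_)
    simp only
    split_ifs
    · exact le_rfl
    · rw [norm_zero]; exact norm_nonneg _
  have hdiff : ∀ σ : ℝ, (if ε ≤ ‖Γ s - Γ σ‖ then g σ * (deriv Γ s / (Γ s - Γ σ)).re else 0)
      = (if ε ≤ ‖Γ s - Γ σ‖ then
      ((K₁ σ).re + (K₂ σ).re + g s * (K₃ σ).re) else 0) - g s * T σ := by
    intro σ
    simp only [hT, norm_sub_rev (Γ σ) (Γ s)]
    split_ifs with h
    · have e : (g σ : ℂ) * (deriv Γ s / (Γ s - Γ σ))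
          = K₁ σ + K₂ σ + g s * K₃ σ - g s * (deriv Γ σ / (Γ σ - Γ s)) := by
        simp only [hK₁, hK₂, hK₃, cauchyDiff]
        rw [← neg_sub (s : ℂ) (σ : ℂ), halfCot_neg]
        ring
      have := congrArg Complex.re e
      simpa only [Complex.sub_re, Complex.add_re, Complex.re_ofReal_mul] using this
    · simp
  simp only [hdiff]
  rw [intervalIntegral.integral_sub hKi (hTi.const_mul _), intervalIntegral.integral_const_mul,
    hzero, mul_zero, sub_zero]

end StripMap

lemma cotIntegral_ofReal_im (g : ℝ → ℝ) (s : ℝ) :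
    (cotIntegral (fun σ => (g σ : ℂ)) s).im = 0 := by
  have : cotIntegral (fun σ => (g σ : ℂ)) s = ((∫ τ in -Real.pi..Real.pi,
      (g (s + τ) - g s) * (Real.cos (-τ / 2) / 2 / Real.sin (-τ / 2)) : ℝ) : ℂ) := by
    rw [cotIntegral, ← intervalIntegral.integral_ofReal]
    refine intervalIntegral.integral_congr fun τ _ => ?_
    simp [halfCot]
  rw [this, Complex.ofReal_im]

lemma Function.Periodic.exists_lipschitzWith {g : ℝ → ℝ} {T : ℝ} (hper : Function.Periodic g T)
    (hT : 0 < T) (hg : ContDiff ℝ 1 g) : ∃ L : NNReal, LipschitzWith L g := by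
  have hc : Continuous (deriv g) := hg.continuous_deriv le_rfl
  have hp : Function.Periodic (deriv g) T := by
    intro s
    rw [← deriv_comp_add_const]
    congr 1
    exact funext hper
  obtain ⟨C, hC⟩ := (hp.compact_of_continuous hT.ne' hc).isBounded.exists_norm_le
  refine ⟨C.toNNReal, lipschitzWith_of_nnnorm_deriv_le (hg.differentiable one_ne_zero) fun x => ?_⟩
  rw [← NNReal.coe_le_coe, coe_nnnorm]
  exact (hC _ (mem_range_self x)).trans (Real.le_coe_toNNReal C)

namespace StripMap
variable {Γ : ℂ → ℂ} {r : ℝ}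

/-- If `a` differs from the principal value of the Cauchy-type integral of `g` by a real analytic
function, then `a - iκπg` extends analytically to the side `κ` of the real line. -/
lemma exists_sided_extension (H : StripMap Γ r) {g a V : ℝ → ℝ} {L : NNReal}
    (hg : LipschitzWith L g) (hgper : Function.Periodic g (2 * Real.pi))
    (hV : ∀ s : ℝ, Tendsto (fun ε : ℝ => ∫ σ in (0 : ℝ)..2 * Real.pi,
        (if ε ≤ ‖Γ s - Γ σ‖ then g σ * (deriv Γ s / (Γ s - Γ σ)).re else 0)) (𝓝[>] 0) (𝓝 (V s)))
    (han : AnalyticOnNhd ℝ (fun s => a s - V s) univ)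
    (haper : Function.Periodic a (2 * Real.pi)) {κ : ℝ} (hκ : κ = 1 ∨ κ = -1) :
    ∃ (ρ : ℝ) (Ψ : ℂ → ℂ), 0 < ρ ∧ Function.Periodic Ψ ((2 * Real.pi : ℝ) : ℂ) ∧
      (∀ ζ : ℂ, |ζ.im| < ρ → ContinuousAt Ψ ζ) ∧
      (∀ ζ : ℂ, |ζ.im| < ρ → 0 < κ * ζ.im → AnalyticAt ℂ Ψ ζ) ∧
      ∀ s : ℝ, Ψ s = a s - κ * Real.pi * Complex.I * g s := by
  have hgC : LipschitzWith L fun σ => (g σ : ℂ) := by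
    simpa [Function.comp_def] using (Complex.isometry_ofReal.lipschitz).comp hg
  have hgCper : Function.Periodic (fun σ => (g σ : ℂ)) (2 * Real.pi) := fun s => by
    simp only [hgper s]
  set R : ℂ → ℂ := fun ζ => ∫ σ in (0 : ℝ)..2 * Real.pi, (g σ : ℂ) * cauchyDiff Γ ζ σ with hR
  set J : ℂ → ℂ := cotIntegral fun σ => (g σ : ℂ) with hJ
  have hJper : Function.Periodic J ((2 * Real.pi : ℝ) : ℂ) := cotIntegral_periodic hgCper
  have hVeq : ∀ s : ℝ, V s = (J s).re + (R s).re := fun s =>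
    tendsto_nhds_unique (hV s) (H.tendsto_principalValue hg hgper s)
  set A : ℝ → ℂ := fun s => ((a s - (J s).re : ℝ) : ℂ) with hA
  have hAeq : A = fun s : ℝ => (((a s - V s) + (R s).re : ℝ) : ℂ) := by
    funext s
    simp only [hA, hVeq s]
    congr 1
    ring
  have hAan : ∀ s : ℝ, AnalyticAt ℝ A s := by
    intro s
    rw [hAeq]
    have h1 : AnalyticAt ℝ (fun s : ℝ => (R s).re) s :=
      (H.analyticAt_integral_cauchyDiff hgC.continuous hgCper s).re_ofReal
    exact (Complex.ofRealCLM.analyticAt _).comp ((han s (mem_univ s)).add h1)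
  have hAper : Function.Periodic A (2 * Real.pi) := by
    intro s
    simp only [hA]
    rw [haper, Complex.ofReal_add, hJper]
  obtain ⟨ρ, hρ, hρA⟩ := exists_strip_analyticAt (complexify_periodic hAper)
    fun s => analyticAt_complexify (hAan s)
  refine ⟨min ρ 2, fun ζ => complexify A ζ + cotSide (fun σ => (g σ : ℂ)) κ ζ,
    lt_min hρ two_pos, fun ζ => ?_, fun ζ hζ => ?_, fun ζ hζ hs => ?_, fun s => ?_⟩
  · simp only [complexify_periodic hAper ζ, cotSide_periodic hgCper κ ζ]
  · exact (hρA ζ (hζ.trans_le (min_le_left _ _))).continuousAt.add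
      (continuousAt_cotSide hgC κ (hζ.trans_le (min_le_right _ _)))
  · exact (hρA ζ (hζ.trans_le (min_le_left _ _))).add
      (analyticAt_cotSide hgC hgCper hκ (hζ.trans_le (min_le_right _ _)) hs)
  · have h1 : J s = ((J s).re : ℂ) := Complex.ext rfl (by simp [hJ, cotIntegral_ofReal_im])
    simp only [complexify_ofReal, cotSide, Complex.ofReal_re, hA]
    rw [← hJ, Complex.ofReal_sub, ← h1]
    ring

end StripMap

/-- The part of the open strip of half-width `r` around the real line lying on the side `κ`. -/
def sideStrip (r κ : ℝ) : Set ℂ := {ζ | |ζ.im| < r ∧ 0 < κ * ζ.im}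

lemma convex_strip (r : ℝ) : Convex ℝ {ζ : ℂ | |ζ.im| < r} := by
  have : {ζ : ℂ | |ζ.im| < r} = Complex.imLm ⁻¹' Metric.ball (0 : ℝ) r := by
    ext ζ
    simp
  rw [this]
  exact (convex_ball _ _).linear_preimage _

lemma convex_sideStrip (r κ : ℝ) : Convex ℝ (sideStrip r κ) := by
  refine (convex_strip r).inter ?_
  exact (convex_Ioi (0 : ℝ)).linear_preimage (κ • Complex.imLm)

lemma HasDerivAt.eventually_pos_right {φ : ℝ → ℝ} {m : ℝ} (h : HasDerivAt φ m 0) (h0 : φ 0 = 0)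
    (hm : 0 < m) : ∀ᶠ δ in 𝓝[>] (0 : ℝ), 0 < φ δ := by
  have h1 := (hasDerivAt_iff_tendsto_slope.1 h).eventually (lt_mem_nhds hm)
  have h2 : 𝓝[>] (0 : ℝ) ≤ 𝓝[≠] 0 := nhdsWithin_mono _ fun x hx => ne_of_gt hx
  filter_upwards [h2 h1, self_mem_nhdsWithin] with δ hδ hpos
  rw [slope_def_field, h0, sub_zero, sub_zero] at hδ
  exact (div_pos_iff_of_pos_right hpos).1 hδ

namespace StripMap
variable {Γ : ℂ → ℂ} {r : ℝ}

lemma mono (H : StripMap Γ r) {ρ : ℝ} (hρ : 0 < ρ) (h : ρ ≤ r) : StripMap Γ ρ where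
  pos := hρ
  per := H.per
  an ζ hζ := H.an ζ (hζ.trans_le h)
  deriv_ne ζ hζ := H.deriv_ne ζ (hζ.trans_le h)
  inj ζ w hζ hw := H.inj ζ w (hζ.trans_le h) (hw.trans_le h)

lemma exists_local_inverse (H : StripMap Γ r) {ζ : ℂ} (hζ : |ζ.im| < r) :
    ∃ G : ℂ → ℂ, HasDerivAt G (deriv Γ ζ)⁻¹ (Γ ζ) ∧ G (Γ ζ) = ζ ∧
      (∀ᶠ z in 𝓝 (Γ ζ), Γ (G z) = z) ∧ ∀ᶠ z in 𝓝 (Γ ζ), |(G z).im| < r := by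
  have hs : HasStrictDerivAt Γ (deriv Γ ζ) ζ := (H.an ζ hζ).hasStrictDerivAt
  have h0 := H.deriv_ne ζ hζ
  have hG := hs.to_localInverse h0
  have hG0 : hs.localInverse Γ (deriv Γ ζ) ζ h0 (Γ ζ) = ζ :=
    (hs.hasStrictFDerivAt_equiv h0).localInverse_apply_image
  refine ⟨hs.localInverse Γ (deriv Γ ζ) ζ h0, hG.hasDerivAt, hG0,
    (hs.hasStrictFDerivAt_equiv h0).eventually_right_inverse, ?_⟩
  have hc : ContinuousAt (fun z => |(hs.localInverse Γ (deriv Γ ζ) ζ h0 z).im|) (Γ ζ) :=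
    (Complex.continuous_im.continuousAt.comp hG.hasDerivAt.continuousAt).abs
  refine hc.eventually (gt_mem_nhds ?_)
  simpa only [hG0] using hζ

lemma isOpen_image (H : StripMap Γ r) : IsOpen (Γ '' {ζ : ℂ | |ζ.im| < r}) := by
  rw [isOpen_iff_mem_nhds]
  rintro _ ⟨ζ, hζ, rfl⟩
  obtain ⟨G, -, -, h1, h2⟩ := H.exists_local_inverse hζ
  filter_upwards [h1, h2] with z hz hz'
  exact ⟨G z, hz', hz⟩

lemma exists_descend (H : StripMap Γ r) {Φ : ℂ → ℂ}
    (hΦ : Function.Periodic Φ ((2 * Real.pi : ℝ) : ℂ)) :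
    ∃ F : ℂ → ℂ, (∀ ζ : ℂ, |ζ.im| < r → F (Γ ζ) = Φ ζ) ∧
      (∀ ζ : ℂ, |ζ.im| < r → ContinuousAt Φ ζ → ContinuousAt F (Γ ζ)) ∧
      ∀ ζ : ℂ, |ζ.im| < r → DifferentiableAt ℂ Φ ζ → DifferentiableAt ℂ F (Γ ζ) := by
  classical
  set F : ℂ → ℂ := fun z => if h : ∃ ζ : ℂ, |ζ.im| < r ∧ Γ ζ = z then Φ h.choose else 0 with hF
  have hFΓ : ∀ ζ : ℂ, |ζ.im| < r → F (Γ ζ) = Φ ζ := by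
    intro ζ hζ
    have h : ∃ w : ℂ, |w.im| < r ∧ Γ w = Γ ζ := ⟨ζ, hζ, rfl⟩
    simp only [hF, dif_pos h]
    obtain ⟨n, hn⟩ := H.inj _ _ h.choose_spec.1 hζ h.choose_spec.2
    rw [hn, hΦ.add_int_mul_two_pi]
  have hloc : ∀ ζ : ℂ, |ζ.im| < r → ∃ G : ℂ → ℂ, HasDerivAt G (deriv Γ ζ)⁻¹ (Γ ζ) ∧
      G (Γ ζ) = ζ ∧ F =ᶠ[𝓝 (Γ ζ)] Φ ∘ G := by
    intro ζ hζ
    obtain ⟨G, hG, hG0, h1, h2⟩ := H.exists_local_inverse hζ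
    refine ⟨G, hG, hG0, ?_⟩
    filter_upwards [h1, h2] with z hz hz'
    rw [Function.comp_apply, ← hFΓ _ hz', hz]
  refine ⟨F, hFΓ, fun ζ hζ hc => ?_, fun ζ hζ hd => ?_⟩
  · obtain ⟨G, hG, hG0, he⟩ := hloc ζ hζ
    rw [← hG0] at hc
    exact (hc.comp hG.continuousAt).congr he.symm
  · obtain ⟨G, hG, hG0, he⟩ := hloc ζ hζ
    rw [← hG0] at hd
    exact (hd.comp _ hG.differentiableAt).congr_of_eventuallyEq he

lemma image_sideStrip_subset (H : StripMap Γ r) {W : Set ℂ} (hW : IsOpen W)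
    (hfr : frontier W = range fun s : ℝ => Γ s) (κ : ℝ) :
    Γ '' sideStrip r κ ⊆ W ∨ Γ '' sideStrip r κ ⊆ (closure W)ᶜ := by
  have hcont : ContinuousOn Γ (sideStrip r κ) := fun ζ hζ =>
    (H.an ζ hζ.1).continuousAt.continuousWithinAt
  have hpre := (convex_sideStrip r κ).isPreconnected.image Γ hcont
  have hsub : Γ '' sideStrip r κ ⊆ W ∪ (closure W)ᶜ := by
    rintro _ ⟨ζ, hζ, rfl⟩
    by_contra hn
    rw [mem_union, not_or, mem_compl_iff, not_not] at hn
    have hmem : Γ ζ ∈ frontier W := by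
      rw [hW.frontier_eq]
      exact ⟨hn.2, hn.1⟩
    rw [hfr] at hmem
    obtain ⟨s, hs⟩ := hmem
    obtain ⟨n, hn⟩ := H.inj ζ s hζ.1 (by simpa using H.pos) hs.symm
    have h2 := hζ.2
    rw [hn] at h2
    simp at h2
  refine hpre.subset_or_subset hW isClosed_closure.isOpen_compl ?_ hsub
  exact disjoint_compl_right.mono_left subset_closure

/-- One side of the boundary curve lies in the domain. -/
lemma exists_interior_side (H : StripMap Γ r) {W : Set ℂ} (hW : IsOpen W)
    (hfr : frontier W = range fun s : ℝ => Γ s) :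
    ∃ κ : ℝ, (κ = 1 ∨ κ = -1) ∧ Γ '' sideStrip r (-κ) ⊆ W := by
  have h0 : Γ (0 : ℝ) ∈ frontier W := hfr ▸ mem_range_self (0 : ℝ)
  obtain ⟨z, ⟨ζ, hζ, rfl⟩, hzW⟩ := mem_closure_iff.1 (frontier_subset_closure h0) _ H.isOpen_image
    ⟨((0 : ℝ) : ℂ), by simpa using H.pos, rfl⟩
  have him : ζ.im ≠ 0 := by
    intro him
    have : Γ ζ ∈ frontier W := by
      rw [hfr]
      have hre : ((ζ.re : ℝ) : ℂ) = ζ := Complex.ext rfl (by simp [him])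
      exact ⟨ζ.re, congrArg Γ hre⟩
    rw [hW.frontier_eq] at this
    exact this.2 hzW
  have key : ∀ κ : ℝ, 0 < -κ * ζ.im → Γ '' sideStrip r (-κ) ⊆ W := by
    intro κ hκ
    have hmem : Γ ζ ∈ Γ '' sideStrip r (-κ) := mem_image_of_mem _ ⟨hζ, hκ⟩
    rcases H.image_sideStrip_subset hW hfr (-κ) with h | h
    · exact h
    · exact absurd (subset_closure hzW) (h hmem)
  rcases him.lt_or_gt with h | h
  · exact ⟨1, Or.inl rfl, key 1 (by linarith)⟩
  · exact ⟨-1, Or.inr rfl, key (-1) (by linarith)⟩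

/-- A normal direction that leaves the closure of the domain points to a side outside of it. -/
lemma exists_exterior_side (H : StripMap Γ r) {W : Set ℂ} (hW : IsOpen W)
    (hfr : frontier W = range fun s : ℝ => Γ s) {s : ℝ} {ν : ℂ} (hν : ‖ν‖ = 1)
    (hperp : (ν * (starRingEnd ℂ) (deriv Γ s)).re = 0)
    (hout : ∃ ε > (0 : ℝ), ∀ δ ∈ Ioo (0 : ℝ) ε, Γ s + δ * ν ∉ closure W) :
    ∃ κ : ℝ, (κ = 1 ∨ κ = -1) ∧ ν = κ * Complex.I * (deriv Γ s / ‖deriv Γ s‖) ∧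
      Γ '' sideStrip r κ ⊆ (closure W)ᶜ := by
  have hs : |((s : ℂ)).im| < r := by simpa using H.pos
  have hd : deriv Γ s ≠ 0 := H.deriv_ne s hs
  have hn : (0 : ℝ) < ‖deriv Γ s‖ := norm_pos_iff.2 hd
  have hnC : (‖deriv Γ s‖ : ℂ) ≠ 0 := by exact_mod_cast hn.ne'
  set d := deriv Γ s with hddef
  set m : ℝ := (ν * (starRingEnd ℂ) d).im with hm
  have hνd : ν * (starRingEnd ℂ) d = m * Complex.I :=
    Complex.ext (by simp [hperp]) (by simp [hm])
  have habs : |m| = ‖d‖ := by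
    have := congrArg norm hνd
    simpa [hν] using this.symm
  have hdd : (starRingEnd ℂ) d * d = (‖d‖ : ℂ) ^ 2 := by
    rw [mul_comm, Complex.mul_conj, Complex.normSq_eq_norm_sq]
    push_cast
    rfl
  have hνeq : ν * (‖d‖ : ℂ) ^ 2 = m * Complex.I * d := by
    rw [← hdd, ← mul_assoc, hνd]
  obtain ⟨κ, hκ, hmκ⟩ : ∃ κ : ℝ, (κ = 1 ∨ κ = -1) ∧ m = κ * ‖d‖ := by
    rcases abs_choice m with h | h
    · exact ⟨1, Or.inl rfl, by rw [← habs, h, one_mul]⟩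
    · exact ⟨-1, Or.inr rfl, by rw [← habs, h]; ring⟩
  have hν' : ν = κ * Complex.I * (d / ‖d‖) := by
    have : ν * (‖d‖ : ℂ) ^ 2 = (κ * Complex.I * (d / ‖d‖)) * (‖d‖ : ℂ) ^ 2 := by
      rw [hνeq, hmκ]
      push_cast
      field_simp
    exact mul_right_cancel₀ (pow_ne_zero 2 hnC) this
  refine ⟨κ, hκ, hν', ?_⟩
  obtain ⟨G, hG, hG0, h1, h2⟩ := H.exists_local_inverse hs
  have hline : HasDerivAt (fun δ : ℝ => Γ s + δ * ν) ν 0 := by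
    simpa using ((hasDerivAt_id (0 : ℝ)).ofReal_comp.mul_const ν).const_add (Γ s)
  have hline0 : Γ s + ((0 : ℝ) : ℂ) * ν = Γ s := by simp
  have hcomp : HasDerivAt (fun δ : ℝ => G (Γ s + δ * ν)) (d⁻¹ * ν) 0 := by
    have hG' : HasDerivAt G d⁻¹ (Γ s + ((0 : ℝ) : ℂ) * ν) := by rwa [hline0]
    exact HasDerivAt.comp (0 : ℝ) hG' hline
  have him : HasDerivAt (fun δ : ℝ => κ * (G (Γ s + δ * ν)).im) (κ * (d⁻¹ * ν).im) 0 :=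
    (Complex.imCLM.hasFDerivAt.comp_hasDerivAt (0 : ℝ) hcomp).const_mul κ
  have hκ2 : κ * κ = 1 := by rcases hκ with rfl | rfl <;> norm_num
  have hval : κ * (d⁻¹ * ν).im = ‖d‖⁻¹ := by
    have : d⁻¹ * ν = ((κ * ‖d‖⁻¹ : ℝ) : ℂ) * Complex.I := by
      rw [hν']
      push_cast
      field_simp
    rw [this, Complex.im_ofReal_mul, Complex.I_im, mul_one, ← mul_assoc, hκ2, one_mul]
  have hpos := him.eventually_pos_right (by simp [hG0]) (by rw [hval]; positivity)
  have htend : Tendsto (fun δ : ℝ => Γ s + δ * ν) (𝓝[>] 0) (𝓝 (Γ s)) := by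
    have := hline.continuousAt.tendsto
    rw [hline0] at this
    exact this.mono_left nhdsWithin_le_nhds
  obtain ⟨ε, hε, hout⟩ := hout
  obtain ⟨δ, ⟨⟨⟨hp, e1⟩, e2⟩, hδ⟩⟩ := (((hpos.and (htend.eventually h1)).and
    (htend.eventually h2)).and (Ioo_mem_nhdsGT hε)).exists
  have hmem : Γ s + δ * ν ∈ Γ '' sideStrip r κ := ⟨_, ⟨e2, hp⟩, e1⟩
  rcases H.image_sideStrip_subset hW hfr κ with h | h
  · exact absurd (subset_closure (h hmem)) (hout δ hδ)
  · exact h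

end StripMap

lemma analyticAt_norm_of_ne {φ : ℝ → ℂ} {s : ℝ} (h : AnalyticAt ℝ φ s) (h0 : φ s ≠ 0) :
    AnalyticAt ℝ (fun s => ‖φ s‖) s :=
  ContDiffAt.analyticAt (h.contDiffAt.norm ℝ h0)

lemma periodic_deriv_real {E : Type*} [NormedAddCommGroup E] [NormedSpace ℝ E] {φ : ℝ → E} {T : ℝ}
    (h : Function.Periodic φ T) : Function.Periodic (deriv φ) T := by
  intro s
  rw [← deriv_comp_add_const]
  congr 1
  exact funext h

theorem exists_holomorphic_field {W : Set ℂ} (hWo : IsOpen W) (hWc : IsConnected W) {c : ℝ → ℂ}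
    (han : AnalyticOnNhd ℝ c univ) (hper : Function.Periodic c (2 * Real.pi))
    (hreg : ∀ s, deriv c s ≠ 0) (hinj : InjOn c (Ico 0 (2 * Real.pi)))
    (hfr : range c = frontier W) {ν : ℝ → ℂ} (hν : ∀ s, ‖ν s‖ = 1)
    (hperp : ∀ s, (ν s * (starRingEnd ℂ) (deriv c s)).re = 0)
    (hout : ∀ s, ∃ ε > (0 : ℝ), ∀ δ ∈ Ioo (0 : ℝ) ε, c s + δ * ν s ∉ closure W)
    {f h q : ℝ → ℝ} (hf : Function.Periodic f (2 * Real.pi)) (hh : ContDiff ℝ 1 h)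
    (hhper : Function.Periodic h (2 * Real.pi))
    (hq : ∀ s : ℝ, Tendsto (fun ε : ℝ => ∫ σ in (0 : ℝ)..2 * Real.pi,
        (if ε ≤ ‖c s - c σ‖ then h σ * ((deriv c s / ‖deriv c s‖ *
          (starRingEnd ℂ) (c s - c σ)).re / ‖c s - c σ‖ ^ 2) * ‖deriv c σ‖ else 0))
        (𝓝[>] 0) (𝓝 (Real.pi * q s)))
    (hfq : AnalyticOnNhd ℝ (fun s => f s - q s) univ) :
    ∃ (U : Set ℂ) (F : ℂ → ℂ), IsOpen U ∧ IsConnected U ∧ closure W ⊆ U ∧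
      DifferentiableOn ℂ F (U \ closure W) ∧ ContinuousOn F (U \ W) ∧
      ∀ s, (F (c s) * (deriv c s / ‖deriv c s‖)).re = f s ∧ (F (c s) * ν s).re = h s := by
  obtain ⟨r, H⟩ := exists_stripMap han hper hreg hinj
  set Γ := complexify c with hΓ
  have hΓc : ∀ s : ℝ, Γ s = c s := complexify_ofReal c
  have hΓd : ∀ s : ℝ, deriv Γ s = deriv c s := by
    intro s
    have h1 := H.hasDerivAt_ofReal s
    simp only [hΓc] at h1
    exact h1.deriv.symm
  have hn : ∀ s, (0 : ℝ) < ‖deriv c s‖ := fun s => norm_pos_iff.2 (hreg s)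
  have hdan : ∀ s, AnalyticAt ℝ (deriv c) s := fun s => (han s (mem_univ s)).deriv
  have hnan : ∀ s, AnalyticAt ℝ (fun s => ‖deriv c s‖) s := fun s =>
    analyticAt_norm_of_ne (hdan s) (hreg s)
  have hnper : ∀ s, ‖deriv c (s + 2 * Real.pi)‖ = ‖deriv c s‖ := fun s => by
    rw [periodic_deriv_real hper s]
  have hfr' : frontier W = range fun s : ℝ => Γ s := by
    rw [← hfr]
    simp only [hΓc]
  -- the two sides of the curve
  obtain ⟨κ, hκ, hInt⟩ := H.exists_interior_side hWo hfr'
  have hκ2 : κ * κ = 1 := by rcases hκ with rfl | rfl <;> norm_num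
  have hside : ∀ s, ν s = κ * Complex.I * (deriv c s / ‖deriv c s‖) := by
    intro s
    obtain ⟨κ', hκ', h1, h2⟩ := H.exists_exterior_side hWo hfr' (s := s) (hν s)
      (by rw [hΓd]; exact hperp s) (by simpa only [hΓc] using hout s)
    rw [hΓd] at h1
    have hkk : κ' = κ := by
      by_contra hne
      have hneg : κ' = -κ := by
        rcases hκ with rfl | rfl <;> rcases hκ' with rfl | rfl <;> simp_all
      rw [hneg] at h2
      have hmem : Γ ((-κ * (r / 2) : ℝ) * Complex.I) ∈ Γ '' sideStrip r (-κ) := by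
        refine mem_image_of_mem _ ⟨?_, ?_⟩
        · have hk : |κ| = 1 := by rcases hκ with rfl | rfl <;> norm_num
          rw [Complex.im_ofReal_mul, Complex.I_im, mul_one, abs_mul, abs_neg, hk, one_mul,
            abs_of_pos (half_pos H.pos)]
          exact half_lt_self H.pos
        · rw [Complex.im_ofReal_mul, Complex.I_im, mul_one, ← mul_assoc, neg_mul_neg, hκ2, one_mul]
          exact half_pos H.pos
      exact h2 hmem (subset_closure (hInt hmem))
    rw [h1, hkk]
  -- the boundary values
  set g : ℝ → ℝ := fun s => h s * ‖deriv c s‖ with hg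
  have hgC : ContDiff ℝ 1 g := hh.mul (contDiff_iff_contDiffAt.2 fun s => (hnan s).contDiffAt)
  have hgper : Function.Periodic g (2 * Real.pi) := fun s => by
    simp only [hg, hnper, hhper s]
  obtain ⟨L, hL⟩ := hgper.exists_lipschitzWith Real.two_pi_pos hgC
  have hV : ∀ s : ℝ, Tendsto (fun ε : ℝ => ∫ σ in (0 : ℝ)..2 * Real.pi,
      (if ε ≤ ‖Γ s - Γ σ‖ then g σ * (deriv Γ s / (Γ s - Γ σ)).re else 0)) (𝓝[>] 0)
      (𝓝 (‖deriv c s‖ * (Real.pi * q s))) := by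
    intro s
    refine ((hq s).const_mul ‖deriv c s‖).congr fun ε => ?_
    rw [← intervalIntegral.integral_const_mul]
    refine intervalIntegral.integral_congr fun σ _ => ?_
    simp only [hΓc, hΓd]
    split_ifs with hε
    · have hre : (deriv c s / (c s - c σ)).re
          = (deriv c s * (starRingEnd ℂ) (c s - c σ)).re / ‖c s - c σ‖ ^ 2 := by
        rw [div_eq_mul_inv, Complex.inv_def, ← mul_assoc, Complex.re_mul_ofReal,
          Complex.normSq_eq_norm_sq, div_eq_mul_inv]
      have hre' : (deriv c s / ‖deriv c s‖ * (starRingEnd ℂ) (c s - c σ)).re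
          = (deriv c s * (starRingEnd ℂ) (c s - c σ)).re / ‖deriv c s‖ := by
        rw [div_mul_eq_mul_div, Complex.div_ofReal_re]
      rw [hre, hre', hg]
      have := (hn s).ne'
      field_simp
    · rw [mul_zero]
  set a : ℝ → ℝ := fun s => Real.pi * ‖deriv c s‖ * f s with ha
  have haV : AnalyticOnNhd ℝ (fun s => a s - ‖deriv c s‖ * (Real.pi * q s)) univ := by
    intro s _
    have : (fun s => a s - ‖deriv c s‖ * (Real.pi * q s))
        = fun s => (Real.pi * ‖deriv c s‖) * (f s - q s) := by
      funext s
      simp only [ha]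
      ring
    rw [this]
    exact (analyticAt_const.mul (hnan s)).mul (hfq s (mem_univ s))
  have haper : Function.Periodic a (2 * Real.pi) := fun s => by
    simp only [ha, hnper, hf s]
  obtain ⟨ρ', Ψ, hρ', hΨper, hΨc, hΨan, hΨb⟩ :=
    H.exists_sided_extension hL hgper hV haV haper hκ
  -- shrink the strip
  set ρ := min r ρ' with hρdef
  have hρr : ρ ≤ r := min_le_left _ _
  have hρρ' : ρ ≤ ρ' := min_le_right _ _
  have K : StripMap Γ ρ := H.mono (lt_min H.pos hρ') hρr
  have hΦper : Function.Periodic (fun ζ => Ψ ζ / (Real.pi * deriv Γ ζ))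
      ((2 * Real.pi : ℝ) : ℂ) := fun ζ => by
    simp only [hΨper ζ, periodic_deriv H.per ζ]
  have hpiC : (Real.pi : ℂ) ≠ 0 := by exact_mod_cast Real.pi_ne_zero
  obtain ⟨F, hFΓ, hFc, hFd⟩ := K.exists_descend hΦper
  set N := Γ '' {ζ : ℂ | |ζ.im| < ρ} with hN
  have hreal : ∀ s : ℝ, |((s : ℂ)).im| < ρ := fun s => by simpa using K.pos
  have hfrN : frontier W ⊆ N := by
    rw [hfr']
    rintro _ ⟨s, rfl⟩
    exact ⟨s, hreal s, rfl⟩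
  have hNpre : IsPreconnected N :=
    (convex_strip ρ).isPreconnected.image Γ fun ζ hζ =>
      (K.an ζ hζ).continuousAt.continuousWithinAt
  have hcN : c 0 ∈ N := hfrN (hfr ▸ mem_range_self 0)
  have hcW : c 0 ∈ frontier W := hfr ▸ mem_range_self 0
  obtain ⟨p, hpN, hpW⟩ := mem_closure_iff.1 (frontier_subset_closure hcW) N K.isOpen_image hcN
  have hsideN : ∀ z ∈ (W ∪ N) \ closure W, ∃ ζ : ℂ, |ζ.im| < ρ ∧ 0 < κ * ζ.im ∧ Γ ζ = z := by
    rintro z ⟨hz | ⟨ζ, hζ, rfl⟩, hzc⟩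
    · exact absurd (subset_closure hz) hzc
    refine ⟨ζ, hζ, ?_, rfl⟩
    by_contra hle
    rcases (not_lt.1 hle).lt_or_eq with hlt | heq
    · exact hzc (subset_closure (hInt (mem_image_of_mem _ ⟨lt_of_lt_of_le hζ hρr, by linarith⟩)))
    · have him : ζ.im = 0 := by
        rcases mul_eq_zero.1 heq with h0 | h0
        · rw [h0] at hκ2
          norm_num at hκ2
        · exact h0
      have hre : ((ζ.re : ℝ) : ℂ) = ζ := Complex.ext rfl (by simp [him])
      refine hzc (frontier_subset_closure ?_)
      rw [hfr']
      exact ⟨ζ.re, congrArg Γ hre⟩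
  refine ⟨W ∪ N, F, hWo.union K.isOpen_image,
    ⟨⟨p, Or.inl hpW⟩, IsPreconnected.union p hpW hpN hWc.isPreconnected hNpre⟩, ?_, ?_, ?_, ?_⟩
  · rw [closure_eq_self_union_frontier]
    exact union_subset_union_right _ hfrN
  · intro z hz
    obtain ⟨ζ, hζ, hpos, rfl⟩ := hsideN z hz
    refine (hFd ζ hζ ?_).differentiableWithinAt
    exact (hΨan ζ (hζ.trans_le hρρ') hpos).differentiableAt.div
      ((K.an ζ hζ).deriv.differentiableAt.const_mul _) (mul_ne_zero hpiC (K.deriv_ne ζ hζ))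
  · rintro z ⟨hz | ⟨ζ, hζ, rfl⟩, hzc⟩
    · exact absurd hz hzc
    refine (hFc ζ hζ ?_).continuousWithinAt
    exact (hΨc ζ (hζ.trans_le hρρ')).div
      (continuousAt_const.mul (K.an ζ hζ).deriv.continuousAt) (mul_ne_zero hpiC (K.deriv_ne ζ hζ))
  · intro s
    have hnC : (‖deriv c s‖ : ℂ) ≠ 0 := by exact_mod_cast (hn s).ne'
    have hd := hreg s
    have hval : F (c s) * (deriv c s / ‖deriv c s‖) = f s - κ * Complex.I * h s := by
      rw [← hΓc, hFΓ s (hreal s), hΨb, hΓd, ha, hg]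
      push_cast
      field_simp
    refine ⟨by rw [hval]; simp, ?_⟩
    have hval' : F (c s) * ν s = κ * Complex.I * (F (c s) * (deriv c s / ‖deriv c s‖)) := by
      rw [hside s]
      ring
    have hκC : (κ : ℂ) * κ = 1 := by exact_mod_cast hκ2
    have : F (c s) * ν s = h s + (κ * f s : ℝ) * Complex.I := by
      rw [hval', hval]
      push_cast
      linear_combination (-(κ : ℂ) * κ * h s) * Complex.I_sq + (h s : ℂ) * hκC
    rw [this]
    simp

/-- The point of the complex plane with the given coordinates. -/
noncomputable def toComplex : (ℝ × ℝ) ≃L[ℝ] ℂ := Complex.equivRealProdCLM.symm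

lemma toComplex_re (v : ℝ × ℝ) : (toComplex v).re = v.1 := rfl

lemma toComplex_im (v : ℝ × ℝ) : (toComplex v).im = v.2 := rfl

lemma norm_toComplex (v : ℝ × ℝ) : ‖toComplex v‖ = enorm2 v := by
  rw [Complex.norm_def, Complex.normSq_apply, toComplex_re, toComplex_im, enorm2, ← sq, ← sq]

lemma re_toComplex_mul_conj (u v : ℝ × ℝ) :
    (toComplex u * (starRingEnd ℂ) (toComplex v)).re = dot u v := by
  simp [toComplex_re, toComplex_im, dot]

/-- The planar vector field `(Re F, -Im F)`. -/
noncomputable def conjField (F : ℂ → ℂ) (p : ℝ × ℝ) : ℝ × ℝ :=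
  ((F (toComplex p)).re, -(F (toComplex p)).im)

lemma dot_conjField (F : ℂ → ℂ) (p v : ℝ × ℝ) :
    dot (conjField F p) v = (F (toComplex p) * toComplex v).re := by
  simp [dot, conjField, toComplex_re, toComplex_im]
  ring

lemma hasDerivAt_toComplex_left (x y : ℝ) : HasDerivAt (fun x => toComplex (x, y)) 1 x := by
  have h1 : HasDerivAt (fun x : ℝ => (x, y)) ((1 : ℝ), (0 : ℝ)) x :=
    (hasDerivAt_id x).prodMk (hasDerivAt_const x y)
  exact (toComplex.hasFDerivAt.comp_hasDerivAt x h1).congr_deriv (Complex.ext rfl rfl)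

lemma hasDerivAt_toComplex_right (x y : ℝ) :
    HasDerivAt (fun y => toComplex (x, y)) Complex.I y := by
  have h1 : HasDerivAt (fun y : ℝ => (x, y)) ((0 : ℝ), (1 : ℝ)) y :=
    (hasDerivAt_const y x).prodMk (hasDerivAt_id y)
  exact (toComplex.hasFDerivAt.comp_hasDerivAt y h1).congr_deriv (Complex.ext rfl rfl)

lemma divg_curl2_conjField {F : ℂ → ℂ} {p : ℝ × ℝ} (hF : DifferentiableAt ℂ F (toComplex p)) :
    divg (conjField F) p = 0 ∧ curl2 (conjField F) p = 0 := by
  obtain ⟨x, y⟩ := p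
  set d := deriv F (toComplex (x, y))
  have hx : HasDerivAt (fun x => F (toComplex (x, y))) d x :=
    (hF.hasDerivAt.comp x (hasDerivAt_toComplex_left x y)).congr_deriv (mul_one d)
  have hy : HasDerivAt (fun y => F (toComplex (x, y))) (d * Complex.I) y :=
    hF.hasDerivAt.comp y (hasDerivAt_toComplex_right x y)
  have hx1 : HasDerivAt (fun x => (F (toComplex (x, y))).re) d.re x :=
    Complex.reCLM.hasFDerivAt.comp_hasDerivAt x hx
  have hx2 : HasDerivAt (fun x => -(F (toComplex (x, y))).im) (-d.im) x :=
    (Complex.imCLM.hasFDerivAt.comp_hasDerivAt x hx).neg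
  have hy1 : HasDerivAt (fun y => (F (toComplex (x, y))).re) (d * Complex.I).re y :=
    Complex.reCLM.hasFDerivAt.comp_hasDerivAt y hy
  have hy2 : HasDerivAt (fun y => -(F (toComplex (x, y))).im) (-(d * Complex.I).im) y :=
    (Complex.imCLM.hasFDerivAt.comp_hasDerivAt y hy).neg
  constructor
  · simp only [divg, pdx, pdy, conjField, hx1.deriv, hy2.deriv]
    simp
  · simp only [curl2, pdx, pdy, conjField, hx2.deriv, hy1.deriv]
    simp

/-- sufficiency of the compatibility-regularity condition.
Let `Ω ⊂ ℝ²` be open, bounded and simply connected with real analytic boundary `∂Ω`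
(regularly parameterised by the `2π`-periodic real analytic `γ`), with unit tangent field `tau`
and outward unit normal field `nor`, and let `f, h ∈ C¹(∂Ω)`. Let `Hh` be given by the principal
value `(Hh)(v) = (1/π) lim_{ε→0} ∫_{∂Ω∖B_ε(v)} h(w) (t(v)·(v−w))/|v−w|² dw` (arclength integral).
If `f − Hh` is real analytic on `∂Ω`, then the Cauchy problem `div B = 0`, `curl B = 0` on
`U ∖ cl Ω`, `B·t = f`, `B·n = h` on `∂Ω` has a solution `B ∈ C¹(U∖cl Ω) ∩ C(U∖Ω)` for some open
connected `U ⊇ cl Ω`. -/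
theorem stmt4
    (Ω : Set (ℝ × ℝ)) (hΩo : IsOpen Ω) (hΩb : Bornology.IsBounded Ω)
    (hΩsc : SimplyConnectedSpace Ω)
    (γ : ℝ → ℝ × ℝ)
    (hγan : AnalyticOnNhd ℝ γ Set.univ)
    (hγper : Function.Periodic γ (2 * Real.pi))
    (hγreg : ∀ s : ℝ, deriv γ s ≠ 0)
    (hγrange : Set.range γ = frontier Ω)
    (hγinj : Set.InjOn γ (Set.Ico 0 (2 * Real.pi)))
    (tau nor : ℝ × ℝ → ℝ × ℝ)
    -- tau is the unit tangent to ∂Ω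
    (htau : ∀ s : ℝ, tau (γ s) = (enorm2 (deriv γ s))⁻¹ • deriv γ s)
    -- nor is the outward unit normal to ∂Ω
    (hnor1 : ∀ v ∈ frontier Ω, enorm2 (nor v) = 1)
    (hnor2 : ∀ v ∈ frontier Ω, dot (nor v) (tau v) = 0)
    (hnor3 : ∀ v ∈ frontier Ω, ∃ ε > (0 : ℝ), ∀ δ ∈ Set.Ioo (0 : ℝ) ε,
      v + δ • nor v ∉ closure Ω)
    (f h : ℝ × ℝ → ℝ)
    -- f, h ∈ C¹(∂Ω)
    (hf : ContDiff ℝ 1 (fun s : ℝ => f (γ s)))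
    (hh : ContDiff ℝ 1 (fun s : ℝ => h (γ s)))
    -- Hh is the principal-value integral operator applied to h
    (Hh : ℝ × ℝ → ℝ)
    (hHh : ∀ s : ℝ, Filter.Tendsto (fun ε : ℝ =>
        ∫ σ in (0 : ℝ)..(2 * Real.pi),
          (if ε ≤ enorm2 (γ s - γ σ) then
            h (γ σ) * (dot (tau (γ s)) (γ s - γ σ) / enorm2 (γ s - γ σ) ^ 2) *
              enorm2 (deriv γ σ)
          else 0))
        (𝓝[>] 0) (𝓝 (Real.pi * Hh (γ s))))
    -- f − Hh is real analytic on ∂Ω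
    (hreg : AnalyticOnNhd ℝ (fun s : ℝ => f (γ s) - Hh (γ s)) Set.univ) :
    -- then the Cauchy problem has a solution
    ∃ (U : Set (ℝ × ℝ)) (B : ℝ × ℝ → ℝ × ℝ),
      IsOpen U ∧ IsConnected U ∧ closure Ω ⊆ U ∧
      ContDiffOn ℝ 1 B (U \ closure Ω) ∧ ContinuousOn B (U \ Ω) ∧
      (∀ p ∈ U \ closure Ω, divg B p = 0) ∧
      (∀ p ∈ U \ closure Ω, curl2 B p = 0) ∧
      (∀ v ∈ frontier Ω, dot (B v) (tau v) = f v) ∧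
      (∀ v ∈ frontier Ω, dot (B v) (nor v) = h v) := by
  set e := toComplex.toHomeomorph with he
  set W : Set ℂ := e.symm ⁻¹' Ω with hW
  have heW : ∀ v : ℝ × ℝ, toComplex v ∈ W ↔ v ∈ Ω := fun v => by
    change e.symm (e v) ∈ Ω ↔ v ∈ Ω
    rw [e.symm_apply_apply]
  have hclos : closure W = e.symm ⁻¹' closure Ω := (e.symm.preimage_closure Ω).symm
  have heclos : ∀ v : ℝ × ℝ, toComplex v ∈ closure W ↔ v ∈ closure Ω := fun v => by
    rw [hclos]
    change e.symm (e v) ∈ closure Ω ↔ v ∈ closure Ω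
    rw [e.symm_apply_apply]
  have hfront : frontier W = e '' frontier Ω := by
    rw [e.image_eq_preimage_symm, e.symm.preimage_frontier]
  set c : ℝ → ℂ := fun s => toComplex (γ s) with hc
  have hcd : ∀ s, deriv c s = toComplex (deriv γ s) := fun s =>
    (toComplex.hasFDerivAt.comp_hasDerivAt s
      (hγan s (mem_univ s)).differentiableAt.hasDerivAt).deriv
  have hΩc : IsConnected Ω := by
    rw [isConnected_iff_connectedSpace]
    infer_instance
  have hWc : IsConnected W := by
    rw [hW, ← e.image_eq_preimage_symm]
    exact hΩc.image _ e.continuous.continuousOn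
  have hmem : ∀ s, γ s ∈ frontier Ω := fun s => hγrange ▸ mem_range_self s
  have htau' : ∀ s, toComplex (tau (γ s)) = deriv c s / ‖deriv c s‖ := fun s => by
    rw [htau, hcd, norm_toComplex, map_smul, Complex.real_smul, Complex.ofReal_inv, div_eq_inv_mul]
  have hcne : ∀ s, deriv c s ≠ 0 := fun s => by
    rw [hcd]
    exact (map_ne_zero_iff _ toComplex.injective).2 (hγreg s)
  obtain ⟨U, F, hUo, hUc, hWU, hFd, hFc, hb⟩ := exists_holomorphic_field (W := W)
    (hΩo.preimage e.symm.continuous) hWc (c := c)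
    (fun s _ => (toComplex.toContinuousLinearMap.analyticAt _).comp (hγan s (mem_univ s)))
    (fun s => by simp only [hc, hγper s]) hcne
    (fun x hx y hy hxy => hγinj hx hy (toComplex.injective hxy))
    (by rw [hfront, ← hγrange, ← range_comp]; rfl)
    (ν := fun s => toComplex (nor (γ s)))
    (fun s => by rw [norm_toComplex]; exact hnor1 _ (hmem s))
    (fun s => by
      have h1 := hnor2 _ (hmem s)
      rw [← re_toComplex_mul_conj, htau', map_div₀, Complex.conj_ofReal, ← mul_div_assoc,
        Complex.div_ofReal_re, div_eq_zero_iff] at h1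
      exact h1.resolve_right (norm_ne_zero_iff.2 (hcne s)))
    (fun s => by
      obtain ⟨ε, hε, h1⟩ := hnor3 _ (hmem s)
      refine ⟨ε, hε, fun δ hδ => ?_⟩
      rw [← Complex.real_smul, hc, ← map_smul, ← map_add, heclos]
      exact h1 δ hδ)
    (f := fun s => f (γ s)) (h := fun s => h (γ s)) (q := fun s => Hh (γ s))
    (fun s => by simp only [hγper s]) hh (fun s => by simp only [hγper s])
    (fun s => by
      refine (hHh s).congr fun ε => ?_
      refine intervalIntegral.integral_congr fun σ _ => ?_
      have hsub : ∀ σ, c s - c σ = toComplex (γ s - γ σ) := fun σ => (map_sub toComplex _ _).symm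
      simp only [← htau', hcd σ, hsub, norm_toComplex, re_toComplex_mul_conj])
    hreg
  have hdiff : ∀ p ∈ toComplex ⁻¹' U \ closure Ω, DifferentiableAt ℂ F (toComplex p) := by
    intro p hp
    have hp' : toComplex p ∈ U \ closure W := ⟨hp.1, fun h1 => hp.2 ((heclos p).1 h1)⟩
    exact (hFd _ hp').differentiableAt
      ((hUo.sdiff isClosed_closure).mem_nhds hp')
  refine ⟨toComplex ⁻¹' U, conjField F, hUo.preimage e.continuous, ?_, ?_, ?_, ?_,
    fun p hp => (divg_curl2_conjField (hdiff p hp)).1,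
    fun p hp => (divg_curl2_conjField (hdiff p hp)).2, ?_, ?_⟩
  · have : toComplex ⁻¹' U = e.symm '' U := (e.symm.image_eq_preimage_symm U).symm
    rw [this]
    exact hUc.image _ e.symm.continuous.continuousOn
  · exact fun p hp => hWU ((heclos p).2 hp)
  · have h1 : ContDiffOn ℝ 1 F (U \ closure W) :=
      (hFd.contDiffOn (hUo.sdiff isClosed_closure)).restrict_scalars ℝ
    have h2 : ContDiffOn ℝ 1 (fun p => F (toComplex p)) (toComplex ⁻¹' U \ closure Ω) :=
      h1.comp toComplex.contDiff.contDiffOn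
        fun p hp => ⟨hp.1, fun h3 => hp.2 ((heclos p).1 h3)⟩
    exact (Complex.reCLM.contDiff.comp_contDiffOn h2).prodMk
      (Complex.imCLM.contDiff.comp_contDiffOn h2).neg
  · have h2 : ContinuousOn (fun p => F (toComplex p)) (toComplex ⁻¹' U \ Ω) :=
      hFc.comp toComplex.continuous.continuousOn
        fun p hp => ⟨hp.1, fun h3 => hp.2 ((heW p).1 h3)⟩
    exact (Complex.continuous_re.comp_continuousOn h2).prodMk
      (Complex.continuous_im.comp_continuousOn h2).neg
  · intro v hv
    obtain ⟨s, rfl⟩ := hγrange.symm ▸ hv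
    rw [dot_conjField, htau']
    exact (hb s).1
  · intro v hv
    obtain ⟨s, rfl⟩ := hγrange.symm ▸ hv
    rw [dot_conjField]
    exact (hb s).2
end

section
/- Let (b_n)_{n≥0} be a sequence of complex numbers with |b₀| = 1, let R₁ ∈ (0,∞] be the radius of convergence of the power series ∑ b_n xⁿ, and let R₂ ∈ (0,∞]. For r ∈ (0, min{R₁,R₂}) set M₁(r) := sup{1, |b₁|r, |b₂|r², …}, and define r₀ := min{ 1/sup_{n≥1}|b_n|^{1/n}, R₂ } (with the convention that 1/sup_{n≥1}|b_n|^{1/n} = ∞ when all b_n with n ≥ 1 vanish). Then 0 < r₀ ≤ min{R₁,R₂} and sup_{r∈(0,min{R₁,R₂})} r/(2M₁(r)) = r₀/2. -/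
open Filter Topology Set ENNReal NNReal

/-- Cauchy-type criterion: the reciprocal of `sup_{n ≥ 1} aₙ^{1/n}` is the largest `r` such that
`aₙ rⁿ ≤ 1` for all `n ≥ 1`. -/
theorem ofReal_le_inv_iSup_rpow_inv_iff {a : ℕ → ℝ} (ha : ∀ n, 0 ≤ a n) {r : ℝ} (hr : 0 < r) :
    ENNReal.ofReal r ≤ (⨆ (n : ℕ) (_ : 1 ≤ n), ENNReal.ofReal (a n ^ ((n : ℝ)⁻¹)))⁻¹ ↔
      ∀ n : ℕ, 1 ≤ n → a n * r ^ n ≤ 1 := by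
  rw [ENNReal.le_inv_iff_le_inv, iSup₂_le_iff]
  refine forall₂_congr fun n hn => ?_
  have hn' : (0 : ℝ) < n := by exact_mod_cast hn
  rw [← ENNReal.ofReal_inv_of_pos hr, ENNReal.ofReal_le_ofReal_iff (by positivity),
    Real.rpow_inv_le_iff_of_pos (ha n) (by positivity) hn', Real.rpow_natCast, inv_pow,
    ← one_div, le_div_iff₀ (by positivity)]

/-- If `aₙ rⁿ ≤ C` for all `n ≥ 1` with `C ≥ 1`, then `r / C ≤ 1 / sup_{n ≥ 1} aₙ^{1/n}`. -/
theorem ofReal_div_le_inv_iSup_rpow_inv {a : ℕ → ℝ} (ha : ∀ n, 0 ≤ a n) {r C : ℝ} (hr : 0 < r)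
    (hC : 1 ≤ C) (h : ∀ n : ℕ, 1 ≤ n → a n * r ^ n ≤ C) :
    ENNReal.ofReal (r / C) ≤
      (⨆ (n : ℕ) (_ : 1 ≤ n), ENNReal.ofReal (a n ^ ((n : ℝ)⁻¹)))⁻¹ := by
  have hC0 : 0 < C := one_pos.trans_le hC
  rw [ofReal_le_inv_iSup_rpow_inv_iff ha (div_pos hr hC0)]
  intro n hn
  rw [div_pow, ← mul_div_assoc, div_le_one (by positivity)]
  exact (h n hn).trans (le_self_pow₀ hC (by omega))

/-- Lemma on the optimal ratio `r / (2 M₁(r))`.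
Let `(bₙ)` be complex numbers with `|b₀| = 1`, let `R₁ ∈ (0,∞]` be the radius of convergence of
`∑ bₙ xⁿ` and `R₂ ∈ (0,∞]`. For `r ∈ (0, min{R₁,R₂})` set `M₁(r) = sup {1, |b₁|r, |b₂|r², …}`,
and put `r₀ = min{1 / sup_{n≥1} |bₙ|^{1/n}, R₂}` (in `ℝ≥0∞`, so that `1/0 = ∞` when all `bₙ`,
`n ≥ 1`, vanish). Then `0 < r₀ ≤ min{R₁,R₂}` and
`sup_{r ∈ (0, min{R₁,R₂})} r / (2 M₁(r)) = r₀ / 2`. -/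
theorem stmt5 (b : ℕ → ℂ) (hb0 : ‖b 0‖ = 1)
    (R₁ R₂ : ℝ≥0∞)
    -- R₁ is the radius of convergence of ∑ bₙ xⁿ
    (hR₁ : R₁ = ⨆ (r : ℝ≥0) (_ : ∃ C : ℝ, ∀ n : ℕ, ‖b n‖ * (r : ℝ) ^ n ≤ C), (r : ℝ≥0∞))
    (hR₁pos : 0 < R₁) (hR₂pos : 0 < R₂)
    (M₁ : ℝ → ℝ)
    (hM₁ : ∀ r : ℝ, M₁ r =
      sSup ({1} ∪ {x : ℝ | ∃ n : ℕ, 1 ≤ n ∧ x = ‖b n‖ * r ^ n}))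
    (r₀ : ℝ≥0∞)
    (hr₀ : r₀ = min (⨆ (n : ℕ) (_ : 1 ≤ n), ENNReal.ofReal (‖b n‖ ^ ((n : ℝ)⁻¹)))⁻¹ R₂) :
    0 < r₀ ∧ r₀ ≤ min R₁ R₂ ∧
      (⨆ (r : ℝ) (_ : 0 < r ∧ ENNReal.ofReal r < min R₁ R₂),
        ENNReal.ofReal (r / (2 * M₁ r))) = r₀ / 2 := by
  have ha : ∀ n, 0 ≤ ‖b n‖ := fun n => norm_nonneg _
  have hr₀R : r₀ ≤ min R₁ R₂ := by
    rw [hr₀]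
    refine min_le_min_right _ (ENNReal.le_of_forall_nnreal_lt fun r hr => ?_)
    rcases eq_or_ne r 0 with rfl | hr0
    · simp
    have hrpos : (0 : ℝ) < r := by exact_mod_cast pos_iff_ne_zero.2 hr0
    rw [← ENNReal.ofReal_coe_nnreal] at hr
    have h := (ofReal_le_inv_iSup_rpow_inv_iff ha hrpos).1 hr.le
    rw [hR₁]
    refine le_iSup₂_of_le r ⟨1, fun n => ?_⟩ le_rfl
    rcases Nat.eq_zero_or_pos n with rfl | hn
    · simp [hb0]
    · exact h n hn
  refine ⟨?_, hr₀R, le_antisymm ?_ ?_⟩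
  · rw [hR₁] at hR₁pos
    obtain ⟨r, hr⟩ := lt_iSup_iff.1 hR₁pos
    obtain ⟨⟨C, hC⟩, hr⟩ := lt_iSup_iff.1 hr
    have hrpos : (0 : ℝ) < r := by exact_mod_cast hr
    have hC1 : 1 ≤ C := by simpa [hb0] using hC 0
    rw [hr₀]
    refine lt_min (lt_of_lt_of_le ?_
      (ofReal_div_le_inv_iSup_rpow_inv ha hrpos hC1 fun n _ => hC n)) hR₂pos
    exact ENNReal.ofReal_pos.2 (by positivity)
  · refine iSup₂_le fun r ⟨hrpos, hr⟩ => ?_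
    have hbdd : BddAbove ({1} ∪ {x : ℝ | ∃ n : ℕ, 1 ≤ n ∧ x = ‖b n‖ * r ^ n}) := by
      have hr1 := hr.trans_le (min_le_left _ _)
      rw [hR₁] at hr1
      obtain ⟨s, hs⟩ := lt_iSup_iff.1 hr1
      obtain ⟨⟨C, hC⟩, hs⟩ := lt_iSup_iff.1 hs
      rw [← ENNReal.ofReal_coe_nnreal] at hs
      have hrs : r ≤ s := (ENNReal.ofReal_lt_ofReal_iff'.1 hs).1.le
      refine ⟨C, ?_⟩
      rintro x (rfl | ⟨n, -, rfl⟩)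
      · simpa [hb0] using hC 0
      · exact le_trans (by gcongr) (hC n)
    have hM1 : 1 ≤ M₁ r := by
      rw [hM₁]
      exact le_csSup hbdd (Or.inl rfl)
    have hMn : ∀ n : ℕ, 1 ≤ n → ‖b n‖ * r ^ n ≤ M₁ r := fun n hn => by
      rw [hM₁]
      exact le_csSup hbdd (Or.inr ⟨n, hn, rfl⟩)
    rw [mul_comm, ← div_div, ENNReal.ofReal_div_of_pos two_pos, ENNReal.ofReal_ofNat]
    refine ENNReal.div_le_div_right ?_ _
    rw [hr₀]
    refine le_min (ofReal_div_le_inv_iSup_rpow_inv ha hrpos hM1 hMn) ?_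
    exact (ENNReal.ofReal_le_ofReal (div_le_self hrpos.le hM1)).trans
      (hr.le.trans (min_le_right _ _))
  · refine ENNReal.div_le_of_le_mul (ENNReal.le_of_forall_nnreal_lt fun r hr => ?_)
    rcases eq_or_ne r 0 with rfl | hr0
    · simp
    have hrpos : (0 : ℝ) < r := by exact_mod_cast pos_iff_ne_zero.2 hr0
    rw [← ENNReal.ofReal_coe_nnreal] at hr ⊢
    have hle := hr.le
    rw [hr₀] at hle
    have h := (ofReal_le_inv_iSup_rpow_inv_iff ha hrpos).1 (hle.trans (min_le_left _ _))
    have hM : M₁ r = 1 := by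
      rw [hM₁]
      refine IsGreatest.csSup_eq ⟨Or.inl rfl, ?_⟩
      rintro x (rfl | ⟨n, hn, rfl⟩)
      · exact le_rfl
      · exact h n hn
    rw [← ENNReal.div_le_iff two_ne_zero ofNat_ne_top]
    refine le_iSup₂_of_le (r : ℝ) ⟨hrpos, hr.trans_le hr₀R⟩ ?_
    rw [hM, mul_one, ENNReal.ofReal_div_of_pos two_pos, ENNReal.ofReal_ofNat]
end

section
/- Let Ψ:[-1,1]→ℝ have a real analytic extension to an open neighbourhood of [-1,1] and let g : [-1,1] → ℝ be continuous. Then for any −1 ≤ α < β ≤ 1 the function x ↦ ∫_α^β g(t) · [Ψ(x) − Ψ(t) − Ψ'(t)(x−t)] / [(x−t)² + (Ψ(x)−Ψ(t))²] dt is real analytic on (-1,1). -/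
open MeasureTheory Filter Topology Set

/-- A parametric integral of holomorphic functions with an integrable bound is holomorphic. -/
theorem differentiableOn_integral_of_norm_le {X : Type*} [MeasurableSpace X] {μ : Measure X}
    {U : Set ℂ} (hU : IsOpen U) {G : ℂ → X → ℂ} {b : X → ℝ} (hb : Integrable b μ)
    (hmeas : ∀ z ∈ U, AEStronglyMeasurable (G z) μ)
    (hdiff : ∀ᵐ t ∂μ, DifferentiableOn ℂ (fun z => G z t) U)
    (hbound : ∀ᵐ t ∂μ, ∀ z ∈ U, ‖G z t‖ ≤ b t) :
    DifferentiableOn ℂ (fun z => ∫ t, G z t ∂μ) U := by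
  intro z₀ hz₀
  obtain ⟨ε, hε, hεU⟩ := Metric.isOpen_iff.1 hU z₀ hz₀
  have hsub : ∀ z ∈ Metric.ball z₀ (ε / 2), Metric.closedBall z (ε / 3) ⊆ U := fun z hz w hw =>
    hεU (by
      have := dist_triangle w z z₀
      rw [Metric.mem_ball] at *
      rw [Metric.mem_closedBall] at hw
      linarith)
  refine (hasDerivAt_integral_of_dominated_loc_of_deriv_le (F' := fun z t => deriv (G · t) z)
    (bound := fun t => b t / (ε / 3))
    (Metric.ball_mem_nhds z₀ (half_pos hε)) ?_ ?_ ?_ ?_ (hb.div_const _)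
    ?_).2.differentiableAt.differentiableWithinAt
  · filter_upwards [hU.mem_nhds hz₀] with z hz using hmeas z hz
  · exact hb.mono' (hmeas z₀ hz₀) (hbound.mono fun t ht => ht z₀ hz₀)
  · obtain ⟨h, hlim, hne⟩ : ∃ h : ℕ → ℂ, Tendsto h atTop (𝓝[≠] z₀) ∧ ∀ n, h n ∈ U := by
      obtain ⟨h, hh⟩ := exists_seq_tendsto (𝓝[≠] z₀)
      have := hh.eventually (mem_nhdsWithin_of_mem_nhds (hU.mem_nhds hz₀))
      obtain ⟨N, hN⟩ := eventually_atTop.1 this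
      exact ⟨fun n => h (n + N), hh.comp (tendsto_add_atTop_nat N), fun n => hN _ (by omega)⟩
    refine aestronglyMeasurable_of_tendsto_ae atTop
      (f := fun n t => slope (G · t) z₀ (h n)) (fun n => ?_) ?_
    · simp only [slope_def_module]
      exact AEStronglyMeasurable.const_smul ((hmeas _ (hne n)).sub (hmeas _ hz₀)) (h n - z₀)⁻¹
    · filter_upwards [hdiff] with t ht
      exact (hasDerivAt_iff_tendsto_slope.1
        (ht.differentiableAt (hU.mem_nhds hz₀)).hasDerivAt).comp hlim
  · filter_upwards [hdiff, hbound] with t ht ht' z hz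
    refine Complex.norm_deriv_le_of_forall_mem_sphere_norm_le (by positivity) ?_
      fun w hw => ht' w (hsub z hz (Metric.sphere_subset_closedBall hw))
    refine DifferentiableOn.diffContOnCl ?_
    rw [closure_ball _ (by positivity)]
    exact ht.mono (hsub z hz)
  · filter_upwards [hdiff] with t ht z hz
    exact (ht.differentiableAt
      (hU.mem_nhds (hsub z hz (Metric.mem_closedBall_self (by positivity))))).hasDerivAt

/-- A real function that is analytic at a point extends holomorphically near this point. -/
theorem AnalyticAt.exists_complex_extension {f : ℝ → ℝ} {x : ℝ} (hf : AnalyticAt ℝ f x) :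
    ∃ F : ℂ → ℂ, AnalyticAt ℂ F x ∧ ∀ᶠ y : ℝ in 𝓝 x, F y = f y := by
  obtain ⟨p, r, hp⟩ := hf
  set q := FormalMultilinearSeries.ofScalars ℂ (fun n => (p.coeff n : ℂ))
  have hq : r ≤ q.radius := by
    refine hp.r_le.trans_eq ?_
    simp only [FormalMultilinearSeries.radius, q, FormalMultilinearSeries.coeff_ofScalars,
      Complex.norm_real, FormalMultilinearSeries.norm_apply_eq_norm_coef]
  have hF := (q.hasFPowerSeriesOnBall (hp.r_pos.trans_le hq)).comp_sub (x : ℂ)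
  rw [zero_add] at hF
  refine ⟨_, hF.analyticAt, ?_⟩
  filter_upwards [Metric.eball_mem_nhds x hp.r_pos] with y hy
  have h1 := hp.hasSum_sub hy
  have h2 : HasSum (fun n => (p.coeff n : ℂ) * ((y : ℂ) - x) ^ n) (f y) := by
    convert Complex.hasSum_ofReal.2 h1 using 2 with n
    rw [FormalMultilinearSeries.apply_eq_pow_smul_coeff]
    push_cast [smul_eq_mul]
    ring
  rw [← h2.tsum_eq]
  simp [FormalMultilinearSeries.sum, q, mul_comm]

theorem AnalyticAt.exists_complex_extension_on_ball {f : ℝ → ℝ} {x : ℝ} (hf : AnalyticAt ℝ f x) :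
    ∃ F : ℂ → ℂ, ∃ a R : ℝ, 0 < R ∧ DifferentiableOn ℂ F (Metric.ball (x : ℂ) R) ∧
      (∀ y : ℝ, (y : ℂ) ∈ Metric.ball (x : ℂ) R → F y = f y ∧ deriv F y = deriv f y) ∧
      ∀ z ∈ Metric.ball (x : ℂ) R, ∀ w ∈ Metric.ball (x : ℂ) R,
        ‖F z - F w - a * (z - w)‖ ≤ 1 / 2 * ‖z - w‖ := by
  obtain ⟨F, hF, hFf⟩ := hf.exists_complex_extension
  have hstrict := hF.hasStrictDerivAt.hasStrictFDerivAt.isLittleO.def (c := 1 / 2) (by norm_num)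
  have hderiv : ∀ᶠ y : ℝ in 𝓝 x, deriv F y = deriv f y := by
    filter_upwards [hFf.eventually_nhds, hf.eventually_analyticAt,
      Complex.continuous_ofReal.continuousAt.eventually hF.eventually_analyticAt] with y h1 h2 h3
    exact ((h3.differentiableAt.hasDerivAt.comp_ofReal).congr_of_eventuallyEq
      (h1.mono fun _ h => h.symm)).unique h2.differentiableAt.hasDerivAt.ofReal_comp
  obtain ⟨R₁, hR₁, h₁⟩ := Metric.eventually_nhds_iff.1 (hFf.and hderiv)
  obtain ⟨R₂, hR₂, h₂⟩ := Metric.eventually_nhds_iff.1 hstrict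
  obtain ⟨R₃, hR₃, h₃⟩ := Metric.eventually_nhds_iff.1 hF.eventually_analyticAt
  refine ⟨F, deriv f x, min R₁ (min R₂ R₃), by positivity, ?_, ?_, ?_⟩
  · exact fun z hz => (h₃ (lt_of_lt_of_le hz (by simp))).differentiableAt.differentiableWithinAt
  · intro y hy
    rw [Metric.mem_ball, Complex.dist_of_im_eq (by simp)] at hy
    exact h₁ (lt_of_lt_of_le hy (by simp))
  · intro z hz w hw
    have := @h₂ (z, w) (by
      rw [Prod.dist_eq]
      exact max_lt (lt_of_lt_of_le hz (by simp)) (lt_of_lt_of_le hw (by simp)))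
    rw [← hderiv.self_of_nhds]
    simpa [mul_comm] using this

theorem three_fourths_le_norm_one_add_sq {D : ℂ} {a : ℝ} (h : ‖D - a‖ ≤ 1 / 2) :
    3 / 4 ≤ ‖1 + D ^ 2‖ := by
  have him : |D.im| ≤ 1 / 2 := by simpa using (Complex.abs_im_le_norm (D - a)).trans h
  have := Complex.re_le_norm (1 + D ^ 2)
  simp only [pow_two, Complex.add_re, Complex.one_re, Complex.mul_re] at this
  rw [pow_two]
  nlinarith [abs_le.1 him, sq_nonneg D.re]

/-- The kernel has a removable singularity, with a uniform bound, where the function is close to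
an affine function with real slope. -/
theorem exists_kernel_extension_near {F : ℂ → ℂ} {t : ℂ} {a ρ : ℝ}
    (hd : DifferentiableOn ℂ F (Metric.ball t ρ)) (hρ : 0 < ρ)
    (hL : ∀ z ∈ Metric.ball t ρ, ‖F z - F t - a * (z - t)‖ ≤ 1 / 2 * ‖z - t‖) :
    ∃ G : ℂ → ℂ, DifferentiableOn ℂ G (Metric.ball t ρ) ∧
      (∀ z ∈ Metric.ball t ρ, ‖G z‖ ≤ 4 / (3 * ρ)) ∧
      ∀ z ∈ Metric.ball t ρ, z ≠ t →
        G z = (F z - F t - deriv F t * (z - t)) / ((z - t) ^ 2 + (F z - F t) ^ 2) := by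
  have hnhds : Metric.ball t ρ ∈ 𝓝 t := Metric.ball_mem_nhds t hρ
  have hD := (Complex.differentiableOn_dslope hnhds).2 hd
  have hQ := (Complex.differentiableOn_dslope hnhds).2 hD
  have hDa : ∀ z ∈ Metric.ball t ρ, ‖dslope F t z - a‖ ≤ 1 / 2 := by
    have hne : ∀ z ∈ Metric.ball t ρ, z ≠ t → ‖dslope F t z - a‖ ≤ 1 / 2 := by
      intro z hz hzt
      have hzt' : z - t ≠ 0 := sub_ne_zero.2 hzt
      have : dslope F t z - a = (F z - F t - a * (z - t)) / (z - t) := by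
        rw [dslope_of_ne _ hzt, slope_def_field]
        field_simp
      rw [this, norm_div, div_le_iff₀ (norm_pos_iff.2 hzt')]
      exact hL z hz
    intro z hz
    rcases eq_or_ne z t with rfl | hzt
    · have hc : ContinuousAt (fun w => ‖dslope F z w - a‖) z :=
        ((hD.continuousOn.continuousAt hnhds).sub continuousAt_const).norm
      refine le_of_tendsto (hc.tendsto.mono_left (nhdsWithin_le_nhds (s := {z}ᶜ))) ?_
      filter_upwards [self_mem_nhdsWithin, mem_nhdsWithin_of_mem_nhds hnhds] with w hw hw'
      exact hne w hw' hw
    · exact hne z hz hzt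
  have hden := fun z hz => three_fourths_le_norm_one_add_sq (hDa z hz)
  have hden0 : ∀ z ∈ Metric.ball t ρ, 1 + dslope F t z ^ 2 ≠ 0 := fun z hz h => by
    have := hden z hz
    rw [h, norm_zero] at this
    norm_num at this
  refine ⟨fun z => dslope (dslope F t) t z / (1 + dslope F t z ^ 2),
    hQ.div ((hD.pow 2).const_add 1) hden0, fun z hz => ?_, fun z hz hzt => ?_⟩
  · have hQb : ‖dslope (dslope F t) t z‖ ≤ 1 / ρ := by
      refine Complex.norm_dslope_le_div_of_mapsTo_ball hD (fun w hw => ?_) hz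
      rw [Metric.mem_closedBall, dist_eq_norm]
      have h1 := hDa w hw
      have h2 := hDa t (Metric.mem_ball_self hρ)
      calc ‖dslope F t w - dslope F t t‖
          = ‖(dslope F t w - a) - (dslope F t t - a)‖ := by ring_nf
        _ ≤ 1 / 2 + 1 / 2 := (norm_sub_le _ _).trans (add_le_add h1 h2)
        _ = 1 := by norm_num
    rw [norm_div]
    calc _ ≤ (1 / ρ) / (3 / 4) := by
          gcongr
          exact hden z hz
      _ = 4 / (3 * ρ) := by field_simp
  · have hzt' : z - t ≠ 0 := sub_ne_zero.2 hzt
    have h0 := hden0 z hz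
    have hF : F z - F t = dslope F t z * (z - t) := by
      rw [dslope_of_ne _ hzt, slope_def_field]
      field_simp
    beta_reduce
    rw [dslope_of_ne (dslope F t) hzt, slope_def_field, dslope_same, hF]
    have h1 : (z - t) ^ 2 + (dslope F t z * (z - t)) ^ 2 ≠ 0 := by
      rw [show (z - t) ^ 2 + (dslope F t z * (z - t)) ^ 2
        = (z - t) ^ 2 * (1 + dslope F t z ^ 2) by ring]
      exact mul_ne_zero (pow_ne_zero 2 hzt') h0
    rw [div_div, div_eq_div_iff (mul_ne_zero hzt' h0) h1]
    ring

theorem le_norm_sq_add_sq {u v : ℂ} {δ : ℝ} (hδ : 0 ≤ δ) (hu : 3 * δ ≤ |u.re|) (hu' : |u.im| ≤ δ)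
    (hv : |v.im| ≤ δ) : 7 * δ ^ 2 ≤ ‖u ^ 2 + v ^ 2‖ := by
  refine le_trans ?_ (Complex.re_le_norm _)
  simp only [pow_two, Complex.add_re, Complex.mul_re]
  nlinarith [abs_le.1 hu', abs_le.1 hv, sq_nonneg v.re, abs_mul_abs_self u.re]

/-- Complexification of the kernel in the first variable, uniformly in the second one. -/
theorem exists_kernel_extension {f : ℝ → ℝ} {K : Set ℝ} (hK : IsCompact K)
    (hf : AnalyticOnNhd ℝ f K) {x : ℝ} (hx : x ∈ K) :
    ∃ F : ℂ → ℂ, ∃ r M : ℝ, 0 < r ∧ (∀ y : ℝ, (y : ℂ) ∈ Metric.ball (x : ℂ) r → F y = f y) ∧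
      ∀ t ∈ K, ∃ G : ℂ → ℂ, DifferentiableOn ℂ G (Metric.ball (x : ℂ) r) ∧
        (∀ z ∈ Metric.ball (x : ℂ) r, ‖G z‖ ≤ M) ∧
        ∀ z ∈ Metric.ball (x : ℂ) r, z ≠ t →
          G z = (F z - f t - deriv f t * (z - t)) / ((z - t) ^ 2 + (F z - f t) ^ 2) := by
  obtain ⟨F, a, R, hR, hd, hreal, hL⟩ := (hf x hx).exists_complex_extension_on_ball
  obtain ⟨B₀, hB₀⟩ := hK.exists_bound_of_continuousOn continuousOn_id
  obtain ⟨B₁, hB₁⟩ := hK.exists_bound_of_continuousOn hf.continuousOn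
  obtain ⟨B₂, hB₂⟩ := hK.exists_bound_of_continuousOn hf.deriv.continuousOn
  have hB₂0 : 0 ≤ B₂ := (norm_nonneg _).trans (hB₂ x hx)
  set δ := R / 16 with hδ
  have hδ0 : 0 < δ := by positivity
  set r := δ / (|a| + 1) with hr
  have hr0 : 0 < r := by positivity
  have hrδ : r ≤ δ := div_le_self hδ0.le (by linarith [abs_nonneg a])
  have hxR : (x : ℂ) ∈ Metric.ball (x : ℂ) R := Metric.mem_ball_self hR
  have hFx : ∀ z ∈ Metric.ball (x : ℂ) r, ‖F z - f x‖ ≤ δ := by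
    intro z hz
    have hzr : ‖z - x‖ ≤ r := by rw [← dist_eq_norm]; exact (Metric.mem_ball.1 hz).le
    have h := hL z (Metric.ball_subset_ball (by linarith) hz) x hxR
    rw [(hreal x hxR).1] at h
    have h' := norm_le_norm_add_norm_sub' (F z - f x) (a * (z - x))
    rw [norm_mul, Complex.norm_real, Real.norm_eq_abs] at h'
    have h'' : r * (|a| + 1) = δ := by rw [hr]; field_simp
    nlinarith [abs_nonneg a, norm_nonneg (z - x)]
  have hfar : ∀ z ∈ Metric.ball (x : ℂ) r, ∀ t ∈ K, 4 * δ ≤ |x - t| →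
      7 * δ ^ 2 ≤ ‖(z - t) ^ 2 + (F z - f t) ^ 2‖ := by
    intro z hz t _ hxt
    have hzr : ‖z - x‖ ≤ r := by rw [← dist_eq_norm]; exact (Metric.mem_ball.1 hz).le
    refine le_norm_sq_add_sq hδ0.le ?_ ?_ ?_
    · have h1 : |z.re - x| ≤ r := by simpa using (Complex.abs_re_le_norm (z - x)).trans hzr
      have h2 := abs_sub_le x z.re t
      rw [abs_sub_comm x z.re] at h2
      simp only [Complex.sub_re, Complex.ofReal_re]
      linarith
    · simpa using ((Complex.abs_im_le_norm (z - x)).trans hzr).trans hrδ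
    · simpa using (Complex.abs_im_le_norm (F z - f x)).trans (hFx z hz)
  refine ⟨F, r, max (4 / (3 * (8 * δ))) ((δ + B₁ + B₁ + B₂ * (δ + B₀ + B₀)) / (7 * δ ^ 2)), hr0,
    fun y hy => (hreal y (Metric.ball_subset_ball (by linarith) hy)).1, fun t ht => ?_⟩
  rcases lt_or_ge |x - t| (4 * δ) with hxt | hxt
  · have hxt' : dist (x : ℂ) t < 4 * δ := by
      rwa [Complex.dist_of_im_eq (by simp)]
    have htR : Metric.ball (t : ℂ) (8 * δ) ⊆ Metric.ball (x : ℂ) R :=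
      Metric.ball_subset_ball' (by rw [dist_comm]; linarith)
    have hrt : Metric.ball (x : ℂ) r ⊆ Metric.ball (t : ℂ) (8 * δ) :=
      Metric.ball_subset_ball' (by linarith)
    have htt := htR (Metric.mem_ball_self (by positivity))
    obtain ⟨G, hG, hGb, hGe⟩ := exists_kernel_extension_near (hd.mono htR)
      (by positivity : 0 < 8 * δ) (fun z hz => hL z (htR hz) t htt)
    rw [(hreal t htt).1, (hreal t htt).2] at hGe
    exact ⟨G, hG.mono hrt, fun z hz => (hGb z (hrt hz)).trans (le_max_left _ _),
      fun z hz => hGe z (hrt hz)⟩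
  · have hFd : DifferentiableOn ℂ F (Metric.ball (x : ℂ) r) :=
      hd.mono (Metric.ball_subset_ball (by linarith))
    refine ⟨fun z => (F z - f t - deriv f t * (z - t)) / ((z - t) ^ 2 + (F z - f t) ^ 2), ?_,
      fun z hz => ?_, fun _ _ _ => rfl⟩
    · refine DifferentiableOn.div (by fun_prop) (by fun_prop) fun z hz h => ?_
      have := hfar z hz t ht hxt
      rw [h, norm_zero] at this
      nlinarith [pow_pos hδ0 2]
    · refine le_trans ?_ (le_max_right _ _)
      rw [norm_div]
      have hzr : ‖z - x‖ ≤ r := by rw [← dist_eq_norm]; exact (Metric.mem_ball.1 hz).le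
      have hnum : ‖F z - f t - deriv f t * (z - t)‖ ≤ δ + B₁ + B₁ + B₂ * (δ + B₀ + B₀) := by
        have e : F z - f t - deriv f t * (z - t)
            = (F z - f x) + f x - f t - deriv f t * ((z - x) + x - t) := by ring
        rw [e]
        refine (norm_sub_le _ _).trans (add_le_add ?_ ?_)
        · refine (norm_sub_le _ _).trans (add_le_add ((norm_add_le _ _).trans
            (add_le_add (hFx z hz) ?_)) ?_)
          · simpa using hB₁ x hx
          · simpa using hB₁ t ht
        · rw [norm_mul]
          refine mul_le_mul (by simpa using hB₂ t ht) ?_ (norm_nonneg _) hB₂0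
          refine (norm_sub_le _ _).trans (add_le_add ((norm_add_le _ _).trans
            (add_le_add (hzr.trans hrδ) ?_)) ?_)
          · simpa using hB₀ x hx
          · simpa using hB₀ t ht
      exact div_le_div₀ ((norm_nonneg _).trans hnum) hnum (by positivity) (hfar z hz t ht hxt)

/-- analyticity of the double-layer-type integral.
If `Ψ` has a real analytic extension to a neighbourhood of `[-1,1]`, `g : [-1,1] → ℝ` is
continuous and `−1 ≤ α < β ≤ 1`, then
`x ↦ ∫_α^β g(t) (Ψ(x) − Ψ(t) − Ψ'(t)(x−t)) / ((x−t)² + (Ψ(x)−Ψ(t))²) dt`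
is real analytic on `(-1,1)`. (The integrand extends continuously across `t = x`; since a single
point is negligible for the integral, the raw formula is used.) -/
theorem stmt7 (Ψ g : ℝ → ℝ)
    (hΨ : ∃ V : Set ℝ, IsOpen V ∧ Set.Icc (-1 : ℝ) 1 ⊆ V ∧ AnalyticOnNhd ℝ Ψ V)
    (hg : ContinuousOn g (Set.Icc (-1 : ℝ) 1))
    (α β : ℝ) (hα : -1 ≤ α) (hαβ : α < β) (hβ : β ≤ 1) :
    AnalyticOnNhd ℝ
      (fun x => ∫ t in α..β, g t *
        ((Ψ x - Ψ t - deriv Ψ t * (x - t)) / ((x - t) ^ 2 + (Ψ x - Ψ t) ^ 2)))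
      (Set.Ioo (-1 : ℝ) 1) := by
  obtain ⟨V, -, hV, hΨV⟩ := hΨ
  have hΨI : AnalyticOnNhd ℝ Ψ (Icc (-1) 1) := hΨV.mono hV
  intro x hx
  obtain ⟨F, r, M, hr, hF, hG⟩ :=
    exists_kernel_extension isCompact_Icc hΨI (Ioo_subset_Icc_self hx)
  choose! G hGd hGb hGe using hG
  set μ := volume.restrict (Ioc α β) with hμ
  have hsub : Ioc α β ⊆ Icc (-1 : ℝ) 1 := fun t ht => ⟨by linarith [ht.1], ht.2.trans hβ⟩
  have hμI : ∀ᵐ t ∂μ, t ∈ Icc (-1 : ℝ) 1 :=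
    (ae_restrict_mem measurableSet_Ioc).mono fun t ht => hsub ht
  have hae : ∀ z : ℂ, ∀ᵐ t : ℝ ∂μ, z ≠ t := fun z => by
    refine (Measure.ae_ne μ z.re).mono fun t ht h => ht ?_
    rw [h, Complex.ofReal_re]
  have hmeas {h : ℝ → ℝ} (hc : ContinuousOn h (Icc (-1) 1)) :
      AEMeasurable (fun t => (h t : ℂ)) μ :=
    Complex.measurable_ofReal.comp_aemeasurable ((hc.mono hsub).aemeasurable measurableSet_Ioc)
  have hgm := hmeas hg
  have hΨm := hmeas hΨI.continuousOn
  have hΨm' := hmeas hΨI.deriv.continuousOn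
  have hid := hmeas continuousOn_id
  have hgint : Integrable g μ :=
    (hg.integrableOn_compact isCompact_Icc).mono_set hsub
  have hdiff : DifferentiableOn ℂ (fun z => ∫ t, (g t : ℂ) * G t z ∂μ)
      (Metric.ball (x : ℂ) r) := by
    refine differentiableOn_integral_of_norm_le Metric.isOpen_ball (hgint.norm.mul_const M)
      (fun z hz => ?_) ?_ ?_
    · have hraw : AEMeasurable (fun t : ℝ => (g t : ℂ) *
          ((F z - Ψ t - deriv Ψ t * (z - t)) / ((z - t) ^ 2 + (F z - Ψ t) ^ 2))) μ := by
        simp only [id] at hid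
        fun_prop
      refine hraw.aestronglyMeasurable.congr ?_
      filter_upwards [hμI, hae z] with t ht hzt
      rw [hGe t ht z hz hzt]
    · filter_upwards [hμI] with t ht using (hGd t ht).const_mul _
    · filter_upwards [hμI] with t ht z hz
      rw [norm_mul, Complex.norm_real]
      exact mul_le_mul_of_nonneg_left (hGb t ht z hz) (norm_nonneg _)
  have hball : Metric.ball (x : ℂ) r ∈ 𝓝 (x : ℂ) := Metric.ball_mem_nhds _ hr
  refine (hdiff.analyticAt hball).re_ofReal.congr ?_
  filter_upwards [Complex.continuous_ofReal.continuousAt.eventually hball] with y hy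
  have hint : ∫ t, (g t : ℂ) * G t y ∂μ = ((∫ t in α..β, g t *
        ((Ψ y - Ψ t - deriv Ψ t * (y - t)) / ((y - t) ^ 2 + (Ψ y - Ψ t) ^ 2)) : ℝ) : ℂ) := by
    rw [intervalIntegral.integral_of_le hαβ.le, ← integral_complex_ofReal]
    refine integral_congr_ae ?_
    filter_upwards [hμI, hae y] with t ht hyt
    rw [hGe t ht y hy hyt, hF y hy]
    push_cast
    rfl
  rw [hint, Complex.ofReal_re]
end

section
/- Let Ψ:[-1,1]→ℝ have a real analytic extension to an open neighbourhood of [-1,1], let Ω = {(x,y)∈(-1,1)×ℝ : y<Ψ(x)}, U₁ = (-1,1)×ℝ, h ∈ C¹([-1,1]), and let G(x,y) := (1/π)∫_{-1}^{1} h(t)√(1+Ψ'(t)²) · log√((x−t)² + (y−Ψ(t))²) dt on U₁∖cl(Ω). Let n(x) := (−Ψ'(x),1)/√(1+Ψ'(x)²) be the upward unit normal to the graph Γ = {(x,Ψ(x))}. Then for every x₀ ∈ (-1,1), ∇G(x,y)·n(x) converges, as (x,y) → (x₀,Ψ(x₀)) with (x,y) ∈ U₁∖cl(Ω) and x the first coordinate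 of the approaching point, to h(x₀) + F(x₀), where F(x₀) := (1/(π√(1+Ψ'(x₀)²))) ∫_{-1}^{1} h(t)√(1+Ψ'(t)²) · [Ψ(x₀) − Ψ(t) − Ψ'(x₀)(x₀−t)] / [(x₀−t)² + (Ψ(x₀)−Ψ(t))²] dt. -/
open MeasureTheory Filter Topology Set

/-- The squared distance from a point off a graph to a point of the graph is positive. -/
lemma graph_dist_sq_pos {Ψ : ℝ → ℝ} {x y : ℝ} (hy : Ψ x ≠ y) (t : ℝ) :
    0 < (x - t) ^ 2 + (y - Ψ t) ^ 2 := by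
  by_cases hxt : x = t
  · subst hxt
    have : y - Ψ x ≠ 0 := sub_ne_zero.2 (Ne.symm hy)
    positivity
  · have : x - t ≠ 0 := sub_ne_zero.2 hxt
    positivity

/-- Differentiation under the integral sign for a jointly continuous derivative. -/
lemma hasDerivAt_intervalIntegral_of_continuousOn {a b : ℝ} (hab : a ≤ b) {f f' : ℝ → ℝ → ℝ}
    {K : Set ℝ} {x₀ : ℝ} (hK : IsCompact K) (hx₀ : K ∈ 𝓝 x₀)
    (hf : ∀ x ∈ K, ContinuousOn (f x) (Icc a b))
    (hf' : ContinuousOn (fun q : ℝ × ℝ => f' q.1 q.2) (K ×ˢ Icc a b))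
    (hd : ∀ x ∈ K, ∀ t ∈ Icc a b, HasDerivAt (fun x => f x t) (f' x t) x) :
    HasDerivAt (fun x => ∫ t in a..b, f x t) (∫ t in a..b, f' x₀ t) x₀ := by
  obtain ⟨C, hC⟩ := (hK.prod isCompact_Icc).exists_bound_of_continuousOn hf'
  have hsub : uIoc a b ⊆ Icc a b := by
    rw [uIoc_of_le hab]
    exact Ioc_subset_Icc_self
  have hm₀ : x₀ ∈ K := mem_of_mem_nhds hx₀
  have hf'₀ : ContinuousOn (f' x₀) (Icc a b) :=
    hf'.comp (f := fun t : ℝ => (x₀, t)) (by fun_prop) fun t ht => ⟨hm₀, ht⟩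
  refine (intervalIntegral.hasDerivAt_integral_of_dominated_loc_of_deriv_le
    (bound := fun _ => C) hx₀ ?_ ?_ ?_ ?_ intervalIntegrable_const ?_).2
  · filter_upwards [hx₀] with x hx
    exact ((hf x hx).mono hsub).aestronglyMeasurable measurableSet_uIoc
  · exact (hf x₀ hm₀).intervalIntegrable_of_Icc hab
  · exact (hf'₀.mono hsub).aestronglyMeasurable measurableSet_uIoc
  · exact .of_forall fun t ht x hx => hC (x, t) ⟨hx, hsub ht⟩
  · exact .of_forall fun t ht x hx => hd x hx t (hsub ht)

/-- The horizontal derivative of a logarithmic single-layer potential off the graph. -/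
lemma hasDerivAt_logPotential_fst {a b : ℝ} {Ψ w : ℝ → ℝ}
    (hΨ : ContinuousOn Ψ (Icc a b)) (hw : ContinuousOn w (Icc a b)) {x y : ℝ}
    (hx : x ∈ Ioo a b) (hy : Ψ x < y) :
    HasDerivAt (fun x => ∫ t in a..b, w t * Real.log (√((x - t) ^ 2 + (y - Ψ t) ^ 2)))
      (∫ t in a..b, w t * ((x - t) / ((x - t) ^ 2 + (y - Ψ t) ^ 2))) x := by
  have hab : a ≤ b := (hx.1.trans hx.2).le
  have hnhds : {x | Ψ x < y} ∈ 𝓝 x :=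
    (hΨ.continuousAt (Icc_mem_nhds hx.1 hx.2)).eventually_lt_const hy
  obtain ⟨K, hKx, hKs, hK⟩ := local_compact_nhds hnhds
  have hpos : ∀ x ∈ K, ∀ t, 0 < (x - t) ^ 2 + (y - Ψ t) ^ 2 :=
    fun x hx t => graph_dist_sq_pos (hKs hx).ne t
  have hsnd : ∀ {g : ℝ → ℝ}, ContinuousOn g (Icc a b) →
      ContinuousOn (fun q : ℝ × ℝ => g q.2) (K ×ˢ Icc a b) :=
    fun hg => hg.comp continuousOn_snd fun q hq => hq.2
  refine hasDerivAt_intervalIntegral_of_continuousOn hab hK hKx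
    (f' := fun x t => w t * ((x - t) / ((x - t) ^ 2 + (y - Ψ t) ^ 2))) ?_ ?_ ?_
  · intro x hx
    refine hw.mul (ContinuousOn.log (by fun_prop) fun t _ => ?_)
    exact (Real.sqrt_pos.2 (hpos x hx t)).ne'
  · have h1 := ((continuousOn_const (c := y)).sub (hsnd hΨ)).pow 2
    refine (hsnd hw).mul (ContinuousOn.div (by fun_prop)
      (ContinuousOn.add (by fun_prop) h1) fun q hq => ?_)
    exact (hpos q.1 hq.1 q.2).ne'
  · intro x hx t _
    have hp := hpos x hx t
    have h1 : HasDerivAt (fun x => (x - t) ^ 2 + (y - Ψ t) ^ 2) (2 * (x - t)) x := by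
      simpa using (((hasDerivAt_id x).sub_const t).pow 2).add_const ((y - Ψ t) ^ 2)
    refine ((((h1.sqrt hp.ne').log (Real.sqrt_pos.2 hp).ne')).const_mul (w t)).congr_deriv ?_
    rw [div_div, mul_assoc, Real.mul_self_sqrt hp.le, mul_div_mul_left _ _ two_ne_zero]

/-- The vertical derivative of a logarithmic single-layer potential off the graph. -/
lemma hasDerivAt_logPotential_snd {a b : ℝ} {Ψ w : ℝ → ℝ}
    (hΨ : ContinuousOn Ψ (Icc a b)) (hw : ContinuousOn w (Icc a b)) {x y : ℝ}
    (hx : x ∈ Ioo a b) (hy : Ψ x < y) :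
    HasDerivAt (fun y => ∫ t in a..b, w t * Real.log (√((x - t) ^ 2 + (y - Ψ t) ^ 2)))
      (∫ t in a..b, w t * ((y - Ψ t) / ((x - t) ^ 2 + (y - Ψ t) ^ 2))) y := by
  have hab : a ≤ b := (hx.1.trans hx.2).le
  obtain ⟨K, hKx, hKs, hK⟩ := local_compact_nhds (Ioi_mem_nhds hy)
  have hpos : ∀ y ∈ K, ∀ t, 0 < (x - t) ^ 2 + (y - Ψ t) ^ 2 :=
    fun y hy t => graph_dist_sq_pos (mem_Ioi.1 (hKs hy)).ne t
  have hsnd : ∀ {g : ℝ → ℝ}, ContinuousOn g (Icc a b) →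
      ContinuousOn (fun q : ℝ × ℝ => g q.2) (K ×ˢ Icc a b) :=
    fun hg => hg.comp continuousOn_snd fun q hq => hq.2
  refine hasDerivAt_intervalIntegral_of_continuousOn hab hK hKx
    (f' := fun y t => w t * ((y - Ψ t) / ((x - t) ^ 2 + (y - Ψ t) ^ 2))) ?_ ?_ ?_
  · intro y hy
    refine hw.mul (ContinuousOn.log (by fun_prop) fun t _ => ?_)
    exact (Real.sqrt_pos.2 (hpos y hy t)).ne'
  · have h1 := continuousOn_fst.sub (hsnd hΨ)
    refine (hsnd hw).mul (ContinuousOn.div h1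
      (ContinuousOn.add (by fun_prop) (h1.pow 2)) fun q hq => ?_)
    exact (hpos q.1 hq.1 q.2).ne'
  · intro y hy t _
    have hp := hpos y hy t
    have h1 : HasDerivAt (fun y => (x - t) ^ 2 + (y - Ψ t) ^ 2) (2 * (y - Ψ t)) y := by
      simpa using (((hasDerivAt_id y).sub_const (Ψ t)).pow 2).const_add ((x - t) ^ 2)
    refine ((((h1.sqrt hp.ne').log (Real.sqrt_pos.2 hp).ne')).const_mul (w t)).congr_deriv ?_
    rw [div_div, mul_assoc, Real.mul_self_sqrt hp.le, mul_div_mul_left _ _ two_ne_zero]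

/-- The kernel with numerator vanishing to second order passes to the limit on the graph. -/
lemma tendsto_integral_quadratic_kernel {a b : ℝ} {Ψ ψ w : ℝ → ℝ} {M : ℝ}
    (hΨ : ContinuousOn Ψ (Icc a b)) (hψ : ContinuousOn ψ (Icc a b))
    (hw : ContinuousOn w (Icc a b))
    (hM : ∀ x ∈ Icc a b, ∀ t ∈ Icc a b, |Ψ x - Ψ t - ψ x * (x - t)| ≤ M * (x - t) ^ 2)
    {x₀ : ℝ} (hx₀ : x₀ ∈ Ioo a b) :
    Tendsto (fun p : ℝ × ℝ => ∫ t in a..b, w t *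
        ((Ψ p.1 - Ψ t - ψ p.1 * (p.1 - t)) / ((p.1 - t) ^ 2 + (p.2 - Ψ t) ^ 2)))
      (𝓝[{p | p.1 ∈ Ioo a b ∧ Ψ p.1 < p.2}] (x₀, Ψ x₀))
      (𝓝 (∫ t in a..b, w t *
        ((Ψ x₀ - Ψ t - ψ x₀ * (x₀ - t)) / ((x₀ - t) ^ 2 + (Ψ x₀ - Ψ t) ^ 2)))) := by
  have hab : a ≤ b := (hx₀.1.trans hx₀.2).le
  have hsub : uIoc a b ⊆ Icc a b := by
    rw [uIoc_of_le hab]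
    exact Ioc_subset_Icc_self
  have hM0 : 0 ≤ M := by
    have h1 := (abs_nonneg _).trans
      (hM a (left_mem_Icc.2 hab) b (right_mem_Icc.2 hab))
    have h2 : 0 < (a - b) ^ 2 := by
      have : a - b ≠ 0 := sub_ne_zero.2 (hx₀.1.trans hx₀.2).ne
      positivity
    exact nonneg_of_mul_nonneg_left h1 h2
  refine intervalIntegral.tendsto_integral_filter_of_dominated_convergence
    (fun t => |w t| * M) ?_ ?_ ?_ ?_
  · filter_upwards [self_mem_nhdsWithin] with p hp
    refine ContinuousOn.aestronglyMeasurable ?_ measurableSet_uIoc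
    refine (hw.mul (ContinuousOn.div (by fun_prop) (by fun_prop) fun t _ => ?_)).mono hsub
    exact (graph_dist_sq_pos hp.2.ne t).ne'
  · filter_upwards [self_mem_nhdsWithin] with p hp
    refine .of_forall fun t ht => ?_
    rw [Real.norm_eq_abs, abs_mul, abs_div]
    have hD := graph_dist_sq_pos hp.2.ne t
    refine mul_le_mul_of_nonneg_left ?_ (abs_nonneg _)
    rw [abs_of_pos hD, div_le_iff₀ hD]
    refine (hM p.1 (Ioo_subset_Icc_self hp.1) t (hsub ht)).trans ?_
    exact mul_le_mul_of_nonneg_left (by nlinarith [sq_nonneg (p.2 - Ψ t)]) hM0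
  · exact (hw.abs.mul continuousOn_const).intervalIntegrable_of_Icc hab
  · have hne : ∀ᵐ t : ℝ, t ≠ x₀ := by simp [ae_iff]
    filter_upwards [hne] with t ht _
    have hΨ₀ : ContinuousAt Ψ x₀ := hΨ.continuousAt (Icc_mem_nhds hx₀.1 hx₀.2)
    have hψ₀ : ContinuousAt ψ x₀ := hψ.continuousAt (Icc_mem_nhds hx₀.1 hx₀.2)
    have hΨ₁ : ContinuousAt (fun p : ℝ × ℝ => Ψ p.1) (x₀, Ψ x₀) :=
      ContinuousAt.comp (f := Prod.fst) hΨ₀ continuousAt_fst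
    have hψ₁ : ContinuousAt (fun p : ℝ × ℝ => ψ p.1) (x₀, Ψ x₀) :=
      ContinuousAt.comp (f := Prod.fst) hψ₀ continuousAt_fst
    have hD : (x₀ - t) ^ 2 + (Ψ x₀ - Ψ t) ^ 2 ≠ 0 := by
      have : x₀ - t ≠ 0 := sub_ne_zero.2 ht.symm
      positivity
    have hc : ContinuousAt (fun p : ℝ × ℝ => w t *
        ((Ψ p.1 - Ψ t - ψ p.1 * (p.1 - t)) / ((p.1 - t) ^ 2 + (p.2 - Ψ t) ^ 2)))
        (x₀, Ψ x₀) :=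
      continuousAt_const.mul (ContinuousAt.div (by fun_prop) (by fun_prop) hD)
    exact hc.tendsto.mono_left nhdsWithin_le_nhds

lemma integral_inv_sq_add_one_sub_mul_sq (m : ℝ) :
    ∫ v : ℝ, (v ^ 2 + (1 - m * v) ^ 2)⁻¹ = Real.pi := by
  have hA : 0 < 1 + m ^ 2 := by positivity
  have h1 : ∀ v : ℝ, (v ^ 2 + (1 - m * v) ^ 2)⁻¹ =
      (1 + m ^ 2) * (1 + (-m + (1 + m ^ 2) * v) ^ 2)⁻¹ := by
    intro v
    have : 1 + (-m + (1 + m ^ 2) * v) ^ 2 = (1 + m ^ 2) * (v ^ 2 + (1 - m * v) ^ 2) := by ring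
    rw [this, mul_inv, mul_inv_cancel_left₀ hA.ne']
  simp_rw [h1]
  rw [integral_const_mul, Measure.integral_comp_mul_left (fun u => (1 + (-m + u) ^ 2)⁻¹),
    integral_add_left_eq_self (fun u : ℝ => (1 + u ^ 2)⁻¹), integral_univ_inv_one_add_sq,
    abs_of_pos (inv_pos.2 hA), smul_eq_mul, mul_inv_cancel_left₀ hA.ne']

/-- Approximate-identity property of the Poisson-type kernel of a graph, approached from above. -/
lemma tendsto_integral_poisson_kernel {a b : ℝ} {Ψ ψ w : ℝ → ℝ} {L M : ℝ}
    (hΨ : ContinuousOn Ψ (Icc a b)) (hψ : ContinuousOn ψ (Icc a b))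
    (hw : ContinuousOn w (Icc a b))
    (hL : ∀ x ∈ Icc a b, ∀ t ∈ Icc a b, |Ψ x - Ψ t| ≤ L * |x - t|)
    (hM : ∀ x ∈ Icc a b, ∀ t ∈ Icc a b, |Ψ x - Ψ t - ψ x * (x - t)| ≤ M * (x - t) ^ 2)
    {x₀ : ℝ} (hx₀ : x₀ ∈ Ioo a b) :
    Tendsto (fun p : ℝ × ℝ => ∫ t in a..b, w t *
        ((p.2 - Ψ p.1) / ((p.1 - t) ^ 2 + (p.2 - Ψ t) ^ 2)))
      (𝓝[{p | p.1 ∈ Ioo a b ∧ Ψ p.1 < p.2}] (x₀, Ψ x₀))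
      (𝓝 (Real.pi * w x₀)) := by
  have hab : a ≤ b := (hx₀.1.trans hx₀.2).le
  obtain ⟨W, hW⟩ := isCompact_Icc.exists_bound_of_continuousOn hw
  have hW0 : 0 ≤ W := (norm_nonneg _).trans (hW a (left_mem_Icc.2 hab))
  set l := 𝓝[{p : ℝ × ℝ | p.1 ∈ Ioo a b ∧ Ψ p.1 < p.2}] (x₀, Ψ x₀) with hl
  let g : ℝ × ℝ → ℝ → ℝ := fun p => (Ioc a b).indicator fun t =>
    w t * ((p.2 - Ψ p.1) / ((p.1 - t) ^ 2 + (p.2 - Ψ t) ^ 2))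
  let k : ℝ × ℝ → ℝ → ℝ := fun p v =>
    (p.2 - Ψ p.1) * g p (p.1 + (p.2 - Ψ p.1) * v)
  have hmem : ∀ᶠ p in l, p.1 ∈ Ioo a b ∧ Ψ p.1 < p.2 := self_mem_nhdsWithin
  have hgint : ∀ p : ℝ × ℝ, Ψ p.1 < p.2 → Integrable (g p) := by
    intro p hp
    refine IntegrableOn.integrable_indicator ?_ measurableSet_Ioc
    refine (ContinuousOn.integrableOn_Icc ?_).mono_set Ioc_subset_Icc_self
    refine hw.mul (ContinuousOn.div (by fun_prop) (by fun_prop) fun t _ => ?_)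
    exact (graph_dist_sq_pos hp.ne t).ne'
  have hk_eq : ∀ p : ℝ × ℝ, ∀ v, Ψ p.1 < p.2 → p.1 + (p.2 - Ψ p.1) * v ∈ Ioc a b →
      k p v = w (p.1 + (p.2 - Ψ p.1) * v) * (v ^ 2 +
        (1 + (Ψ p.1 - Ψ (p.1 + (p.2 - Ψ p.1) * v)) / (p.2 - Ψ p.1)) ^ 2)⁻¹ := by
    intro p v hp hv
    have hs : p.2 - Ψ p.1 ≠ 0 := (sub_pos.2 hp).ne'
    simp only [k, g, indicator_of_mem hv]
    set s := p.2 - Ψ p.1 with hs_def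
    have h1 : p.2 - Ψ (p.1 + s * v) = s * (1 + (Ψ p.1 - Ψ (p.1 + s * v)) / s) := by
      rw [mul_add, mul_div_cancel₀ _ hs, hs_def]
      ring
    have h2 : p.1 - (p.1 + s * v) = -(s * v) := by ring
    rw [h1, h2]
    set q := 1 + (Ψ p.1 - Ψ (p.1 + s * v)) / s
    have h3 : (-(s * v)) ^ 2 + (s * q) ^ 2 = s * (s * (v ^ 2 + q ^ 2)) := by ring
    rw [h3, div_mul_cancel_left₀ hs, mul_inv]
    field_simp
  have hkint : ∀ᶠ p in l, ∫ v, k p v = ∫ t in a..b, w t *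
      ((p.2 - Ψ p.1) / ((p.1 - t) ^ 2 + (p.2 - Ψ t) ^ 2)) := by
    filter_upwards [hmem] with p hp
    have hs := sub_pos.2 hp.2
    simp only [k]
    rw [integral_const_mul,
      Measure.integral_comp_mul_left (fun u => g p (p.1 + u)),
      integral_add_left_eq_self (g p), abs_of_pos (inv_pos.2 hs), smul_eq_mul,
      mul_inv_cancel_left₀ hs.ne', intervalIntegral.integral_of_le hab]
    exact integral_indicator measurableSet_Ioc
  have hfst : Tendsto (fun p : ℝ × ℝ => p.1) l (𝓝 x₀) :=
    continuousAt_fst.tendsto.mono_left nhdsWithin_le_nhds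
  have hsnd : Tendsto (fun p : ℝ × ℝ => p.2) l (𝓝 (Ψ x₀)) :=
    continuousAt_snd.tendsto.mono_left nhdsWithin_le_nhds
  have hΨ₀ : ContinuousAt Ψ x₀ := hΨ.continuousAt (Icc_mem_nhds hx₀.1 hx₀.2)
  have hψ₀ : ContinuousAt ψ x₀ := hψ.continuousAt (Icc_mem_nhds hx₀.1 hx₀.2)
  have hw₀ : ContinuousAt w x₀ := hw.continuousAt (Icc_mem_nhds hx₀.1 hx₀.2)
  have hs₀ : Tendsto (fun p : ℝ × ℝ => p.2 - Ψ p.1) l (𝓝 0) := by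
    simpa using hsnd.sub (hΨ₀.tendsto.comp hfst)
  have hlim : Tendsto (fun p => ∫ v, k p v) l
      (𝓝 (∫ v, w x₀ * (v ^ 2 + (1 - ψ x₀ * v) ^ 2)⁻¹)) := by
    refine tendsto_integral_filter_of_dominated_convergence
      (fun v => W * ((3 + 2 * L ^ 2) * (1 + v ^ 2)⁻¹)) ?_ ?_
      ((integrable_inv_one_add_sq.const_mul _).const_mul _) ?_
    · filter_upwards [hmem] with p hp
      have h1 := ((hgint p hp.2).comp_add_left p.1).comp_mul_left' (sub_pos.2 hp.2).ne'
      exact (h1.const_mul (p.2 - Ψ p.1)).aestronglyMeasurable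
    · filter_upwards [hmem] with p hp
      refine .of_forall fun v => ?_
      by_cases hv : p.1 + (p.2 - Ψ p.1) * v ∈ Ioc a b
      · rw [hk_eq p v hp.2 hv, norm_mul]
        have hvI := Ioc_subset_Icc_self hv
        have hs := sub_pos.2 hp.2
        refine mul_le_mul (hW _ hvI) ?_ (norm_nonneg _) hW0
        have hlip := hL p.1 (Ioo_subset_Icc_self hp.1) _ hvI
        set s := p.2 - Ψ p.1
        set c := (Ψ p.1 - Ψ (p.1 + s * v)) / s with hc
        have hc_le : |c| ≤ L * |v| := by
          rw [hc, abs_div, abs_of_pos hs, div_le_iff₀ hs]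
          refine hlip.trans_eq ?_
          rw [sub_add_cancel_left, abs_neg, abs_mul, abs_of_pos hs]
          ring
        have hc_sq : c ^ 2 ≤ L ^ 2 * v ^ 2 := by
          have := pow_le_pow_left₀ (abs_nonneg c) hc_le 2
          rwa [mul_pow, sq_abs, sq_abs] at this
        have hkey : 1 + v ^ 2 ≤ (3 + 2 * L ^ 2) * (v ^ 2 + (1 + c) ^ 2) := by
          nlinarith [sq_nonneg (1 + 2 * c), sq_nonneg v, sq_nonneg (1 + c),
            mul_nonneg (sq_nonneg L) (sq_nonneg (1 + c))]
        have hpos : 0 < v ^ 2 + (1 + c) ^ 2 := by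
          have h1 : 0 < 1 + v ^ 2 := by positivity
          have h2 : (0 : ℝ) < 3 + 2 * L ^ 2 := by positivity
          exact pos_of_mul_pos_right (h1.trans_le hkey) h2.le
        rw [Real.norm_of_nonneg (inv_nonneg.2 hpos.le), ← div_eq_mul_inv,
          le_div_iff₀ (by positivity), mul_comm, ← div_eq_mul_inv, div_le_iff₀ hpos]
        exact hkey
      · have : k p v = 0 := by simp only [k, g, indicator_of_notMem hv, mul_zero]
        rw [this, norm_zero]
        positivity
    · refine .of_forall fun v => ?_
      have hz : Tendsto (fun p : ℝ × ℝ => p.1 + (p.2 - Ψ p.1) * v) l (𝓝 x₀) := by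
        simpa using hfst.add (hs₀.mul_const v)
      have hzmem : ∀ᶠ p in l, p.1 + (p.2 - Ψ p.1) * v ∈ Ioc a b :=
        hz.eventually (Ioc_mem_nhds hx₀.1 hx₀.2)
      have hquot : Tendsto
          (fun p : ℝ × ℝ => (Ψ p.1 - Ψ (p.1 + (p.2 - Ψ p.1) * v)) / (p.2 - Ψ p.1)) l
          (𝓝 (-(ψ x₀ * v))) := by
        have herr : Tendsto (fun p : ℝ × ℝ =>
            (Ψ p.1 - Ψ (p.1 + (p.2 - Ψ p.1) * v)) / (p.2 - Ψ p.1) + ψ p.1 * v) l (𝓝 0) := by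
          refine squeeze_zero_norm' (a := fun p : ℝ × ℝ => M * v ^ 2 * (p.2 - Ψ p.1)) ?_
            (by simpa using hs₀.const_mul (M * v ^ 2))
          filter_upwards [hmem, hzmem] with p hp hv
          have hs := sub_pos.2 hp.2
          have h1 := hM p.1 (Ioo_subset_Icc_self hp.1) _ (Ioc_subset_Icc_self hv)
          set s := p.2 - Ψ p.1
          have h2 : (Ψ p.1 - Ψ (p.1 + s * v)) / s + ψ p.1 * v =
              (Ψ p.1 - Ψ (p.1 + s * v) - ψ p.1 * (p.1 - (p.1 + s * v))) / s := by
            field_simp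
            ring
          rw [h2, Real.norm_eq_abs, abs_div, abs_of_pos hs, div_le_iff₀ hs]
          exact h1.trans_eq (by ring)
        simpa using herr.sub ((hψ₀.tendsto.comp hfst).mul_const v)
      have hne : v ^ 2 + (1 + -(ψ x₀ * v)) ^ 2 ≠ 0 := by
        intro h0
        have hv0 : v = 0 := by nlinarith [sq_nonneg v, sq_nonneg (1 + -(ψ x₀ * v))]
        simp [hv0] at h0
      have hmain := (hw₀.tendsto.comp hz).mul
        ((((hquot.const_add 1).pow 2).const_add (v ^ 2)).inv₀ hne)
      rw [sub_eq_add_neg]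
      refine hmain.congr' ?_
      filter_upwards [hmem, hzmem] with p hp hv
      exact (hk_eq p v hp.2 hv).symm
  rw [integral_const_mul, integral_inv_sq_add_one_sub_mul_sq, mul_comm] at hlim
  exact hlim.congr' hkint

/-- First-order Taylor bound on a convex set for a function with bounded second derivative. -/
lemma abs_sub_sub_deriv_mul_le {Ψ : ℝ → ℝ} {a b M : ℝ}
    (hΨ : ∀ x ∈ Icc a b, DifferentiableAt ℝ Ψ x)
    (hΨ' : ∀ x ∈ Icc a b, DifferentiableAt ℝ (deriv Ψ) x)
    (hM : ∀ x ∈ Icc a b, ‖deriv (deriv Ψ) x‖ ≤ M) {x t : ℝ} (hx : x ∈ Icc a b)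
    (ht : t ∈ Icc a b) :
    |Ψ x - Ψ t - deriv Ψ x * (x - t)| ≤ M * (x - t) ^ 2 := by
  have hsub : uIcc t x ⊆ Icc a b := uIcc_subset_Icc ht hx
  have hM0 : 0 ≤ M := (norm_nonneg _).trans (hM x hx)
  have hd : ∀ u ∈ uIcc t x, HasDerivAt (fun u => Ψ u - deriv Ψ x * u)
      (deriv Ψ u - deriv Ψ x) u := by
    intro u hu
    exact ((hΨ u (hsub hu)).hasDerivAt.sub ((hasDerivAt_id u).const_mul (deriv Ψ x))).congr_deriv
      (by rw [mul_one])
  have hb : ∀ u ∈ uIcc t x, ‖deriv (fun u => Ψ u - deriv Ψ x * u) u‖ ≤ M * |x - t| := by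
    intro u hu
    rw [(hd u hu).deriv]
    refine ((convex_Icc a b).norm_image_sub_le_of_norm_deriv_le hΨ' hM hx (hsub hu)).trans ?_
    refine mul_le_mul_of_nonneg_left ?_ hM0
    rw [Real.norm_eq_abs, abs_sub_comm]
    exact abs_sub_right_of_mem_uIcc hu
  have h1 := (convex_uIcc t x).norm_image_sub_le_of_norm_deriv_le
    (fun u hu => (hd u hu).differentiableAt) hb left_mem_uIcc right_mem_uIcc
  rw [Real.norm_eq_abs, Real.norm_eq_abs, mul_assoc, abs_mul_abs_self, ← sq] at h1
  convert h1 using 2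
  ring

/-- Points of the strip outside the closure of the subgraph lie strictly above the graph. -/
lemma lt_snd_of_notMem_closure_subgraph {Ψ : ℝ → ℝ} {I : Set ℝ} {p : ℝ × ℝ} (hp : p.1 ∈ I)
    (hcl : p ∉ closure {q : ℝ × ℝ | q.1 ∈ I ∧ q.2 < Ψ q.1}) : Ψ p.1 < p.2 := by
  by_contra! hle
  refine hcl (mem_closure_of_tendsto (f := fun y : ℝ => (p.1, y)) (b := 𝓝[<] p.2) ?_ ?_)
  · exact (Continuous.prodMk_right p.1).continuousAt.tendsto.mono_left nhdsWithin_le_nhds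
  · filter_upwards [self_mem_nhdsWithin] with y hy
    exact ⟨hp, (mem_Iio.1 hy).trans_le hle⟩

/-- one-sided limit of the normal derivative of the single-layer potential.
With `n(x) = (−Ψ'(x),1)/√(1+Ψ'(x)²)` the upward unit normal to the graph of `Ψ`,
`∇G(x,y)·n(x) → h(x₀) + F(x₀)` as `(x,y) → (x₀, Ψ x₀)` from within `U₁ ∖ cl Ω`. -/
theorem stmt9 (Ψ h : ℝ → ℝ)
    (hΨ : ∃ V : Set ℝ, IsOpen V ∧ Set.Icc (-1 : ℝ) 1 ⊆ V ∧ AnalyticOnNhd ℝ Ψ V)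
    (hh : ContDiffOn ℝ 1 h (Set.Icc (-1 : ℝ) 1))
    (Ω : Set (ℝ × ℝ)) (hΩ : Ω = {p : ℝ × ℝ | p.1 ∈ Set.Ioo (-1 : ℝ) 1 ∧ p.2 < Ψ p.1})
    (U₁ : Set (ℝ × ℝ)) (hU₁ : U₁ = Set.Ioo (-1 : ℝ) 1 ×ˢ (Set.univ : Set ℝ))
    (G : ℝ × ℝ → ℝ)
    (hG : ∀ p : ℝ × ℝ, G p = (1 / Real.pi) * ∫ t in (-1 : ℝ)..1,
      h t * Real.sqrt (1 + deriv Ψ t ^ 2) *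
        Real.log (Real.sqrt ((p.1 - t) ^ 2 + (p.2 - Ψ t) ^ 2)))
    (F : ℝ → ℝ)
    (hF : ∀ x₀ : ℝ, F x₀ = (1 / (Real.pi * Real.sqrt (1 + deriv Ψ x₀ ^ 2))) *
      ∫ t in (-1 : ℝ)..1, h t * Real.sqrt (1 + deriv Ψ t ^ 2) *
        ((Ψ x₀ - Ψ t - deriv Ψ x₀ * (x₀ - t)) / ((x₀ - t) ^ 2 + (Ψ x₀ - Ψ t) ^ 2))) :
    ∀ x₀ ∈ Set.Ioo (-1 : ℝ) 1,
      Filter.Tendsto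
        (fun p : ℝ × ℝ =>
          (pdy G p - deriv Ψ p.1 * pdx G p) / Real.sqrt (1 + deriv Ψ p.1 ^ 2))
        (𝓝[U₁ \ closure Ω] (x₀, Ψ x₀)) (𝓝 (h x₀ + F x₀)) := by
  intro x₀ hx₀
  obtain ⟨V, -, hV, hA⟩ := hΨ
  have hA₁ : AnalyticOnNhd ℝ Ψ (Icc (-1) 1) := hA.mono hV
  have hA₂ := hA₁.deriv
  have hΨc : ContinuousOn Ψ (Icc (-1) 1) := hA₁.continuousOn
  have hψc : ContinuousOn (deriv Ψ) (Icc (-1) 1) := hA₂.continuousOn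
  obtain ⟨L, hL⟩ := isCompact_Icc.exists_bound_of_continuousOn hψc
  obtain ⟨M, hM⟩ := isCompact_Icc.exists_bound_of_continuousOn hA₂.deriv.continuousOn
  have hlip : ∀ x ∈ Icc (-1 : ℝ) 1, ∀ t ∈ Icc (-1 : ℝ) 1, |Ψ x - Ψ t| ≤ L * |x - t| :=
    fun x hx t ht => (convex_Icc (-1 : ℝ) 1).norm_image_sub_le_of_norm_deriv_le
      (fun u hu => (hA₁ u hu).differentiableAt) hL ht hx
  have htaylor : ∀ x ∈ Icc (-1 : ℝ) 1, ∀ t ∈ Icc (-1 : ℝ) 1,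
      |Ψ x - Ψ t - deriv Ψ x * (x - t)| ≤ M * (x - t) ^ 2 :=
    fun x hx t ht => abs_sub_sub_deriv_mul_le (fun u hu => (hA₁ u hu).differentiableAt)
      (fun u hu => (hA₂ u hu).differentiableAt) hM hx ht
  set w : ℝ → ℝ := fun t => h t * √(1 + deriv Ψ t ^ 2) with hw_def
  have hhc := hh.continuousOn
  have hw : ContinuousOn w (Icc (-1) 1) := by fun_prop
  set S : Set (ℝ × ℝ) := {p | p.1 ∈ Ioo (-1 : ℝ) 1 ∧ Ψ p.1 < p.2} with hS
  have hsub : U₁ \ closure Ω ⊆ S := by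
    rintro p ⟨hpU, hpΩ⟩
    rw [hU₁] at hpU
    rw [hΩ] at hpΩ
    exact ⟨hpU.1, lt_snd_of_notMem_closure_subgraph hpU.1 hpΩ⟩
  refine Tendsto.mono_left ?_ (nhdsWithin_mono _ hsub)
  have hGfun : G = fun p : ℝ × ℝ => (1 / Real.pi) * ∫ t in (-1 : ℝ)..1,
      w t * Real.log (√((p.1 - t) ^ 2 + (p.2 - Ψ t) ^ 2)) := funext hG
  have hnum : ∀ p ∈ S, (1 / Real.pi) * ((∫ t in (-1 : ℝ)..1, w t *
        ((p.2 - Ψ p.1) / ((p.1 - t) ^ 2 + (p.2 - Ψ t) ^ 2))) +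
      ∫ t in (-1 : ℝ)..1, w t * ((Ψ p.1 - Ψ t - deriv Ψ p.1 * (p.1 - t)) /
        ((p.1 - t) ^ 2 + (p.2 - Ψ t) ^ 2))) = pdy G p - deriv Ψ p.1 * pdx G p := by
    intro p hp
    have hD : ∀ t, (p.1 - t) ^ 2 + (p.2 - Ψ t) ^ 2 ≠ 0 :=
      fun t => (graph_dist_sq_pos hp.2.ne t).ne'
    have hint : ∀ {f : ℝ → ℝ}, ContinuousOn f (Icc (-1) 1) → IntervalIntegrable
        (fun t => w t * (f t / ((p.1 - t) ^ 2 + (p.2 - Ψ t) ^ 2))) volume (-1) 1 := by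
      intro f hf
      refine ContinuousOn.intervalIntegrable_of_Icc (by norm_num) ?_
      exact hw.mul (ContinuousOn.div hf (by fun_prop) fun t _ => hD t)
    have hx := ((hasDerivAt_logPotential_fst hΨc hw hp.1 hp.2).const_mul (1 / Real.pi)).deriv
    have hy := ((hasDerivAt_logPotential_snd hΨc hw hp.1 hp.2).const_mul (1 / Real.pi)).deriv
    rw [pdx, pdy, hGfun]
    dsimp only
    rw [hx, hy, mul_left_comm, ← mul_sub, ← intervalIntegral.integral_const_mul,
      ← intervalIntegral.integral_sub (hint (by fun_prop)) ((hint (by fun_prop)).const_mul _),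
      ← intervalIntegral.integral_add (hint (by fun_prop)) (hint (by fun_prop))]
    congr 2
    ext t
    ring
  have hsqrt : √(1 + deriv Ψ x₀ ^ 2) ≠ 0 := (Real.sqrt_pos.2 (by positivity)).ne'
  have hψ₀ : ContinuousAt (deriv Ψ) x₀ := hψc.continuousAt (Icc_mem_nhds hx₀.1 hx₀.2)
  have hden : Tendsto (fun p : ℝ × ℝ => √(1 + deriv Ψ p.1 ^ 2)) (𝓝[S] (x₀, Ψ x₀))
      (𝓝 (√(1 + deriv Ψ x₀ ^ 2))) := by
    have h1 : Tendsto (fun p : ℝ × ℝ => deriv Ψ p.1) (𝓝[S] (x₀, Ψ x₀)) (𝓝 (deriv Ψ x₀)) :=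
      hψ₀.tendsto.comp (continuousAt_fst.tendsto.mono_left nhdsWithin_le_nhds)
    exact ((h1.pow 2).const_add 1).sqrt
  have hlim := (((tendsto_integral_poisson_kernel hΨc hψc hw hlip htaylor hx₀).add
    (tendsto_integral_quadratic_kernel hΨc hψc hw htaylor hx₀)).const_mul
      (1 / Real.pi)).div hden hsqrt
  have hval : h x₀ + F x₀ = (1 / Real.pi) * (Real.pi * w x₀ + ∫ t in (-1 : ℝ)..1, w t *
      ((Ψ x₀ - Ψ t - deriv Ψ x₀ * (x₀ - t)) / ((x₀ - t) ^ 2 + (Ψ x₀ - Ψ t) ^ 2))) /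
        √(1 + deriv Ψ x₀ ^ 2) := by
    rw [hF x₀]
    simp only [hw_def]
    have := Real.pi_ne_zero
    field_simp
  rw [hval]
  refine hlim.congr' ?_
  filter_upwards [self_mem_nhdsWithin] with p hp
  rw [← hnum p hp]
  rfl
end
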